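/- Rüssmann–Vey theorem: let H = (H₁,…,H_n) : (ℂ^{2n},0) → (ℂⁿ,0) be a holomorphic germ with pairwise Poisson-commuting components, and suppose H_i = p_i q_i + r_i where each r_i vanishes to order at least 3 at 0 (r_i ∈ 𝔪³). Then there exist a symplectomorphism germ φ : (ℂ^{2n},0) → (ℂ^{2n},0) and a biholomorphism germ ψ : (ℂⁿ,0) → (ℂⁿ,0) such that H(φ(q,p)) = ψ(p₁q₁, …, p_n q_n) for all (q,p) near 0. -/

import Mathlib

open Filter Topology

/-- The phase space `ℂ^{2n}` with coordinates `(q, p)`. -/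
abbrev Phase (n : ℕ) := (Fin n → ℂ) × (Fin n → ℂ)

/-- The standard symplectic form `ω = Σ dq_i ∧ dp_i` on `ℂ^{2n}`, evaluated on two
tangent vectors. -/
noncomputable def omegaC {n : ℕ} (u v : Phase n) : ℂ :=
  ∑ i, (u.1 i * v.2 i - u.2 i * v.1 i)

/-- The Poisson bracket `{g, h} = Σ_i (∂_{q_i} g ∂_{p_i} h - ∂_{p_i} g ∂_{q_i} h)`
of two functions on `ℂ^{2n}`, at a point `z`. -/
noncomputable def poisson {n : ℕ} (g h : Phase n → ℂ) (z : Phase n) : ℂ :=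
  ∑ i, (fderiv ℂ g z (Pi.single i 1, 0) * fderiv ℂ h z (0, Pi.single i 1) -
        fderiv ℂ g z (0, Pi.single i 1) * fderiv ℂ h z (Pi.single i 1, 0))

/-- `φ` is a symplectomorphism germ of `(ℂ^{2n}, 0)`: it is analytic at `0`, fixes `0`,
and its differential preserves the symplectic form at every point near `0` (as the form
is nondegenerate, the differential is then automatically invertible). -/
def IsSymplectoGerm {n : ℕ} (φ : Phase n → Phase n) : Prop :=
  AnalyticAt ℂ φ 0 ∧ φ 0 = 0 ∧
    ∀ᶠ z in 𝓝 (0 : Phase n), ∀ u v : Phase n,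
      omegaC (fderiv ℂ φ z u) (fderiv ℂ φ z v) = omegaC u v

/-- `r` vanishes to order at least `3` at the origin (`r ∈ 𝔪³`). -/
def VanishesToOrder3 {n : ℕ} (r : Phase n → ℂ) : Prop :=
  r 0 = 0 ∧ fderiv ℂ r 0 = 0 ∧ fderiv ℂ (fderiv ℂ r) 0 = 0

theorem norm_fderiv_le_of_forall_ball {E F : Type} [NormedAddCommGroup E] [NormedSpace ℂ E]
    [NormedAddCommGroup F] [NormedSpace ℂ F] {f : E → F} {c : E} {R M : ℝ} (hR : 0 < R)
    (hd : DifferentiableOn ℂ f (Metric.ball c R)) (hM : ∀ z ∈ Metric.ball c R, ‖f z‖ ≤ M) :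
    ‖fderiv ℂ f c‖ ≤ 2 * M / R := by
  refine Complex.norm_fderiv_le_div_of_mapsTo_ball hd (fun z hz => ?_) hR
  rw [Metric.mem_closedBall, dist_eq_norm]
  have := norm_sub_le (f z) (f c)
  linarith [hM z hz, hM c (Metric.mem_ball_self hR)]

/-- Differentiation under the integral sign: no bound on the derivative is needed, thanks to the
Cauchy estimates. -/
theorem hasFDerivAt_intervalIntegral_of_holomorphic {E F : Type} [NormedAddCommGroup E]
    [NormedSpace ℂ E] [FiniteDimensional ℂ E] [NormedAddCommGroup F] [NormedSpace ℂ F]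
    [CompleteSpace F] {U : Set E} (hU : IsOpen U) {a b : ℝ} {g : ℝ → E → F}
    (hc : ContinuousOn (fun p : ℝ × E => g p.1 p.2) (Set.uIcc a b ×ˢ U))
    (hd : ∀ t ∈ Set.uIcc a b, DifferentiableOn ℂ (g t) U) {x : E} (hx : x ∈ U) :
    ContinuousOn (fun t => fderiv ℂ (g t) x) (Set.uIcc a b) ∧
    HasFDerivAt (fun x => ∫ t in a..b, g t x) (∫ t in a..b, fderiv ℂ (g t) x) x := by
  have : ProperSpace E := FiniteDimensional.proper ℂ E
  obtain ⟨r, hr, hrU⟩ : ∃ r > 0, Metric.closedBall x (2 * r) ⊆ U := by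
    obtain ⟨r, hr, h⟩ := Metric.nhds_basis_closedBall.mem_iff.1 (hU.mem_nhds hx)
    exact ⟨r / 2, by positivity, by simpa [mul_div_cancel₀] using h⟩
  have hsub : Metric.ball x r ⊆ U := fun y hy => hrU (by
    simp only [Metric.mem_ball, Metric.mem_closedBall] at hy ⊢; linarith)
  have hK : IsCompact (Set.uIcc a b ×ˢ Metric.closedBall x (2 * r)) :=
    isCompact_uIcc.prod (isCompact_closedBall _ _)
  have hcK := hc.mono (Set.prod_mono (subset_refl (Set.uIcc a b)) hrU)
  obtain ⟨M, hM⟩ := hK.exists_bound_of_continuousOn hcK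
  have hcont : ∀ y ∈ U, ContinuousOn (fun t => g t y) (Set.uIcc a b) := fun y hy =>
    hc.comp (f := fun t : ℝ => ((t, y) : ℝ × E)) (by fun_prop) (fun t ht => ⟨ht, hy⟩)
  have hf' : ContinuousOn (fun t => fderiv ℂ (g t) x) (Set.uIcc a b) := by
    have huc := hK.uniformContinuousOn_of_continuous hcK
    rw [Metric.uniformContinuousOn_iff] at huc
    rw [Metric.continuousOn_iff]
    intro t ht ε hε
    obtain ⟨δ, hδ, h⟩ := huc (ε * r / 4) (by positivity)
    refine ⟨δ, hδ, fun s hs hst => ?_⟩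
    have hxx : DifferentiableAt ℂ (g s) x := (hd s hs).differentiableAt (hU.mem_nhds hx)
    have hxx' : DifferentiableAt ℂ (g t) x := (hd t ht).differentiableAt (hU.mem_nhds hx)
    have := norm_fderiv_le_of_forall_ball (f := fun y => g s y - g t y) (c := x)
      (M := ε * r / 4) hr (((hd s hs).sub (hd t ht)).mono hsub) (fun z hz => by
        have hz' : z ∈ Metric.closedBall x (2 * r) := by
          simp only [Metric.mem_ball, Metric.mem_closedBall] at hz ⊢; linarith
        have := h (s, z) ⟨hs, hz'⟩ (t, z) ⟨ht, hz'⟩ (by simpa [Prod.dist_eq] using hst)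
        rw [dist_eq_norm] at this
        exact this.le)
    rw [fderiv_fun_sub hxx hxx'] at this
    rw [dist_eq_norm]
    refine this.trans_lt ?_
    rw [div_lt_iff₀ hr]; nlinarith [mul_pos hε hr]
  refine ⟨hf', ?_⟩
  refine intervalIntegral.hasFDerivAt_integral_of_dominated_of_fderiv_le
    (F' := fun x t => fderiv ℂ (g t) x) (bound := fun _ => 2 * M / r) (Metric.ball_mem_nhds x hr)
    ?_ ?_ ?_ ?_ ?_ ?_
  · filter_upwards [hU.mem_nhds hx] with y hy
    exact (((hcont y hy).mono Set.uIoc_subset_uIcc).aestronglyMeasurable measurableSet_uIoc)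
  · exact (hcont x hx).intervalIntegrable
  · exact ((hf'.mono Set.uIoc_subset_uIcc).aestronglyMeasurable measurableSet_uIoc)
  · refine Eventually.of_forall fun t ht y hy => ?_
    have hsub' : Metric.ball y r ⊆ Metric.closedBall x (2 * r) := fun z hz => by
      simp only [Metric.mem_ball, Metric.mem_closedBall] at hz hy ⊢
      linarith [dist_triangle z y x]
    exact norm_fderiv_le_of_forall_ball hr
      ((hd t (Set.uIoc_subset_uIcc ht)).mono (hsub'.trans hrU))
      (fun z hz => hM (t, z) ⟨Set.uIoc_subset_uIcc ht, hsub' hz⟩)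
  · exact intervalIntegrable_const
  · refine Eventually.of_forall fun t ht y hy => ?_
    exact ((hd t (Set.uIoc_subset_uIcc ht)).differentiableAt (hU.mem_nhds (hsub hy))).hasFDerivAt

theorem differentiableOn_intervalIntegral {E F : Type} [NormedAddCommGroup E]
    [NormedSpace ℂ E] [FiniteDimensional ℂ E] [NormedAddCommGroup F] [NormedSpace ℂ F]
    [CompleteSpace F] {U : Set E} (hU : IsOpen U) {a b : ℝ} {g : ℝ → E → F}
    (hc : ContinuousOn (fun p : ℝ × E => g p.1 p.2) (Set.uIcc a b ×ˢ U))
    (hd : ∀ t ∈ Set.uIcc a b, DifferentiableOn ℂ (g t) U) :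
    DifferentiableOn ℂ (fun x => ∫ t in a..b, g t x) U := fun _ hx =>
  (hasFDerivAt_intervalIntegral_of_holomorphic hU hc hd hx).2.differentiableAt.differentiableWithinAt

theorem fderiv_intervalIntegral {E F : Type} [NormedAddCommGroup E]
    [NormedSpace ℂ E] [FiniteDimensional ℂ E] [NormedAddCommGroup F] [NormedSpace ℂ F]
    [CompleteSpace F] {U : Set E} (hU : IsOpen U) {a b : ℝ} {g : ℝ → E → F}
    (hc : ContinuousOn (fun p : ℝ × E => g p.1 p.2) (Set.uIcc a b ×ˢ U))
    (hd : ∀ t ∈ Set.uIcc a b, DifferentiableOn ℂ (g t) U) {x : E} (hx : x ∈ U) (v : E) :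
    fderiv ℂ (fun x => ∫ t in a..b, g t x) x v = ∫ t in a..b, fderiv ℂ (g t) x v := by
  have h := hasFDerivAt_intervalIntegral_of_holomorphic hU hc hd hx
  rw [h.2.fderiv]
  exact ((ContinuousLinearMap.apply ℂ F v).intervalIntegral_comp_comm
    h.1.intervalIntegrable).symm

theorem differentiableOn_circleIntegral {E F : Type} [NormedAddCommGroup E]
    [NormedSpace ℂ E] [FiniteDimensional ℂ E] [NormedAddCommGroup F] [NormedSpace ℂ F]
    [CompleteSpace F] {U : Set E} (hU : IsOpen U) {c : ℂ} {R : ℝ} (hR : 0 ≤ R) {g : ℂ → E → F}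
    (hc : ContinuousOn (fun p : ℂ × E => g p.1 p.2) (Metric.sphere c R ×ˢ U))
    (hd : ∀ t ∈ Metric.sphere c R, DifferentiableOn ℂ (g t) U) :
    DifferentiableOn ℂ (fun x => ∮ t in C(c, R), g t x) U := by
  unfold circleIntegral
  refine differentiableOn_intervalIntegral (g := fun θ x =>
    deriv (circleMap c R) θ • g (circleMap c R θ) x) hU ?_ ?_
  · refine ContinuousOn.smul (by simp only [deriv_circleMap]; fun_prop) ?_
    exact hc.comp (f := fun p : ℝ × E => ((circleMap c R p.1, p.2) : ℂ × E)) (by fun_prop)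
      (fun p hp => ⟨circleMap_mem_sphere _ hR _, hp.2⟩)
  · intro t _
    exact (hd _ (circleMap_mem_sphere _ hR _)).const_smul _

theorem fderiv_circleIntegral {E F : Type} [NormedAddCommGroup E]
    [NormedSpace ℂ E] [FiniteDimensional ℂ E] [NormedAddCommGroup F] [NormedSpace ℂ F]
    [CompleteSpace F] {U : Set E} (hU : IsOpen U) {c : ℂ} {R : ℝ} (hR : 0 ≤ R) {g : ℂ → E → F}
    (hc : ContinuousOn (fun p : ℂ × E => g p.1 p.2) (Metric.sphere c R ×ˢ U))
    (hd : ∀ t ∈ Metric.sphere c R, DifferentiableOn ℂ (g t) U) {x : E} (hx : x ∈ U) (v : E) :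
    fderiv ℂ (fun x => ∮ t in C(c, R), g t x) x v = ∮ t in C(c, R), fderiv ℂ (g t) x v := by
  unfold circleIntegral
  rw [fderiv_intervalIntegral (g := fun θ x =>
    deriv (circleMap c R) θ • g (circleMap c R θ) x) hU ?_ ?_ hx]
  · congr 1; ext θ
    rw [fderiv_fun_const_smul ((hd _ (circleMap_mem_sphere _ hR _)).differentiableAt
      (hU.mem_nhds hx))]
    rfl
  · refine ContinuousOn.smul (by simp only [deriv_circleMap]; fun_prop) ?_
    exact hc.comp (f := fun p : ℝ × E => ((circleMap c R p.1, p.2) : ℂ × E)) (by fun_prop)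
      (fun p hp => ⟨circleMap_mem_sphere _ hR _, hp.2⟩)
  · intro t _
    exact (hd _ (circleMap_mem_sphere _ hR _)).const_smul _

theorem differentiableAt_clm_of_apply {D E F : Type} [NormedAddCommGroup E]
    [NormedSpace ℂ E] [FiniteDimensional ℂ E] [NormedAddCommGroup F] [NormedSpace ℂ F]
    [NormedAddCommGroup D] [NormedSpace ℂ D]
    {g : D → E →L[ℂ] F} {x : D} (h : ∀ v, DifferentiableAt ℂ (fun z => g z v) x) :
    DifferentiableAt ℂ g x := by
  let d := Module.finrank ℂ E
  have hd : d = Module.finrank ℂ (Fin d → ℂ) := (Module.finrank_fin_fun ℂ).symm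
  let e₁ := ContinuousLinearEquiv.ofFinrankEq hd
  let e₂ := (e₁.arrowCongr (1 : F ≃L[ℂ] F)).trans (ContinuousLinearEquiv.piRing (Fin d))
  rw [← Function.id_comp g, ← e₂.symm_comp_self]
  refine e₂.symm.differentiable.differentiableAt.comp x (differentiableAt_pi.mpr fun i => ?_)
  exact h _

theorem DifferentiableOn.fderiv_of_isOpen {E F : Type} [NormedAddCommGroup E]
    [NormedSpace ℂ E] [FiniteDimensional ℂ E] [NormedAddCommGroup F] [NormedSpace ℂ F]
    [CompleteSpace F] {U : Set E} {f : E → F} (hf : DifferentiableOn ℂ f U) (hU : IsOpen U) :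
    DifferentiableOn ℂ (fderiv ℂ f) U := by
  intro x hx
  refine (differentiableAt_clm_of_apply fun v => ?_).differentiableWithinAt
  obtain ⟨r, hr, hrU⟩ : ∃ r > 0, Metric.closedBall x (2 * r) ⊆ U := by
    obtain ⟨r, hr, h⟩ := Metric.nhds_basis_closedBall.mem_iff.1 (hU.mem_nhds hx)
    exact ⟨r / 2, by positivity, by simpa [mul_div_cancel₀] using h⟩
  obtain ⟨ρ, hρ, hρv⟩ : ∃ ρ > 0, ρ * ‖v‖ ≤ r := by
    refine ⟨r / (‖v‖ + 1), by positivity, ?_⟩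
    rw [div_mul_eq_mul_div, div_le_iff₀ (by positivity)]; nlinarith
  have hmem : ∀ z ∈ Metric.ball x r, ∀ t ∈ Metric.closedBall (0 : ℂ) ρ, z + t • v ∈ U := by
    intro z hz t ht
    apply hrU
    rw [Metric.mem_ball, dist_eq_norm] at hz
    rw [mem_closedBall_zero_iff] at ht
    rw [Metric.mem_closedBall, dist_eq_norm, add_sub_right_comm]
    have h1 := norm_add_le (z - x) (t • v)
    rw [norm_smul] at h1
    nlinarith [mul_le_mul_of_nonneg_right ht (norm_nonneg v)]
  have key : ∀ z ∈ Metric.ball x r, fderiv ℂ f z v =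
      (2 * Real.pi * Complex.I : ℂ)⁻¹ • ∮ t in C(0, ρ), ((t - 0) ^ 2)⁻¹ • f (z + t • v) := by
    intro z hz
    have hz0 := hmem z hz 0 (Metric.mem_closedBall_self hρ.le)
    have hd : DifferentiableOn ℂ (fun t : ℂ => f (z + t • v)) (Metric.closedBall 0 ρ) :=
      hf.comp (f := fun t : ℂ => z + t • v) (by fun_prop) (fun t ht => hmem z hz t ht)
    have h1 : HasDerivAt (fun t : ℂ => f (z + t • v)) (fderiv ℂ f z v) 0 := by
      have h2 : HasDerivAt (fun t : ℂ => z + t • v) v 0 := by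
        simpa using ((hasDerivAt_id (0 : ℂ)).smul_const v).const_add z
      have h3 : HasFDerivAt f (fderiv ℂ f z) (z + (0 : ℂ) • v) := by
        simpa using (hf.differentiableAt (hU.mem_nhds (by simpa using hz0))).hasFDerivAt
      exact h3.comp_hasDerivAt 0 h2
    rw [← h1.deriv]
    have h4 := hd.deriv_eq_smul_circleIntegral hρ
    simp only [one_div] at h4
    rw [h4, smul_smul, inv_mul_cancel₀ Complex.two_pi_I_ne_zero, one_smul]
  have hdiff : DifferentiableOn ℂ (fun z => ∮ t in C(0, ρ), ((t - 0) ^ 2)⁻¹ • f (z + t • v))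
      (Metric.ball x r) := by
    refine differentiableOn_circleIntegral Metric.isOpen_ball hρ.le ?_ ?_
    · refine ContinuousOn.smul (ContinuousOn.inv₀ (by fun_prop) fun p hp => ?_) ?_
      · have := hp.1
        rw [mem_sphere_zero_iff_norm] at this
        intro h0
        simp only [sub_zero, ne_eq, OfNat.ofNat_ne_zero, not_false_eq_true, pow_eq_zero_iff] at h0
        rw [h0] at this
        simp at this
        exact hρ.ne this
      · exact hf.continuousOn.comp (f := fun p : ℂ × E => p.2 + p.1 • v) (by fun_prop)
          (fun p hp => hmem _ hp.2 _ (Metric.sphere_subset_closedBall hp.1))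
    · intro t ht
      refine DifferentiableOn.const_smul ?_ _
      exact hf.comp (f := fun z : E => z + t • v) (by fun_prop)
        (fun z hz => hmem _ hz _ (Metric.sphere_subset_closedBall ht))
  exact ((hdiff.const_smul _).congr key).differentiableAt (Metric.ball_mem_nhds x hr)

theorem DifferentiableOn.contDiffOn_nat_of_isOpen {E : Type} [NormedAddCommGroup E]
    [NormedSpace ℂ E] [FiniteDimensional ℂ E] {U : Set E} (hU : IsOpen U) (n : ℕ) :
    ∀ {F : Type} [NormedAddCommGroup F] [NormedSpace ℂ F] [CompleteSpace F] {f : E → F},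
      DifferentiableOn ℂ f U → ContDiffOn ℂ n f U := by
  induction n with
  | zero => intro F _ _ _ f hf; exact contDiffOn_zero.2 hf.continuousOn
  | succ n ih =>
    intro F _ _ _ f hf
    push_cast
    rw [contDiffOn_succ_iff_fderiv_of_isOpen hU]
    exact ⟨hf, by simp, ih (hf.fderiv_of_isOpen hU)⟩

theorem norm_iteratedFDeriv_le_of_forall_ball {E : Type} [NormedAddCommGroup E]
    [NormedSpace ℂ E] [FiniteDimensional ℂ E] {c : E} {s : ℝ} (hs : 0 < s) (n : ℕ) :
    ∀ {F : Type} [NormedAddCommGroup F] [NormedSpace ℂ F] [CompleteSpace F] {f : E → F} {ρ M : ℝ},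
      DifferentiableOn ℂ f (Metric.ball c ρ) → (∀ z ∈ Metric.ball c ρ, ‖f z‖ ≤ M) →
      n * s < ρ → ‖iteratedFDeriv ℂ n f c‖ ≤ M * (2 / s) ^ n := by
  induction n with
  | zero =>
    intro F _ _ _ f ρ M hf hM hρ
    simpa using hM c (Metric.mem_ball_self (by simpa using hρ))
  | succ n ih =>
    intro F _ _ _ f ρ M hf hM hρ
    push_cast at hρ
    rw [← norm_iteratedFDeriv_fderiv]
    have hsub : Metric.ball c (ρ - s) ⊆ Metric.ball c ρ := Metric.ball_subset_ball (by linarith)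
    refine (ih (ρ := ρ - s) (M := 2 * M / s) ((hf.fderiv_of_isOpen Metric.isOpen_ball).mono hsub)
      ?_ (by linarith)).trans (le_of_eq ?_)
    · intro z hz
      have hsub' : Metric.ball z s ⊆ Metric.ball c ρ := Metric.ball_subset_ball' (by
        rw [Metric.mem_ball] at hz; linarith)
      exact norm_fderiv_le_of_forall_ball hs (hf.mono hsub') (fun w hw => hM w (hsub' hw))
    · rw [pow_succ]; ring

/-- Osgood's lemma: complex differentiable functions of several variables are analytic. -/
theorem DifferentiableOn.analyticAt_of_isOpen {E F : Type} [NormedAddCommGroup E]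
    [NormedSpace ℂ E] [FiniteDimensional ℂ E] [NormedAddCommGroup F] [NormedSpace ℂ F]
    [CompleteSpace F] {U : Set E} {f : E → F} (hf : DifferentiableOn ℂ f U) (hU : IsOpen U)
    {x : E} (hx : x ∈ U) : AnalyticAt ℂ f x := by
  have : ProperSpace E := FiniteDimensional.proper ℂ E
  obtain ⟨ρ, hρ, hρU⟩ := Metric.nhds_basis_closedBall.mem_iff.1 (hU.mem_nhds hx)
  obtain ⟨M, hM⟩ := (isCompact_closedBall x ρ).exists_bound_of_continuousOn
    (hf.continuousOn.mono hρU)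
  have hM0 : 0 ≤ M := (norm_nonneg _).trans (hM x (Metric.mem_closedBall_self hρ.le))
  have hfb : DifferentiableOn ℂ f (Metric.ball x ρ) :=
    hf.mono (Metric.ball_subset_closedBall.trans hρU)
  have hbound : ∀ n : ℕ, ‖iteratedFDeriv ℂ n f x‖ ≤ M * (2 / (ρ / (2 * (n + 1)))) ^ n := by
    intro n
    refine norm_iteratedFDeriv_le_of_forall_ball (by positivity) n hfb
      (fun z hz => hM z (Metric.ball_subset_closedBall hz)) ?_
    have hn : (0 : ℝ) ≤ n := Nat.cast_nonneg n
    rw [mul_div_assoc', div_lt_iff₀ (by positivity)]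
    nlinarith
  let p : FormalMultilinearSeries ℂ E F := fun n =>
    ((n.factorial : ℂ)⁻¹) • iteratedFDeriv ℂ n f x
  refine ⟨p, ENNReal.ofReal (ρ / 12), ?_, by simpa using hρ, ?_⟩
  · refine p.le_radius_of_bound (M * 3) fun n => ?_
    rw [Real.coe_toNNReal _ (by positivity)]
    have h1 : ‖p n‖ ≤ (n.factorial : ℝ)⁻¹ * (M * (2 / (ρ / (2 * (n + 1)))) ^ n) := by
      simp only [p, norm_smul, norm_inv, Complex.norm_natCast]
      exact mul_le_mul_of_nonneg_left (hbound n) (by positivity)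
    have h2 : ((n : ℝ) + 1) ^ n / n.factorial ≤ 3 ^ (n + 1) := by
      refine (Real.pow_div_factorial_le_exp ((n : ℝ) + 1) (by positivity) n).trans ?_
      have : Real.exp ((n : ℝ) + 1) = Real.exp 1 ^ (n + 1) := by
        rw [← Real.exp_nat_mul]; simp
      rw [this]
      exact pow_le_pow_left₀ (Real.exp_pos _).le
        (by linarith [Real.exp_one_lt_d9]) _
    calc ‖p n‖ * (ρ / 12) ^ n
        ≤ ((n.factorial : ℝ)⁻¹ * (M * (2 / (ρ / (2 * (n + 1)))) ^ n)) * (ρ / 12) ^ n := by gcongr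
      _ = M * (((n : ℝ) + 1) ^ n / n.factorial) * (1 / 3) ^ n := by
        have : (2 / (ρ / (2 * ((n : ℝ) + 1)))) ^ n * (ρ / 12) ^ n
            = ((n : ℝ) + 1) ^ n * (1 / 3) ^ n := by
          rw [← mul_pow, ← mul_pow]; congr 1; field_simp; norm_num
        rw [div_eq_mul_inv]
        linear_combination ((n.factorial : ℝ)⁻¹ * M) * this
      _ ≤ M * 3 ^ (n + 1) * (1 / 3) ^ n := by gcongr
      _ = M * 3 := by
        rw [pow_succ, one_div, inv_pow]; field_simp
  · intro y hy
    rw [Metric.mem_eball, edist_zero_right, ← ofReal_norm, ENNReal.ofReal_lt_ofReal_iff (by positivity)] at hy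
    have hmem : ∀ t ∈ Metric.ball (0 : ℂ) 2, x + t • y ∈ Metric.ball x ρ := by
      intro t ht
      rw [mem_ball_zero_iff] at ht
      rw [Metric.mem_ball, dist_eq_norm, add_sub_cancel_left, norm_smul]
      nlinarith [norm_nonneg y, norm_nonneg t]
    have hg : DifferentiableOn ℂ (fun t : ℂ => f (x + t • y)) (Metric.ball 0 2) :=
      hfb.comp (f := fun t : ℂ => x + t • y) (by fun_prop) hmem
    have hder : ∀ n : ℕ, ∀ t ∈ Metric.ball (0 : ℂ) 2,
        iteratedDeriv n (fun t : ℂ => f (x + t • y)) t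
          = iteratedFDeriv ℂ n f (x + t • y) (fun _ => y) := by
      intro n
      induction n with
      | zero => intro t _; simp
      | succ n ih =>
        intro t ht
        rw [iteratedDeriv_succ, (Filter.EventuallyEq.deriv_eq
          (Filter.eventually_of_mem (Metric.isOpen_ball.mem_nhds ht) ih)),
          ContDiffAt.deriv_fderiv_add_smul]
        exact ((DifferentiableOn.contDiffOn_nat_of_isOpen Metric.isOpen_ball (n + 1) hfb).contDiffAt
          (Metric.isOpen_ball.mem_nhds (hmem t ht)))
    have := Complex.hasSum_taylorSeries_on_ball hg (z := 1) (by simp)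
    simp only [sub_zero, one_pow, one_smul] at this
    convert this using 2 with n
    rw [hder n 0 (by simp)]
    simp [p]

theorem DifferentiableOn.contDiffAt_of_isOpen {E F : Type} [NormedAddCommGroup E]
    [NormedSpace ℂ E] [FiniteDimensional ℂ E] [NormedAddCommGroup F] [NormedSpace ℂ F]
    [CompleteSpace F] {U : Set E} {f : E → F} (hf : DifferentiableOn ℂ f U) (hU : IsOpen U)
    {x : E} (hx : x ∈ U) {n : WithTop ℕ∞} : ContDiffAt ℂ n f x :=
  (hf.analyticAt_of_isOpen hU hx).contDiffAt

/-- Hadamard's lemma: division by the first variable. -/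
theorem exists_eq_add_smul_of_starShaped {E F : Type} [NormedAddCommGroup E]
    [NormedSpace ℂ E] [FiniteDimensional ℂ E] [NormedAddCommGroup F] [NormedSpace ℂ F]
    [CompleteSpace F] {W : Set (ℂ × E)} (hW : IsOpen W)
    (hstar : ∀ p ∈ W, ∀ τ ∈ Set.Icc (0 : ℝ) 1, ((τ : ℂ) * p.1, p.2) ∈ W) {w : ℂ × E → F}
    (hw : DifferentiableOn ℂ w W) :
    ∃ w' : ℂ × E → F, DifferentiableOn ℂ w' W ∧ ∀ p ∈ W, w p = w (0, p.2) + p.1 • w' p := by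
  have hstar' : ∀ p ∈ W, ∀ τ ∈ Set.uIcc (0 : ℝ) 1, ((τ : ℂ) * p.1, p.2) ∈ W := fun p hp τ hτ =>
    hstar p hp τ (by rwa [Set.uIcc_of_le zero_le_one] at hτ)
  have hw' := hw.fderiv_of_isOpen hW
  have hcont : ContinuousOn (fun p : ℝ × (ℂ × E) =>
      fderiv ℂ w ((p.1 : ℂ) * p.2.1, p.2.2) ((1, 0) : ℂ × E)) (Set.uIcc 0 1 ×ˢ W) := by
    refine ContinuousOn.clm_apply ?_ continuousOn_const
    exact hw'.continuousOn.comp (f := fun p : ℝ × (ℂ × E) => (((p.1 : ℂ) * p.2.1, p.2.2) : ℂ × E))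
      (by fun_prop) (fun p hp => hstar' p.2 hp.2 p.1 hp.1)
  refine ⟨fun p => ∫ τ in (0 : ℝ)..1, fderiv ℂ w ((τ : ℂ) * p.1, p.2) ((1, 0) : ℂ × E),
    differentiableOn_intervalIntegral hW hcont ?_, ?_⟩
  · intro τ hτ
    refine DifferentiableOn.clm_apply ?_ (differentiableOn_const _)
    exact hw'.comp (f := fun p : ℂ × E => (((τ : ℂ) * p.1, p.2) : ℂ × E))
      (by fun_prop) (fun p hp => hstar' p hp τ hτ)
  · intro p hp
    have hder : ∀ τ ∈ Set.uIcc (0 : ℝ) 1, HasDerivAt (fun τ : ℝ => w ((τ : ℂ) * p.1, p.2))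
        (p.1 • fderiv ℂ w ((τ : ℂ) * p.1, p.2) ((1, 0) : ℂ × E)) τ := by
      intro τ hτ
      have h1 : HasFDerivAt w (fderiv ℂ w ((τ : ℂ) * p.1, p.2)) ((τ : ℂ) * p.1, p.2) :=
        (hw.differentiableAt (hW.mem_nhds (hstar' p hp τ hτ))).hasFDerivAt
      have h2 : HasDerivAt (fun s : ℂ => ((s * p.1, p.2) : ℂ × E)) (p.1 • ((1, 0) : ℂ × E)) τ := by
        have := ((hasDerivAt_id (τ : ℂ)).mul_const p.1).prodMk (hasDerivAt_const (τ : ℂ) p.2)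
        simpa using this
      have h3 := HasDerivAt.scomp τ
        (HasFDerivAt.comp_hasDerivAt (x := (τ : ℂ)) (f := fun s : ℂ => ((s * p.1, p.2) : ℂ × E))
          h1 h2) (Complex.ofRealCLM.hasDerivAt (x := τ))
      rw [map_smul] at h3
      simpa [Function.comp_def, -Prod.smul_mk] using h3
    have hci : ContinuousOn (fun τ : ℝ => fderiv ℂ w ((τ : ℂ) * p.1, p.2) ((1, 0) : ℂ × E))
        (Set.uIcc 0 1) := hcont.comp (f := fun τ : ℝ => (τ, p)) (by fun_prop) (fun τ hτ => ⟨hτ, hp⟩)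
    have := intervalIntegral.integral_eq_sub_of_hasDerivAt hder
      (hci.const_smul p.1).intervalIntegrable
    rw [intervalIntegral.integral_smul] at this
    simp only [Complex.ofReal_one, one_mul, Complex.ofReal_zero, zero_mul] at this
    rw [this]; simp

theorem lipschitz_of_bounded_holomorphic {V F : Type} [NormedAddCommGroup V] [NormedSpace ℂ V]
    [NormedAddCommGroup F] [NormedSpace ℂ F] {g : V → F} {r c : ℝ} (hr : 0 < r) (hcr : 16 * c ≤ r)
    (hg : DifferentiableOn ℂ g (Metric.ball 0 r)) (hb : ∀ v ∈ Metric.ball 0 r, ‖g v‖ ≤ c)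
    {v : V} (hv : v ∈ Metric.ball 0 (r / 2)) : ‖fderiv ℂ g v‖ ≤ 1 / 4 := by
  have hsub : Metric.ball v (r / 2) ⊆ Metric.ball 0 r :=
    Metric.ball_subset_ball' (by rw [Metric.mem_ball] at hv; linarith)
  refine (norm_fderiv_le_of_forall_ball (by positivity) (hg.mono hsub)
    (fun z hz => hb z (hsub hz))).trans ?_
  rw [div_le_iff₀ (by positivity)]; linarith

/-- Quantitative inversion of `v ↦ v + g (e, v)`, holomorphic in the parameter `e`. -/
theorem exists_holomorphic_inverse {E V : Type} [NormedAddCommGroup E]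
    [NormedSpace ℂ E] [FiniteDimensional ℂ E] [NormedAddCommGroup V] [NormedSpace ℂ V]
    [FiniteDimensional ℂ V] {U : Set E} (hU : IsOpen U) {r c : ℝ} (hr : 0 < r) (hcr : 16 * c ≤ r)
    {g : E × V → V} (hg : DifferentiableOn ℂ g (U ×ˢ Metric.ball 0 r))
    (hb : ∀ p ∈ U ×ˢ Metric.ball 0 r, ‖g p‖ ≤ c) :
    ∃ P : E × V → V, DifferentiableOn ℂ P (U ×ˢ Metric.ball 0 (r / 4)) ∧
      (∀ p ∈ U ×ˢ Metric.ball (0 : V) (r / 4), P p ∈ Metric.ball 0 (r / 2) ∧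
        P p + g (p.1, P p) = p.2 ∧ ‖P p - p.2‖ ≤ c) ∧
      (∀ e ∈ U, ∀ h : V, ∀ v ∈ Metric.ball (0 : V) (r / 2), ∀ w ∈ Metric.ball (0 : V) (r / 2),
        v + g (e, v) = h → w + g (e, w) = h → v = w) := by
  have : CompleteSpace V := FiniteDimensional.complete ℂ V
  have : CompleteSpace E := FiniteDimensional.complete ℂ E
  have hball : Metric.ball (0 : V) (r / 2) ⊆ Metric.ball 0 r := Metric.ball_subset_ball (by linarith)
  have hge : ∀ e ∈ U, DifferentiableOn ℂ (fun v => g (e, v)) (Metric.ball 0 r) := fun e he =>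
    hg.comp (f := fun v : V => ((e, v) : E × V)) (by fun_prop) (fun v hv => ⟨he, hv⟩)
  have hlip : ∀ e ∈ U, ∀ v ∈ Metric.ball (0 : V) (r / 2), ∀ w ∈ Metric.ball (0 : V) (r / 2),
      ‖g (e, w) - g (e, v)‖ ≤ 1 / 4 * ‖w - v‖ := by
    intro e he v hv w hw
    exact (convex_ball (0 : V) (r / 2)).norm_image_sub_le_of_norm_fderiv_le (𝕜 := ℂ)
      (f := fun v => g (e, v))
      (fun x hx => (hge e he).differentiableAt (Metric.isOpen_ball.mem_nhds (hball hx)))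
      (fun x hx => lipschitz_of_bounded_holomorphic hr hcr (hge e he)
        (fun v hv => hb (e, v) ⟨he, hv⟩) hx) hv hw
  have huniq : ∀ e ∈ U, ∀ h : V, ∀ v ∈ Metric.ball (0 : V) (r / 2),
      ∀ w ∈ Metric.ball (0 : V) (r / 2), v + g (e, v) = h → w + g (e, w) = h → v = w := by
    intro e he h v hv w hw h1 h2
    have h3 := hlip e he v hv w hw
    have h4 : w - v = -(g (e, w) - g (e, v)) := by
      rw [← h1] at h2
      rw [neg_sub, sub_eq_sub_iff_add_eq_add, h2, add_comm]
    have h5 : ‖w - v‖ ≤ 1 / 4 * ‖w - v‖ := by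
      conv_lhs => rw [h4, norm_neg]
      exact h3
    have h6 : ‖w - v‖ = 0 := by linarith [norm_nonneg (w - v)]
    exact (sub_eq_zero.1 (norm_eq_zero.1 h6)).symm
  have hex : ∀ p : E × V, ∃ v : V, p ∈ U ×ˢ Metric.ball (0 : V) (r / 4) →
      v ∈ Metric.ball (0 : V) (r / 2) ∧ v + g (p.1, v) = p.2 ∧ ‖v - p.2‖ ≤ c := by
    rintro ⟨e, h⟩
    by_cases hp : ((e, h) : E × V) ∈ U ×ˢ Metric.ball (0 : V) (r / 4)
    swap
    · exact ⟨0, fun h => absurd h hp⟩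
    have hh : ‖h‖ < r / 4 := by simpa using hp.2
    have he : e ∈ U := hp.1
    have hsub : Metric.closedBall (0 : V) (3 * r / 8) ⊆ Metric.ball 0 (r / 2) :=
      Metric.closedBall_subset_ball (by linarith)
    have hmaps : Set.MapsTo (fun v => h - g (e, v)) (Metric.closedBall (0 : V) (3 * r / 8))
        (Metric.closedBall (0 : V) (3 * r / 8)) := by
      intro v hv
      rw [mem_closedBall_zero_iff]
      have := hb (e, v) ⟨he, hball (hsub hv)⟩
      linarith [norm_sub_le h (g (e, v))]
    have hcontr : ContractingWith (1 / 4 : NNReal) (hmaps.restrict _ _ _) := by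
      refine ⟨by rw [div_lt_iff₀] <;> norm_num, LipschitzWith.of_dist_le_mul fun v w => ?_⟩
      have := hlip e he v (hsub v.2) w (hsub w.2)
      rw [Subtype.dist_eq, Subtype.dist_eq, dist_eq_norm, dist_eq_norm']
      simpa using this
    obtain ⟨v, hv, hfix, -, -⟩ := hcontr.exists_fixedPoint' Metric.isClosed_closedBall.isComplete
      hmaps (Metric.mem_closedBall_self (by positivity)) (edist_ne_top _ _)
    have hfix' : h - g (e, v) = v := hfix
    refine ⟨v, fun _ => ⟨hsub hv, ?_, ?_⟩⟩
    · exact (sub_eq_iff_eq_add.1 hfix').symm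
    · have : v - h = - g (e, v) := by rw [sub_eq_iff_eq_add.1 hfix']; abel
      rw [this, norm_neg]
      exact hb (e, v) ⟨he, hball (hsub hv)⟩
  choose P hP using hex
  refine ⟨P, ?_, hP, huniq⟩
  rintro ⟨e, h⟩ hp
  obtain ⟨hv, hPe, -⟩ := hP (e, h) hp
  have he : e ∈ U := hp.1
  set v := P (e, h) with hvdef
  have hmem : ((e, v) : E × V) ∈ U ×ˢ Metric.ball (0 : V) r := ⟨he, hball hv⟩
  have hop : IsOpen (U ×ˢ Metric.ball (0 : V) r) := hU.prod Metric.isOpen_ball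
  let Φ : E × V → E × V := fun p => (p.1, p.2 + g p)
  have hgs : HasStrictFDerivAt g (fderiv ℂ g (e, v)) (e, v) :=
    (hg.contDiffAt_of_isOpen (n := 1) hop hmem).hasStrictFDerivAt one_ne_zero
  have hΦ : HasStrictFDerivAt Φ ((ContinuousLinearMap.fst ℂ E V).prod
      (ContinuousLinearMap.snd ℂ E V + fderiv ℂ g (e, v))) (e, v) :=
    hasStrictFDerivAt_fst.prodMk (hasStrictFDerivAt_snd.add hgs)
  set L := (ContinuousLinearMap.fst ℂ E V).prod
      (ContinuousLinearMap.snd ℂ E V + fderiv ℂ g (e, v)) with hL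
  have hgv : ∀ w : V, ‖fderiv ℂ g (e, v) (0, w)‖ ≤ 1 / 4 * ‖w‖ := by
    intro w
    have h1 : HasFDerivAt (fun v => g (e, v))
        ((fderiv ℂ g (e, v)).comp (ContinuousLinearMap.inr ℂ E V)) v :=
      hgs.hasFDerivAt.comp v (hasFDerivAt_prodMk_right e v)
    have h2 := lipschitz_of_bounded_holomorphic hr hcr (hge e he)
        (fun v hv => hb (e, v) ⟨he, hv⟩) hv
    rw [h1.fderiv] at h2
    have := ContinuousLinearMap.le_of_opNorm_le _ h2 w
    simpa using this
  have hinj : Function.Injective L := by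
    rw [injective_iff_map_eq_zero]
    rintro ⟨a, w⟩ hz
    have h1 : a = 0 := by simpa [hL] using congrArg Prod.fst hz
    subst h1
    have h2 : w + fderiv ℂ g (e, v) (0, w) = 0 := by simpa [hL] using congrArg Prod.snd hz
    have h3 := hgv w
    rw [← norm_neg, ← eq_neg_of_add_eq_zero_left h2] at h3
    have h4 : w = 0 := norm_eq_zero.1 (by linarith [norm_nonneg w])
    rw [h4]; rfl
  let L' : (E × V) ≃L[ℂ] (E × V) :=
    (LinearEquiv.ofInjectiveEndo (L : (E × V) →ₗ[ℂ] (E × V)) hinj).toContinuousLinearEquiv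
  have hL' : (L' : (E × V) →L[ℂ] (E × V)) = L := by ext <;> rfl
  rw [← hL'] at hΦ
  have hΦv : Φ (e, v) = (e, h) := by simp only [Φ]; rw [hPe]
  have hloc := hΦ.to_localInverse.hasFDerivAt.differentiableAt
  have hri := hΦ.eventually_right_inverse
  have hten := hΦ.localInverse_tendsto
  rw [hΦv] at hloc hri hten
  have hev : ∀ᶠ p in 𝓝 (e, h), P p = (hΦ.localInverse Φ L' (e, v) p).2 := by
    have hop2 : IsOpen (U ×ˢ Metric.ball (0 : V) (r / 2)) := hU.prod Metric.isOpen_ball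
    have hop4 : IsOpen (U ×ˢ Metric.ball (0 : V) (r / 4)) := hU.prod Metric.isOpen_ball
    filter_upwards [hri, hten (hop2.mem_nhds ⟨he, hv⟩), hop4.mem_nhds hp] with p h1 h2 h3
    obtain ⟨h4, h5, -⟩ := hP p h3
    have h6 := congrArg Prod.fst h1
    have h7 := congrArg Prod.snd h1
    simp only [Φ] at h6 h7
    refine huniq p.1 h3.1 p.2 _ h4 _ h2.2 h5 ?_
    rw [← h6] at *
    exact h7
  exact (hloc.snd.congr_of_eventuallyEq hev).differentiableWithinAt

/-- If all the nonnegative moments of `h` on the unit circle vanish, the Cauchy integral over the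
unit circle reproduces `h` on the inner part of its annulus of holomorphy. -/
theorem circleIntegral_sub_inv_mul_of_moments_eq_zero {h : ℂ → ℂ}
    (hh : DifferentiableOn ℂ h {ζ | 1 / 2 < ‖ζ‖ ∧ ‖ζ‖ < 2})
    (hm : ∀ m : ℕ, (∮ ζ in C(0, 1), ζ ^ m * h ζ) = 0) {z : ℂ} (hz : 1 / 2 < ‖z‖)
    (hz1 : ‖z‖ < 1) :
    (∮ ζ in C(0, 1), (ζ - z)⁻¹ * h ζ) = 2 * Real.pi * Complex.I * h z := by
  have hopen : IsOpen {ζ : ℂ | 1 / 2 < ‖ζ‖ ∧ ‖ζ‖ < 2} :=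
    (isOpen_lt continuous_const continuous_norm).inter (isOpen_lt continuous_norm continuous_const)
  obtain ⟨ρ, hρ, hρz⟩ := exists_between hz
  have hρ0 : 0 < ρ := by linarith
  have hmem : ∀ ζ : ℂ, ζ ∈ Metric.closedBall (0 : ℂ) 1 \ Metric.ball 0 ρ →
      ζ ∈ {ζ : ℂ | 1 / 2 < ‖ζ‖ ∧ ‖ζ‖ < 2} := by
    intro ζ hζ
    simp only [Set.mem_sdiff, Metric.mem_closedBall, dist_zero_right, Metric.mem_ball,
      not_lt] at hζ
    exact ⟨by linarith [hζ.2], by linarith [hζ.1]⟩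
  have hsphere : ∀ r, ρ ≤ r → r ≤ 1 → ∀ ζ ∈ Metric.sphere (0 : ℂ) r,
      ζ ∈ {ζ : ℂ | 1 / 2 < ‖ζ‖ ∧ ‖ζ‖ < 2} := by
    intro r h1 h2 ζ hζ
    simp only [mem_sphere_zero_iff_norm] at hζ
    exact ⟨by rw [hζ]; linarith, by rw [hζ]; linarith⟩
  have hzmem : z ∈ {ζ : ℂ | 1 / 2 < ‖ζ‖ ∧ ‖ζ‖ < 2} := ⟨hz, by linarith⟩
  have hhat : ∀ ζ ∈ {ζ : ℂ | 1 / 2 < ‖ζ‖ ∧ ‖ζ‖ < 2}, DifferentiableAt ℂ h ζ := fun ζ hζ =>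
    hh.differentiableAt (hopen.mem_nhds hζ)
  have hmρ : ∀ m : ℕ, (∮ ζ in C(0, ρ), ζ ^ m * h ζ) = 0 := by
    intro m
    refine Eq.trans (Eq.symm ?_) (hm m)
    apply Complex.circleIntegral_eq_of_differentiable_on_annulus_off_countable hρ0
      (by linarith) Set.countable_empty
    · exact ((continuous_pow m).continuousOn).mul (hh.continuousOn.mono hmem)
    · intro ζ hζ
      refine (differentiableAt_pow m).mul (hhat ζ (hmem ζ ?_))
      exact ⟨Metric.ball_subset_closedBall hζ.1.1,
        fun h' => hζ.1.2 (Metric.ball_subset_closedBall h')⟩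
  have hds : (∮ ζ in C(0, 1), dslope h z ζ) = ∮ ζ in C(0, ρ), dslope h z ζ := by
    apply Complex.circleIntegral_eq_of_differentiable_on_annulus_off_countable hρ0
      (by linarith) (Set.countable_singleton z)
    · exact ((continuousOn_dslope (hopen.mem_nhds hzmem)).2
        ⟨hh.continuousOn, hhat z hzmem⟩).mono hmem
    · intro ζ hζ
      have hne : ζ ≠ z := fun h' => hζ.2 h'
      refine (differentiableAt_dslope_of_ne hne).2 (hhat ζ (hmem ζ ?_))
      exact ⟨Metric.ball_subset_closedBall hζ.1.1,
        fun h' => hζ.1.2 (Metric.ball_subset_closedBall h')⟩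
  have hintegr : ∀ r, 0 < r → ρ ≤ r → r ≤ 1 → ‖z‖ ≠ r →
      CircleIntegrable (fun ζ => (ζ - z)⁻¹ * h ζ) 0 r ∧
      CircleIntegrable (fun ζ => (ζ - z)⁻¹ * h z) 0 r := by
    intro r h0 h1 h2 h3
    have hc : ContinuousOn (fun ζ : ℂ => (ζ - z)⁻¹) (Metric.sphere 0 r) := by
      refine ContinuousOn.inv₀ (by fun_prop) ?_
      intro ζ hζ h'
      rw [sub_eq_zero.1 h'] at hζ
      exact h3 (by simpa using hζ)
    exact ⟨(hc.mul (hh.continuousOn.mono (hsphere r h1 h2))).circleIntegrable h0.le,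
      (hc.mul continuousOn_const).circleIntegrable h0.le⟩
  have hsplit : ∀ r, 0 < r → ρ ≤ r → r ≤ 1 → ‖z‖ ≠ r → (∮ ζ in C(0, r), dslope h z ζ) =
      (∮ ζ in C(0, r), (ζ - z)⁻¹ * h ζ) - (∮ ζ in C(0, r), (ζ - z)⁻¹) * h z := by
    intro r h0 h1 h2 h3
    have : (∮ ζ in C(0, r), (ζ - z)⁻¹) * h z = ∮ ζ in C(0, r), (ζ - z)⁻¹ * h z := by
      have := circleIntegral.integral_const_mul (h z) (fun ζ : ℂ => (ζ - z)⁻¹) 0 r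
      rw [mul_comm, ← this]
      simp only [mul_comm]
    rw [this, ← circleIntegral.integral_sub (hintegr r h0 h1 h2 h3).1 (hintegr r h0 h1 h2 h3).2]
    apply circleIntegral.integral_congr h0.le
    intro ζ hζ
    have hne : ζ ≠ z := by
      rintro rfl
      exact h3 (by simpa using hζ)
    simp only [dslope_of_ne _ hne, slope_def_field]
    ring
  have hout : (∮ ζ in C(0, ρ), (ζ - z)⁻¹) = 0 := by
    apply Complex.circleIntegral_eq_zero_of_differentiable_on_off_countable hρ0.le
      Set.countable_empty
    · refine ContinuousOn.inv₀ (by fun_prop) ?_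
      intro ζ hζ h'
      rw [sub_eq_zero.1 h'] at hζ
      have : ‖z‖ ≤ ρ := by simpa using hζ
      linarith
    · intro ζ hζ
      refine DifferentiableAt.inv (by fun_prop) ?_
      intro h'
      have h2 := hζ.1
      rw [sub_eq_zero.1 h'] at h2
      have : ‖z‖ < ρ := by simpa using h2
      linarith
  have hρint : (∮ ζ in C(0, ρ), (ζ - z)⁻¹ * h ζ) = 0 := by
    have hz0 : z ≠ 0 := by
      rintro rfl
      norm_num at hz
    have hne : ∀ ζ ∈ Metric.sphere (0 : ℂ) ρ, ζ - z ≠ 0 := by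
      intro ζ hζ h'
      rw [sub_eq_zero.1 h'] at hζ
      have : ‖z‖ = ρ := by simpa using hζ
      linarith
    have hstep : ∀ N : ℕ, (∮ ζ in C(0, ρ), (ζ - z)⁻¹ * h ζ) =
        ∮ ζ in C(0, ρ), (ζ / z) ^ N * ((ζ - z)⁻¹ * h ζ) := by
      intro N
      induction N with
      | zero => simp
      | succ N ih =>
        rw [ih]
        have hI : ∀ N : ℕ, CircleIntegrable (fun ζ => (ζ / z) ^ N * ((ζ - z)⁻¹ * h ζ)) 0 ρ := by
          intro N
          refine ContinuousOn.circleIntegrable hρ0.le ?_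
          refine ContinuousOn.mul (by fun_prop) (ContinuousOn.mul
            (ContinuousOn.inv₀ (by fun_prop) hne) (hh.continuousOn.mono
            (hsphere ρ le_rfl (by linarith))))
        rw [← sub_eq_zero, ← circleIntegral.integral_sub (hI N) (hI (N + 1))]
        have h0 : (∮ ζ in C(0, ρ), -(z ^ (N + 1))⁻¹ * (ζ ^ N * h ζ)) = 0 := by
          rw [circleIntegral.integral_const_mul, hmρ N, mul_zero]
        refine Eq.trans ?_ h0
        apply circleIntegral.integral_congr hρ0.le
        intro ζ hζ
        have := hne ζ hζ
        simp only [div_pow]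
        field_simp
        ring
    have hcont : ContinuousOn (fun ζ => (ζ - z)⁻¹ * h ζ) (Metric.sphere 0 ρ) :=
      (ContinuousOn.inv₀ (by fun_prop) hne).mul
        (hh.continuousOn.mono (hsphere ρ le_rfl (by linarith)))
    obtain ⟨B, hB⟩ := (isCompact_sphere (0 : ℂ) ρ).exists_bound_of_continuousOn hcont
    have hlim : Tendsto (fun N : ℕ => 2 * Real.pi * ρ * ((ρ / ‖z‖) ^ N * B)) atTop (𝓝 0) := by
      have := tendsto_pow_atTop_nhds_zero_of_lt_one (r := ρ / ‖z‖) (by positivity)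
        ((div_lt_one (by linarith)).2 hρz)
      simpa using (this.mul_const B).const_mul (2 * Real.pi * ρ)
    have hle : ∀ N : ℕ, ‖∮ ζ in C(0, ρ), (ζ - z)⁻¹ * h ζ‖ ≤
        2 * Real.pi * ρ * ((ρ / ‖z‖) ^ N * B) := by
      intro N
      rw [hstep N]
      apply circleIntegral.norm_integral_le_of_norm_le_const hρ0.le
      intro ζ hζ
      rw [norm_mul, norm_pow, norm_div, mem_sphere_zero_iff_norm.1 hζ]
      exact mul_le_mul_of_nonneg_left (hB ζ hζ) (by positivity)
    exact norm_le_zero_iff.1 (ge_of_tendsto' hlim hle)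
  have h1 := hsplit 1 one_pos (by linarith) le_rfl hz1.ne
  have h2 := hsplit ρ hρ0 le_rfl (by linarith) (by linarith)
  rw [hout, hρint, zero_mul, sub_zero, ← hds, h1, sub_eq_zero,
    circleIntegral.integral_sub_inv_of_mem_ball (by simpa using hz1)] at h2
  exact h2

/-- The unit tangent vector in the direction `q_k` of the phase space with a parameter. -/
def qDir {n : ℕ} (k : Fin n) : ℂ × Phase n := (0, (Pi.single k 1, 0))

/-- The unit tangent vector in the direction `p_k` of the phase space with a parameter. -/
def pDir {n : ℕ} (k : Fin n) : ℂ × Phase n := (0, (0, Pi.single k 1))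

/-- Replace the coordinate `q_k` by `ζ`. -/
def setQ {n : ℕ} (k : Fin n) (w : ℂ × Phase n) (ζ : ℂ) : ℂ × Phase n :=
  w + (ζ - w.2.1 k) • qDir k

/-- The polydisc in the phase space with a parameter, from which the discs `|q_j| ≤ 1 / 2` with
`j ∉ J` are removed. -/
def annularDomain {n : ℕ} (J : Finset (Fin n)) : Set (ℂ × Phase n) :=
  {w | ‖w.1‖ < 1 ∧ (∀ j, ‖w.2.1 j‖ < 2) ∧ (∀ j, ‖w.2.2 j‖ < 1 / 16) ∧
    ∀ j, j ∉ J → 1 / 2 < ‖w.2.1 j‖}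

/-- The moments of `g` on the unit circle of the `q_k`-plane. -/
noncomputable def qMoment {n : ℕ} (k : Fin n) (m : ℕ) (g : ℂ × Phase n → ℂ) (w : ℂ × Phase n) :
    ℂ :=
  ∮ ζ in C(0, 1), ζ ^ m * g (setQ k w ζ)

section SetQ

variable {n : ℕ} (k : Fin n) (w : ℂ × Phase n) (ζ : ℂ)

@[simp] theorem setQ_fst : (setQ k w ζ).1 = w.1 := by simp [setQ, qDir]

@[simp] theorem setQ_p : (setQ k w ζ).2.2 = w.2.2 := by simp [setQ, qDir]

@[simp] theorem setQ_q_same : (setQ k w ζ).2.1 k = ζ := by simp [setQ, qDir]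

theorem setQ_q_ne {j : Fin n} (h : j ≠ k) : (setQ k w ζ).2.1 j = w.2.1 j := by
  simp [setQ, qDir, Pi.single_eq_of_ne h]

@[simp] theorem setQ_self : setQ k w (w.2.1 k) = w := by simp [setQ]

theorem setQ_setQ (ξ : ℂ) : setQ k (setQ k w ξ) ζ = setQ k w ζ := by
  unfold setQ
  simp only [Prod.fst_add, Prod.snd_add, Prod.smul_snd, Prod.smul_fst, qDir, Pi.add_apply,
    Pi.smul_apply, Pi.single_eq_same, smul_eq_mul, mul_one]
  rw [add_assoc, ← add_smul]
  congr 2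
  ring

theorem differentiable_setQ_left : Differentiable ℂ (fun w : ℂ × Phase n => setQ k w ζ) := by
  unfold setQ
  fun_prop

theorem hasDerivAt_setQ : HasDerivAt (fun ζ => setQ k w ζ) (qDir k) ζ := by
  unfold setQ
  simpa using (((hasDerivAt_id ζ).sub_const (w.2.1 k)).smul_const (qDir k)).const_add w

theorem continuous_setQ : Continuous (fun p : ℂ × (ℂ × Phase n) => setQ k p.2 p.1) := by
  unfold setQ
  fun_prop

theorem fderiv_setQ_left {v : ℂ × Phase n} (hv : v.2.1 k = 0) :
    fderiv ℂ (fun w : ℂ × Phase n => setQ k w ζ) w v = v := by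
  have h : HasFDerivAt (fun w : ℂ × Phase n => setQ k w ζ)
      (ContinuousLinearMap.id ℂ (ℂ × Phase n) -
        ((ContinuousLinearMap.proj (R := ℂ) (φ := fun _ : Fin n => ℂ) k).comp
          ((ContinuousLinearMap.fst ℂ (Fin n → ℂ) (Fin n → ℂ)).comp
            (ContinuousLinearMap.snd ℂ ℂ (Phase n)))).smulRight (qDir k)) w := by
    have := ((ContinuousLinearMap.id ℂ (ℂ × Phase n) -
        ((ContinuousLinearMap.proj (R := ℂ) (φ := fun _ : Fin n => ℂ) k).comp
          ((ContinuousLinearMap.fst ℂ (Fin n → ℂ) (Fin n → ℂ)).comp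
            (ContinuousLinearMap.snd ℂ ℂ (Phase n)))).smulRight (qDir k)).hasFDerivAt
          (x := w)).add_const (ζ • qDir k)
    refine this.congr_of_eventuallyEq (Eventually.of_forall fun x => ?_)
    simp only [setQ, sub_apply, ContinuousLinearMap.id_apply,
      ContinuousLinearMap.smulRight_apply, ContinuousLinearMap.comp_apply,
      ContinuousLinearMap.proj_apply, sub_smul]
    simp only [ContinuousLinearMap.coe_snd', ContinuousLinearMap.coe_fst']
    abel
  rw [h.fderiv]
  simp [hv]

end SetQ

theorem isOpen_annularDomain {n : ℕ} (J : Finset (Fin n)) : IsOpen (annularDomain J) := by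
  unfold annularDomain
  simp only [Set.ofPred_and, Set.ofPred_forall]
  refine (isOpen_lt (by fun_prop) (by fun_prop)).inter (IsOpen.inter ?_ (IsOpen.inter ?_ ?_))
  · exact isOpen_iInter_of_finite fun j => isOpen_lt (by fun_prop) (by fun_prop)
  · exact isOpen_iInter_of_finite fun j => isOpen_lt (by fun_prop) (by fun_prop)
  · exact isOpen_iInter_of_finite fun j => isOpen_iInter_of_finite fun _ =>
      isOpen_lt (by fun_prop) (by fun_prop)

theorem annularDomain_mono {n : ℕ} {J J' : Finset (Fin n)} (h : J ⊆ J') :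
    annularDomain J ⊆ annularDomain J' :=
  fun _ hw => ⟨hw.1, hw.2.1, hw.2.2.1, fun j hj => hw.2.2.2 j fun hj' => hj (h hj')⟩

theorem annularDomain_star {n : ℕ} {J : Finset (Fin n)} {w : ℂ × Phase n}
    (hw : w ∈ annularDomain J) {τ : ℂ} (hτ : ‖τ‖ < 1) : (τ, w.2) ∈ annularDomain J :=
  ⟨hτ, hw.2⟩

theorem setQ_mem_annularDomain_insert {n : ℕ} {J : Finset (Fin n)} {k : Fin n} {w : ℂ × Phase n}
    (hw : w ∈ annularDomain (insert k J)) {ζ : ℂ} (hζ : ‖ζ‖ < 2) :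
    setQ k w ζ ∈ annularDomain (insert k J) := by
  refine ⟨by simpa using hw.1, fun j => ?_, by simpa using hw.2.2.1, fun j hj => ?_⟩
  · by_cases h : j = k
    · subst h; simpa using hζ
    · rw [setQ_q_ne _ _ _ h]; exact hw.2.1 j
  · have h : j ≠ k := fun h => hj (by simp [h])
    rw [setQ_q_ne _ _ _ h]; exact hw.2.2.2 j hj

theorem setQ_mem_annularDomain {n : ℕ} {J : Finset (Fin n)} {k : Fin n} {w : ℂ × Phase n}
    (hw : w ∈ annularDomain (insert k J)) {ζ : ℂ} (hζ : ‖ζ‖ < 2) (hζ' : 1 / 2 < ‖ζ‖) :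
    setQ k w ζ ∈ annularDomain J := by
  refine ⟨by simpa using hw.1, fun j => ?_, by simpa using hw.2.2.1, fun j hj => ?_⟩
  · by_cases h : j = k
    · subst h; simpa using hζ
    · rw [setQ_q_ne _ _ _ h]; exact hw.2.1 j
  · by_cases h : j = k
    · subst h; simpa using hζ'
    · rw [setQ_q_ne _ _ _ h]; exact hw.2.2.2 j (by simp [h, hj])

section Moments

variable {n : ℕ} {J : Finset (Fin n)} {k : Fin n} {g : ℂ × Phase n → ℂ}

theorem setQ_mem_of_sphere {w : ℂ × Phase n} (hw : w ∈ annularDomain (insert k J)) {ζ : ℂ}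
    (hζ : ζ ∈ Metric.sphere (0 : ℂ) 1) : setQ k w ζ ∈ annularDomain J := by
  have h : ‖ζ‖ = 1 := by simpa using hζ
  exact setQ_mem_annularDomain hw (by rw [h]; norm_num) (by rw [h]; norm_num)

theorem continuousOn_setQ_sphere (hg : ContinuousOn g (annularDomain J)) :
    ContinuousOn (fun p : ℂ × (ℂ × Phase n) => g (setQ k p.2 p.1))
      (Metric.sphere 0 1 ×ˢ annularDomain (insert k J)) :=
  hg.comp (continuous_setQ k).continuousOn fun _ hp => setQ_mem_of_sphere hp.2 hp.1

theorem continuousOn_slice_sphere (hg : ContinuousOn g (annularDomain J)) {w : ℂ × Phase n}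
    (hw : w ∈ annularDomain (insert k J)) :
    ContinuousOn (fun ζ => g (setQ k w ζ)) (Metric.sphere (0 : ℂ) 1) :=
  (continuousOn_setQ_sphere hg).comp (f := fun ζ : ℂ => (ζ, w)) (by fun_prop)
    (fun _ hζ => ⟨hζ, hw⟩)

theorem circleIntegrable_slice (hg : ContinuousOn g (annularDomain J)) {w : ℂ × Phase n}
    (hw : w ∈ annularDomain (insert k J)) (m : ℕ) :
    CircleIntegrable (fun ζ => ζ ^ m * g (setQ k w ζ)) 0 1 :=
  ContinuousOn.circleIntegrable zero_le_one
    ((continuous_pow m).continuousOn.mul (continuousOn_slice_sphere hg hw))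

theorem differentiableOn_slice_left (hg : DifferentiableOn ℂ g (annularDomain J)) {ζ : ℂ}
    (hζ : ζ ∈ Metric.sphere (0 : ℂ) 1) :
    DifferentiableOn ℂ (fun w => g (setQ k w ζ)) (annularDomain (insert k J)) :=
  hg.comp (differentiable_setQ_left k ζ).differentiableOn fun _ hw => setQ_mem_of_sphere hw hζ

theorem differentiableOn_qMoment (hg : DifferentiableOn ℂ g (annularDomain J)) (m : ℕ) :
    DifferentiableOn ℂ (qMoment k m g) (annularDomain (insert k J)) := by
  unfold qMoment
  refine differentiableOn_circleIntegral (g := fun ζ w => ζ ^ m * g (setQ k w ζ))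
    (isOpen_annularDomain _) zero_le_one ?_ ?_
  · exact ContinuousOn.mul (by fun_prop) (continuousOn_setQ_sphere hg.continuousOn)
  · exact fun ζ hζ => (differentiableOn_slice_left hg hζ).const_mul _

theorem fderiv_qMoment (hg : DifferentiableOn ℂ g (annularDomain J)) (m : ℕ) {w : ℂ × Phase n}
    (hw : w ∈ annularDomain (insert k J)) {v : ℂ × Phase n} (hv : v.2.1 k = 0) :
    fderiv ℂ (qMoment k m g) w v = qMoment k m (fun x => fderiv ℂ g x v) w := by
  unfold qMoment
  rw [fderiv_circleIntegral (g := fun ζ w => ζ ^ m * g (setQ k w ζ))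
    (isOpen_annularDomain _) zero_le_one _ _ hw]
  · apply circleIntegral.integral_congr zero_le_one
    intro ζ hζ
    have hgat : DifferentiableAt ℂ g (setQ k w ζ) :=
      hg.differentiableAt ((isOpen_annularDomain J).mem_nhds (setQ_mem_of_sphere hw hζ))
    have hs := (differentiable_setQ_left k ζ) w
    have h2 : fderiv ℂ (fun w => g (setQ k w ζ)) w v = fderiv ℂ g (setQ k w ζ) v := by
      rw [show (fun w => g (setQ k w ζ)) = g ∘ (fun w => setQ k w ζ) from rfl,
        fderiv_comp w hgat hs, ContinuousLinearMap.comp_apply, fderiv_setQ_left _ _ _ hv]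
    simp only
    have hd : DifferentiableAt ℂ (fun w => g (setQ k w ζ)) w := hgat.comp w hs
    rw [fderiv_const_mul hd]
    simp [h2]
  · exact ContinuousOn.mul (by fun_prop) (continuousOn_setQ_sphere hg.continuousOn)
  · exact fun ζ hζ => (differentiableOn_slice_left hg hζ).const_mul _

theorem qMoment_eq_zero_of_differentiableOn (hg : DifferentiableOn ℂ g (annularDomain (insert k J)))
    (m : ℕ) {w : ℂ × Phase n} (hw : w ∈ annularDomain (insert k J)) : qMoment k m g w = 0 := by
  have hat : ∀ ζ ∈ Metric.closedBall (0 : ℂ) 1,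
      DifferentiableAt ℂ (fun ζ => ζ ^ m * g (setQ k w ζ)) ζ := by
    intro ζ hζ
    have hζ' : ‖ζ‖ ≤ 1 := by simpa using hζ
    refine (differentiableAt_pow m).mul ?_
    exact (hg.differentiableAt ((isOpen_annularDomain _).mem_nhds
      (setQ_mem_annularDomain_insert hw (by linarith)))).comp ζ
      (hasDerivAt_setQ k w ζ).differentiableAt
  exact Complex.circleIntegral_eq_zero_of_differentiable_on_off_countable zero_le_one
    Set.countable_empty (fun ζ hζ => (hat ζ hζ).continuousAt.continuousWithinAt)
    fun ζ hζ => hat ζ (Metric.ball_subset_closedBall hζ.1)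

theorem qMoment_succ_fderiv (hg : DifferentiableOn ℂ g (annularDomain J)) (m : ℕ)
    {w : ℂ × Phase n} (hw : w ∈ annularDomain (insert k J)) :
    qMoment k (m + 1) (fun x => fderiv ℂ g x (qDir k)) w = -((m : ℂ) + 1) * qMoment k m g w := by
  have hg' : ContinuousOn (fun x => fderiv ℂ g x (qDir k)) (annularDomain J) :=
    ((hg.fderiv_of_isOpen (isOpen_annularDomain J)).continuousOn).clm_apply continuousOn_const
  have h0 : (∮ ζ in C(0, 1), (((m : ℂ) + 1) * (ζ ^ m * g (setQ k w ζ)) +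
      ζ ^ (m + 1) * fderiv ℂ g (setQ k w ζ) (qDir k))) = 0 := by
    apply circleIntegral.integral_eq_zero_of_hasDerivWithinAt (f := fun ζ =>
      ζ ^ (m + 1) * g (setQ k w ζ)) zero_le_one
    intro ζ hζ
    have hgat : DifferentiableAt ℂ g (setQ k w ζ) :=
      hg.differentiableAt ((isOpen_annularDomain J).mem_nhds (setQ_mem_of_sphere hw hζ))
    have := (hasDerivAt_pow (m + 1) ζ).mul
      (hgat.hasFDerivAt.comp_hasDerivAt ζ (hasDerivAt_setQ k w ζ))
    refine (this.congr_deriv ?_).hasDerivWithinAt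
    push_cast
    simp
    ring
  unfold qMoment
  rw [circleIntegral.integral_add _ (circleIntegrable_slice hg' hw (m + 1)),
    circleIntegral.integral_const_mul] at h0
  · linear_combination h0
  · have := (circleIntegrable_slice hg.continuousOn hw m)
    exact (ContinuousOn.circleIntegrable zero_le_one (continuousOn_const.mul
      ((continuous_pow m).continuousOn.mul (continuousOn_slice_sphere hg.continuousOn hw))))

theorem qMoment_congr {g' : ℂ × Phase n → ℂ} (h : Set.EqOn g g' (annularDomain J)) (m : ℕ)
    {w : ℂ × Phase n} (hw : w ∈ annularDomain (insert k J)) :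
    qMoment k m g w = qMoment k m g' w := by
  apply circleIntegral.integral_congr zero_le_one
  intro ζ hζ
  simp only [h (setQ_mem_of_sphere hw hζ)]

theorem qMoment_add {g' : ℂ × Phase n → ℂ} (hg : ContinuousOn g (annularDomain J))
    (hg' : ContinuousOn g' (annularDomain J)) (m : ℕ)
    {w : ℂ × Phase n} (hw : w ∈ annularDomain (insert k J)) :
    qMoment k m (fun x => g x + g' x) w = qMoment k m g w + qMoment k m g' w := by
  unfold qMoment
  rw [← circleIntegral.integral_add (circleIntegrable_slice hg hw m)
    (circleIntegrable_slice hg' hw m)]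
  simp only [mul_add]

/-- Functions independent of `q_k` may be pulled out of moments in the `q_k`-plane. -/
theorem qMoment_mul_left {c : ℂ × Phase n → ℂ} (hc : ∀ w ζ, c (setQ k w ζ) = c w) (m : ℕ)
    (w : ℂ × Phase n) : qMoment k m (fun x => c x * g x) w = c w * qMoment k m g w := by
  unfold qMoment
  rw [← circleIntegral.integral_const_mul]
  simp only [hc]
  congr 1; ext ζ; ring

theorem qMoment_setQ (m : ℕ) (w : ℂ × Phase n) (ξ : ℂ) :
    qMoment k m g (setQ k w ξ) = qMoment k m g w := by
  unfold qMoment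
  simp only [setQ_setQ]

theorem qMoment_q_mul (m : ℕ) (w : ℂ × Phase n) :
    qMoment k m (fun x => x.2.1 k * g x) w = qMoment k (m + 1) g w := by
  unfold qMoment
  simp only [setQ_q_same, pow_succ, mul_assoc]

/-- A holomorphic function all of whose nonnegative moments in the `q_k`-plane vanish extends
across the disc `|q_k| ≤ 1 / 2`. -/
theorem exists_extension_of_qMoment_eq_zero (hg : DifferentiableOn ℂ g (annularDomain J))
    (h0 : ∀ m, ∀ w ∈ annularDomain (insert k J), qMoment k m g w = 0) :
    ∃ F, DifferentiableOn ℂ F (annularDomain (insert k J)) ∧ Set.EqOn F g (annularDomain J) := by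
  classical
  set c : ℂ × Phase n → ℂ := fun w =>
    ∮ ζ in C(0, 1), (2 * Real.pi * Complex.I)⁻¹ * ((ζ - w.2.1 k)⁻¹ * g (setQ k w ζ)) with hcdef
  set U : Set (ℂ × Phase n) := annularDomain (insert k J) ∩ {w | ‖w.2.1 k‖ < 1} with hU
  have hUo : IsOpen U := (isOpen_annularDomain _).inter (isOpen_lt (by fun_prop) (by fun_prop))
  have hne : ∀ w : ℂ × Phase n, ‖w.2.1 k‖ < 1 → ∀ ζ ∈ Metric.sphere (0 : ℂ) 1,
      ζ - w.2.1 k ≠ 0 := by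
    intro w hw ζ hζ h'
    rw [sub_eq_zero] at h'
    have h1 : ‖ζ‖ = 1 := by simpa using hζ
    rw [h'] at h1
    linarith
  have hc : DifferentiableOn ℂ c U := by
    refine differentiableOn_circleIntegral (g := fun ζ (w : ℂ × Phase n) =>
      (2 * Real.pi * Complex.I)⁻¹ * ((ζ - w.2.1 k)⁻¹ * g (setQ k w ζ))) hUo zero_le_one ?_ ?_
    · refine continuousOn_const.mul (ContinuousOn.mul (ContinuousOn.inv₀ (by fun_prop) ?_) ?_)
      · exact fun p hp => hne p.2 hp.2.2 p.1 hp.1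
      · exact (continuousOn_setQ_sphere hg.continuousOn).mono
          (Set.prod_mono_right Set.inter_subset_left)
    · intro ζ hζ
      refine DifferentiableOn.const_mul (DifferentiableOn.mul
        (DifferentiableOn.inv (by fun_prop) fun w hw => hne w hw.2 ζ hζ) ?_) _
      exact (differentiableOn_slice_left hg hζ).mono Set.inter_subset_left
  have hoverlap : ∀ w ∈ annularDomain J, ‖w.2.1 k‖ < 1 → 1 / 2 < ‖w.2.1 k‖ → c w = g w := by
    intro w hw h1 h2
    have hw' := annularDomain_mono (Finset.subset_insert k J) hw
    have := circleIntegral_sub_inv_mul_of_moments_eq_zero (h := fun ζ => g (setQ k w ζ))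
      (fun ζ hζ => ((hg.differentiableAt ((isOpen_annularDomain _).mem_nhds
        (setQ_mem_annularDomain hw' hζ.2 hζ.1))).comp ζ
        (hasDerivAt_setQ k w ζ).differentiableAt).differentiableWithinAt)
      (fun m => h0 m w hw') h2 h1
    simp only [setQ_self] at this
    simp only [hcdef]
    rw [circleIntegral.integral_const_mul, this]
    have hpi : (2 * Real.pi * Complex.I : ℂ) ≠ 0 := Complex.two_pi_I_ne_zero
    field_simp
  by_cases hk : k ∈ J
  · exact ⟨g, by rwa [Finset.insert_eq_of_mem hk], fun _ _ => rfl⟩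
  refine ⟨fun w => if ‖w.2.1 k‖ < 1 then c w else g w, ?_, ?_⟩
  · intro w hw
    refine DifferentiableAt.differentiableWithinAt ?_
    by_cases h : ‖w.2.1 k‖ < 1
    · refine (hc.differentiableAt (hUo.mem_nhds ⟨hw, h⟩)).congr_of_eventuallyEq ?_
      filter_upwards [hUo.mem_nhds ⟨hw, h⟩] with x hx
      exact if_pos hx.2
    · have hin : ∀ x ∈ annularDomain (insert k J), 1 / 2 < ‖x.2.1 k‖ → x ∈ annularDomain J := by
        intro x hx hx2
        have := setQ_mem_annularDomain hx (hx.2.1 k) hx2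
        rwa [setQ_self] at this
      have hw2 : 1 / 2 < ‖w.2.1 k‖ := by linarith
      have hV : annularDomain (insert k J) ∩ {x | 1 / 2 < ‖x.2.1 k‖} ∈ 𝓝 w :=
        ((isOpen_annularDomain _).inter (isOpen_lt (by fun_prop) (by fun_prop))).mem_nhds
          ⟨hw, hw2⟩
      refine (hg.differentiableAt ((isOpen_annularDomain _).mem_nhds
        (hin w hw hw2))).congr_of_eventuallyEq ?_
      filter_upwards [hV] with x hx
      split_ifs with h1
      · exact hoverlap x (hin x hx.1 hx.2) h1 hx.2
      · rfl
  · intro w hw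
    simp only
    split_ifs with h1
    · exact hoverlap w hw h1 (hw.2.2.2 k hk)
    · rfl

end Moments

/-- The Poisson bracket in the phase variables, with the sign for which `q_k p_k` acts as
`q_k ∂_{q_k} - p_k ∂_{p_k}`. -/
noncomputable def paramBracket {n : ℕ} (f g : ℂ × Phase n → ℂ) (w : ℂ × Phase n) : ℂ :=
  ∑ l, (fderiv ℂ f w (pDir l) * fderiv ℂ g w (qDir l) -
    fderiv ℂ f w (qDir l) * fderiv ℂ g w (pDir l))

theorem eq_zero_of_euler_equation {φ : ℂ → ℂ} {r : ℝ} {N : ℕ} (hN : N ≠ 0)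
    (hφ : ∀ s ∈ Metric.ball (0 : ℂ) r, DifferentiableAt ℂ φ s ∧ s * deriv φ s = -(N : ℂ) * φ s) :
    ∀ s ∈ Metric.ball (0 : ℂ) r, φ s = 0 := by
  intro s hs
  have hr : 0 < r := Metric.pos_of_mem_ball hs
  have hd : ∀ s ∈ Metric.ball (0 : ℂ) r, HasDerivAt (fun s => s ^ N * φ s) 0 s := by
    intro s hs
    refine ((hasDerivAt_pow N s).mul (hφ s hs).1.hasDerivAt).congr_deriv ?_
    obtain ⟨N, rfl⟩ := Nat.exists_eq_succ_of_ne_zero hN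
    have := (hφ s hs).2
    simp only [Nat.succ_eq_add_one, Nat.add_sub_cancel] at this ⊢
    rw [pow_succ]
    linear_combination s ^ N * this
  have hconst := (convex_ball (0 : ℂ) r).is_const_of_fderivWithin_eq_zero (𝕜 := ℂ)
    (f := fun s => s ^ N * φ s)
    (fun s hs => (hd s hs).differentiableAt.differentiableWithinAt)
    (fun s hs => by
      rw [fderivWithin_of_isOpen Metric.isOpen_ball hs]
      ext
      simp [(hd s hs).hasFDerivAt.fderiv]) hs (Metric.mem_ball_self hr)
  simp only [zero_pow hN, zero_mul, mul_eq_zero, pow_eq_zero_iff hN] at hconst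
  rcases hconst with h | h
  · have := (hφ s hs).2
    rw [h, zero_mul] at this
    have hN' : (N : ℂ) ≠ 0 := by exact_mod_cast hN
    rw [h]
    have h2 := this.symm
    simpa [hN'] using h2
  · exact h

theorem eq_zero_of_continuousAt_of_punctured {φ : ℂ → ℂ} {a : ℂ} (hφ : ContinuousAt φ a)
    (h : ∀ᶠ s in 𝓝[≠] a, φ s = 0) : φ a = 0 := by
  refine tendsto_nhds_unique (hφ.tendsto.mono_left (nhdsWithin_le_nhds (s := {a}ᶜ))) ?_
  refine tendsto_const_nhds.congr' ?_
  filter_upwards [h] with s hs using hs.symm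

/-- The identity theorem for the domains `annularDomain J`. -/
theorem eq_zero_of_eq_zero_annularDomain {n : ℕ} {J : Finset (Fin n)} {f : ℂ × Phase n → ℂ}
    (hf : DifferentiableOn ℂ f (annularDomain J)) (h0 : ∀ w ∈ annularDomain (∅ : Finset (Fin n)),
      f w = 0) : ∀ w ∈ annularDomain J, f w = 0 := by
  classical
  induction J using Finset.induction_on with
  | empty => exact h0
  | insert k J hk ih =>
    intro w hw
    have ih' := ih (hf.mono (annularDomain_mono (Finset.subset_insert k J)))
    have han : AnalyticOnNhd ℂ (fun ζ => f (setQ k w ζ)) (Metric.ball 0 2) := by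
      refine DifferentiableOn.analyticOnNhd ?_ Metric.isOpen_ball
      intro ζ hζ
      exact ((hf.differentiableAt ((isOpen_annularDomain _).mem_nhds
        (setQ_mem_annularDomain_insert hw (by simpa using hζ)))).comp ζ
        (hasDerivAt_setQ k w ζ).differentiableAt).differentiableWithinAt
    have hopen : IsOpen {ζ : ℂ | 1 / 2 < ‖ζ‖ ∧ ‖ζ‖ < 2} :=
      (isOpen_lt continuous_const continuous_norm).inter
        (isOpen_lt continuous_norm continuous_const)
    have h1 : (1 : ℂ) ∈ {ζ : ℂ | 1 / 2 < ‖ζ‖ ∧ ‖ζ‖ < 2} := by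
      constructor <;> norm_num
    have := han.eqOn_zero_of_preconnected_of_eventuallyEq_zero
      (convex_ball (0 : ℂ) 2).isPreconnected (z₀ := 1) (by simp) (by
        filter_upwards [hopen.mem_nhds h1] with ζ hζ
        exact ih' _ (setQ_mem_annularDomain hw hζ.2 hζ.1))
    have h2 := this (show w.2.1 k ∈ Metric.ball (0 : ℂ) 2 by simpa using hw.2.1 k)
    simpa using h2

section Extension

variable {n : ℕ} {J : Finset (Fin n)} {k : Fin n} {f : ℂ × Phase n → ℂ}

theorem setQ_zero_fst (k : Fin n) (x : ℂ × Phase n) (ζ : ℂ) :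
    setQ k (0, x.2) ζ = (0, (setQ k x ζ).2) := by
  ext1 <;> simp [setQ, qDir]

theorem zero_snd_mem {x : ℂ × Phase n} (hx : x ∈ annularDomain J) : (0, x.2) ∈ annularDomain J :=
  annularDomain_star hx (by simp)

/-- Inductive extension, order by order in the parameter. -/
theorem exists_extension_of_leading_qMoment_eq_zero
    (hf : DifferentiableOn ℂ f (annularDomain J))
    (H : ∀ (M : ℕ) (F w : ℂ × Phase n → ℂ), DifferentiableOn ℂ F (annularDomain (insert k J)) →
      DifferentiableOn ℂ w (annularDomain J) →
      (∀ x ∈ annularDomain J, f x = F x + x.1 ^ M * w x) →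
      ∀ m, ∀ x ∈ annularDomain (insert k J), qMoment k m w (0, x.2) = 0) :
    ∃ F, DifferentiableOn ℂ F (annularDomain (insert k J)) ∧ Set.EqOn F f (annularDomain J) := by
  have hsub : annularDomain J ⊆ annularDomain (insert k J) :=
    annularDomain_mono (Finset.subset_insert k J)
  have hM : ∀ M : ℕ, ∃ F w : ℂ × Phase n → ℂ,
      DifferentiableOn ℂ F (annularDomain (insert k J)) ∧
      DifferentiableOn ℂ w (annularDomain J) ∧
      ∀ x ∈ annularDomain J, f x = F x + x.1 ^ M * w x := by
    intro M
    induction M with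
    | zero => exact ⟨fun _ => 0, f, by fun_prop, hf, fun x _ => by simp⟩
    | succ M ih =>
      obtain ⟨F, w, hF, hw, h⟩ := ih
      have hw0 : DifferentiableOn ℂ (fun x : ℂ × Phase n => w (0, x.2)) (annularDomain J) :=
        hw.comp (f := fun x : ℂ × Phase n => ((0, x.2) : ℂ × Phase n)) (by fun_prop)
          fun x hx => zero_snd_mem hx
      obtain ⟨G, hG, hGw⟩ := exists_extension_of_qMoment_eq_zero hw0 (k := k) (by
        intro m x hx
        refine Eq.trans ?_ (H M F w hF hw h m x hx)
        unfold qMoment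
        simp only [setQ_zero_fst])
      obtain ⟨w', hw', hww'⟩ := exists_eq_add_smul_of_starShaped (isOpen_annularDomain J)
        (fun p hp τ hτ => annularDomain_star hp (by
          rw [norm_mul, Complex.norm_real, Real.norm_eq_abs, abs_of_nonneg hτ.1]
          have := hp.1
          nlinarith [norm_nonneg p.1, hτ.2])) hw
      refine ⟨fun x => F x + x.1 ^ M * G x, w', ?_, hw', fun x hx => ?_⟩
      · exact hF.add (DifferentiableOn.mul (by fun_prop) hG)
      · have hGx : G x = w (0, x.2) := hGw hx
        simp only
        rw [h x hx, hww' x hx, hGx, smul_eq_mul, pow_succ]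
        ring
  apply exists_extension_of_qMoment_eq_zero hf
  intro m x hx
  have hline : ∀ {g : ℂ × Phase n → ℂ}, DifferentiableOn ℂ g (annularDomain J) →
      AnalyticOnNhd ℂ (fun ε : ℂ => qMoment k m g (ε, x.2)) (Metric.ball 0 1) := by
    intro g hg
    refine DifferentiableOn.analyticOnNhd ?_ Metric.isOpen_ball
    exact (differentiableOn_qMoment hg m).comp (f := fun ε : ℂ => ((ε, x.2) : ℂ × Phase n))
      (by fun_prop) fun ε hε => annularDomain_star hx (by simpa using hε)
  have h0 : (0 : ℂ) ∈ Metric.ball (0 : ℂ) 1 := by simp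
  have htop : analyticOrderAt (fun ε : ℂ => qMoment k m f (ε, x.2)) 0 = ⊤ := by
    rw [ENat.eq_top_iff_forall_ge]
    intro M
    obtain ⟨F, w, hF, hw, h⟩ := hM M
    rw [natCast_le_analyticOrderAt (hline hf 0 h0)]
    refine ⟨_, hline hw 0 h0, ?_⟩
    filter_upwards [Metric.isOpen_ball.mem_nhds h0] with ε hε
    have hεx : (ε, x.2) ∈ annularDomain (insert k J) := annularDomain_star hx (by simpa using hε)
    have hc : ContinuousOn (fun x : ℂ × Phase n => x.1 ^ M * w x) (annularDomain J) :=
      ContinuousOn.mul (by fun_prop) hw.continuousOn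
    rw [qMoment_congr (g' := fun x => F x + x.1 ^ M * w x) h m hεx,
      qMoment_add (hF.continuousOn.mono hsub) hc m hεx,
      qMoment_eq_zero_of_differentiableOn hF m hεx, zero_add,
      qMoment_mul_left (c := fun x => x.1 ^ M) (by simp)]
    simp
  have := (hline hf).eqOn_zero_of_preconnected_of_eventuallyEq_zero
    (convex_ball (0 : ℂ) 1).isPreconnected h0 (analyticOrderAt_eq_top.1 htop)
  exact this (by simpa using hx.1 : x.1 ∈ Metric.ball (0 : ℂ) 1)

theorem differentiableOn_fderiv_apply (hf : DifferentiableOn ℂ f (annularDomain J))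
    (v : ℂ × Phase n) : DifferentiableOn ℂ (fun x => fderiv ℂ f x v) (annularDomain J) :=
  (hf.fderiv_of_isOpen (isOpen_annularDomain J)).clm_apply (differentiableOn_const v)

theorem differentiableOn_paramBracket {g : ℂ × Phase n → ℂ}
    (hf : DifferentiableOn ℂ f (annularDomain J)) (hg : DifferentiableOn ℂ g (annularDomain J)) :
    DifferentiableOn ℂ (paramBracket f g) (annularDomain J) := by
  unfold paramBracket
  refine DifferentiableOn.fun_sum fun l _ => ?_
  exact ((differentiableOn_fderiv_apply hf _).mul (differentiableOn_fderiv_apply hg _)).sub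
    ((differentiableOn_fderiv_apply hf _).mul (differentiableOn_fderiv_apply hg _))

theorem paramBracket_congr_right {K g : ℂ × Phase n → ℂ} (h : Set.EqOn f g (annularDomain J))
    {x : ℂ × Phase n} (hx : x ∈ annularDomain J) : paramBracket K f x = paramBracket K g x := by
  have : f =ᶠ[𝓝 x] g := Filter.eventuallyEq_of_mem ((isOpen_annularDomain J).mem_nhds hx) h
  unfold paramBracket
  rw [this.fderiv_eq]

theorem paramBracket_add_pow_mul {K F w : ℂ × Phase n → ℂ} {M : ℕ} {x : ℂ × Phase n}
    (hF : DifferentiableAt ℂ F x) (hw : DifferentiableAt ℂ w x) :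
    paramBracket K (fun x => F x + x.1 ^ M * w x) x =
      paramBracket K F x + x.1 ^ M * paramBracket K w x := by
  have hd : ∀ v : ℂ × Phase n, v.1 = 0 → fderiv ℂ (fun x => F x + x.1 ^ M * w x) x v =
      fderiv ℂ F x v + x.1 ^ M * fderiv ℂ w x v := by
    intro v hv
    have hp : HasFDerivAt (fun x : ℂ × Phase n => x.1 ^ M)
        ((M * x.1 ^ (M - 1)) • ContinuousLinearMap.fst ℂ ℂ (Phase n)) x :=
      (hasDerivAt_pow M x.1).comp_hasFDerivAt x hasFDerivAt_fst
    rw [(hF.hasFDerivAt.fun_add (hp.fun_mul hw.hasFDerivAt)).fderiv]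
    simp [hv]
  unfold paramBracket
  rw [Finset.mul_sum, ← Finset.sum_add_distrib]
  refine Finset.sum_congr rfl fun l _ => ?_
  rw [hd _ rfl, hd _ rfl]
  ring

/-- Moments of a bracket equation, to leading order in the parameter. -/
theorem qMoment_paramBracket_eq_zero {K F w : ℂ × Phase n → ℂ} {M : ℕ} {δ c : ℂ}
    (hK : DifferentiableOn ℂ K (annularDomain (insert k J)))
    (hF : DifferentiableOn ℂ F (annularDomain (insert k J)))
    (hw : DifferentiableOn ℂ w (annularDomain J))
    (hfw : ∀ x ∈ annularDomain J, f x = F x + x.1 ^ M * w x)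
    (hPB : ∀ x ∈ annularDomain J, paramBracket K f x = δ * f x + c) (m : ℕ) {x : ℂ × Phase n}
    (hx : x ∈ annularDomain (insert k J)) :
    qMoment k m (fun x => paramBracket K w x - δ * w x) (0, x.2) = 0 := by
  have hsub : annularDomain J ⊆ annularDomain (insert k J) :=
    annularDomain_mono (Finset.subset_insert k J)
  have hgd : DifferentiableOn ℂ (fun x => paramBracket K w x - δ * w x) (annularDomain J) :=
    (differentiableOn_paramBracket (hK.mono hsub) hw).sub (hw.const_mul δ)
  have hGd : DifferentiableOn ℂ (fun x => δ * F x + c - paramBracket K F x)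
      (annularDomain (insert k J)) :=
    ((hF.const_mul δ).add_const c).sub (differentiableOn_paramBracket hK hF)
  have hG : Set.EqOn (fun x => x.1 ^ M * (paramBracket K w x - δ * w x))
      (fun x => δ * F x + c - paramBracket K F x) (annularDomain J) := by
    intro x hx
    have h1 := hPB x hx
    rw [paramBracket_congr_right hfw hx, paramBracket_add_pow_mul
      (hF.differentiableAt ((isOpen_annularDomain _).mem_nhds (hsub hx)))
      (hw.differentiableAt ((isOpen_annularDomain _).mem_nhds hx)), hfw x hx] at h1
    simp only
    linear_combination h1
  have hz : ∀ ε : ℂ, ‖ε‖ < 1 → ε ≠ 0 →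
      qMoment k m (fun x => paramBracket K w x - δ * w x) (ε, x.2) = 0 := by
    intro ε hε hε0
    have hεx : (ε, x.2) ∈ annularDomain (insert k J) := annularDomain_star hx hε
    have h1 := qMoment_congr hG m hεx
    rw [qMoment_mul_left (c := fun x => x.1 ^ M) (by simp),
      qMoment_eq_zero_of_differentiableOn hGd m hεx] at h1
    exact (mul_eq_zero.1 h1).resolve_left (pow_ne_zero _ hε0)
  have hcont : ContinuousAt (fun ε : ℂ =>
      qMoment k m (fun x => paramBracket K w x - δ * w x) (ε, x.2)) 0 := by
    have h1 := ((differentiableOn_qMoment hgd m).differentiableAt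
      ((isOpen_annularDomain _).mem_nhds (zero_snd_mem hx))).continuousAt
    exact ContinuousAt.comp (f := fun ε : ℂ => ((ε, x.2) : ℂ × Phase n)) (x := 0) h1
      (by fun_prop)
  have hfin := eq_zero_of_continuousAt_of_punctured hcont ?_
  · exact hfin
  filter_upwards [self_mem_nhdsWithin, mem_nhdsWithin_of_mem_nhds
    (Metric.ball_mem_nhds (0 : ℂ) one_pos)] with ε h1 h2
  exact hz ε (by simpa using h2) h1

theorem fderiv_apply_eq_of_eq_slice {K K' : ℂ × Phase n → ℂ} {U : Set (ℂ × Phase n)}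
    (hU : IsOpen U) {x v : ℂ × Phase n} (hx : x ∈ U) (hK : DifferentiableAt ℂ K x)
    (hK' : DifferentiableAt ℂ K' x) (hx0 : x.1 = 0) (hv0 : v.1 = 0)
    (h : ∀ y ∈ U, y.1 = 0 → K y = K' y) : fderiv ℂ K x v = fderiv ℂ K' x v := by
  have hline : HasDerivAt (fun s : ℂ => x + s • v) v 0 := by
    simpa using ((hasDerivAt_id (0 : ℂ)).smul_const v).const_add x
  have hx' : x + (0 : ℂ) • v = x := by simp
  have h1 : HasDerivAt (fun s : ℂ => K (x + s • v)) (fderiv ℂ K x v) 0 :=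
    HasFDerivAt.comp_hasDerivAt (0 : ℂ) (by rw [hx']; exact hK.hasFDerivAt) hline
  have h2 : HasDerivAt (fun s : ℂ => K' (x + s • v)) (fderiv ℂ K' x v) 0 :=
    HasFDerivAt.comp_hasDerivAt (0 : ℂ) (by rw [hx']; exact hK'.hasFDerivAt) hline
  refine h1.unique (h2.congr_of_eventuallyEq ?_)
  have hmem : ∀ᶠ s in 𝓝 (0 : ℂ), x + s • v ∈ U :=
    hline.continuousAt.eventually_mem (by rw [hx']; exact hU.mem_nhds hx)
  filter_upwards [hmem] with s hs
  exact h _ hs (by simp [hx0, hv0])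

theorem fderiv_q_mul_p {k l : Fin n} (x : ℂ × Phase n) :
    fderiv ℂ (fun w : ℂ × Phase n => w.2.1 k * w.2.2 k) x (pDir l) =
      x.2.1 k * (Pi.single l 1 : Fin n → ℂ) k ∧
    fderiv ℂ (fun w : ℂ × Phase n => w.2.1 k * w.2.2 k) x (qDir l) =
      x.2.2 k * (Pi.single l 1 : Fin n → ℂ) k := by
  have h1 : HasFDerivAt (fun w : ℂ × Phase n => w.2.1 k)
      ((ContinuousLinearMap.proj (R := ℂ) (φ := fun _ : Fin n => ℂ) k).comp
          ((ContinuousLinearMap.fst ℂ (Fin n → ℂ) (Fin n → ℂ)).comp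
            (ContinuousLinearMap.snd ℂ ℂ (Phase n)))) x :=
    ((ContinuousLinearMap.proj (R := ℂ) (φ := fun _ : Fin n => ℂ) k).comp
          ((ContinuousLinearMap.fst ℂ (Fin n → ℂ) (Fin n → ℂ)).comp
            (ContinuousLinearMap.snd ℂ ℂ (Phase n)))).hasFDerivAt
  have h2 : HasFDerivAt (fun w : ℂ × Phase n => w.2.2 k)
      ((ContinuousLinearMap.proj (R := ℂ) (φ := fun _ : Fin n => ℂ) k).comp
          ((ContinuousLinearMap.snd ℂ (Fin n → ℂ) (Fin n → ℂ)).comp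
            (ContinuousLinearMap.snd ℂ ℂ (Phase n)))) x :=
    ((ContinuousLinearMap.proj (R := ℂ) (φ := fun _ : Fin n => ℂ) k).comp
          ((ContinuousLinearMap.snd ℂ (Fin n → ℂ) (Fin n → ℂ)).comp
            (ContinuousLinearMap.snd ℂ ℂ (Phase n)))).hasFDerivAt
  rw [(h1.fun_mul h2).fderiv]
  simp [pDir, qDir]

theorem paramBracket_of_slice_eq_q_mul_p {K g : ℂ × Phase n → ℂ}
    {U : Set (ℂ × Phase n)} (hU : IsOpen U) (hK : DifferentiableOn ℂ K U)
    (hK0 : ∀ x ∈ U, x.1 = 0 → K x = x.2.1 k * x.2.2 k) {x : ℂ × Phase n} (hx : x ∈ U)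
    (hx0 : x.1 = 0) :
    paramBracket K g x =
      x.2.1 k * fderiv ℂ g x (qDir k) - x.2.2 k * fderiv ℂ g x (pDir k) := by
  unfold paramBracket
  have hKat := hK.differentiableAt (hU.mem_nhds hx)
  have hK' : DifferentiableAt ℂ (fun w : ℂ × Phase n => w.2.1 k * w.2.2 k) x := by fun_prop
  have e1 : ∀ l, fderiv ℂ K x (pDir l) = x.2.1 k * (Pi.single l 1 : Fin n → ℂ) k := fun l => by
    rw [fderiv_apply_eq_of_eq_slice hU hx hKat hK' hx0 rfl hK0, (fderiv_q_mul_p x).1]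
  have e2 : ∀ l, fderiv ℂ K x (qDir l) = x.2.2 k * (Pi.single l 1 : Fin n → ℂ) k := fun l => by
    rw [fderiv_apply_eq_of_eq_slice hU hx hKat hK' hx0 rfl hK0, (fderiv_q_mul_p x).2]
  simp only [e1, e2]
  rw [Finset.sum_eq_single k]
  · simp
  · intro l _ hl
    simp [Pi.single_eq_of_ne hl.symm]
  · simp

theorem qMoment_eq_zero_of_paramBracket {K F w : ℂ × Phase n → ℂ} {M m N : ℕ} {δ : ℂ}
    (hN : N ≠ 0) (hNδ : (m : ℂ) + 1 + δ = N)
    (hK : DifferentiableOn ℂ K (annularDomain (insert k J)))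
    (hK0 : ∀ x ∈ annularDomain (insert k J), x.1 = 0 → K x = x.2.1 k * x.2.2 k)
    (hF : DifferentiableOn ℂ F (annularDomain (insert k J)))
    (hw : DifferentiableOn ℂ w (annularDomain J))
    (hfw : ∀ x ∈ annularDomain J, f x = F x + x.1 ^ M * w x)
    (hPB : ∀ x ∈ annularDomain J, paramBracket K f x = δ * f x) {x : ℂ × Phase n}
    (hx : x ∈ annularDomain (insert k J)) : qMoment k m w (0, x.2) = 0 := by
  have hsub : annularDomain J ⊆ annularDomain (insert k J) :=
    annularDomain_mono (Finset.subset_insert k J)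
  have hqd := differentiableOn_fderiv_apply hw (qDir k)
  have hpd := differentiableOn_fderiv_apply hw (pDir k)
  have key : ∀ y ∈ annularDomain (insert k J), y.1 = 0 →
      y.2.2 k * fderiv ℂ (qMoment k m w) y (pDir k) = -(N : ℂ) * qMoment k m w y := by
    intro y hy hy0
    have hy' : (0, y.2) = y := by rw [← hy0]
    have h1 := qMoment_paramBracket_eq_zero hK hF hw hfw
      (fun x hx => by rw [hPB x hx, add_zero]) m hy
    rw [hy'] at h1
    have h2 : qMoment k m (fun x => paramBracket K w x - δ * w x) y =
        qMoment k m (fun x => x.2.1 k * fderiv ℂ w x (qDir k) +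
          ((-x.2.2 k) * fderiv ℂ w x (pDir k) + (-δ) * w x)) y := by
      apply circleIntegral.integral_congr zero_le_one
      intro ζ hζ
      simp only
      rw [paramBracket_of_slice_eq_q_mul_p (isOpen_annularDomain _) hK hK0
        (hsub (setQ_mem_of_sphere hy hζ)) (by simpa using hy0)]
      ring
    have c1 : ContinuousOn (fun x : ℂ × Phase n => (-x.2.2 k) * fderiv ℂ w x (pDir k))
        (annularDomain J) := ContinuousOn.mul (by fun_prop) hpd.continuousOn
    have c2 : ContinuousOn (fun x => (-δ) * w x) (annularDomain J) :=
      continuousOn_const.mul hw.continuousOn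
    have c0 : ContinuousOn (fun x : ℂ × Phase n => x.2.1 k * fderiv ℂ w x (qDir k))
        (annularDomain J) := ContinuousOn.mul (by fun_prop) hqd.continuousOn
    have c3 : ContinuousOn (fun x : ℂ × Phase n => (-x.2.2 k) * fderiv ℂ w x (pDir k) +
        (-δ) * w x) (annularDomain J) := c1.add c2
    rw [h2, qMoment_add c0 c3 m hy, qMoment_add c1 c2 m hy, qMoment_q_mul, qMoment_succ_fderiv hw m hy,
      qMoment_mul_left (c := fun x => -x.2.2 k) (by simp),
      qMoment_mul_left (c := fun _ => -δ) (by simp), ← fderiv_qMoment hw m hy (by simp [pDir])]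
      at h1
    rw [← hNδ]
    linear_combination -h1
  have hmem : ∀ s ∈ Metric.ball (0 : ℂ) (1 / 16),
      ((0, x.2) : ℂ × Phase n) + (s - x.2.2 k) • pDir k ∈ annularDomain (insert k J) := by
    intro s hs
    refine ⟨by simp [pDir], by simpa [pDir] using hx.2.1, fun j => ?_,
      by simpa [pDir] using hx.2.2.2⟩
    by_cases hj : j = k
    · subst hj
      simpa [pDir] using hs
    · simpa [pDir, Pi.single_eq_of_ne hj] using hx.2.2.1 j
  have hode := eq_zero_of_euler_equation (r := 1 / 16)
    (φ := fun s : ℂ => qMoment k m w (((0, x.2) : ℂ × Phase n) + (s - x.2.2 k) • pDir k)) hN (by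
      intro s hs
      have hline : HasDerivAt (fun s : ℂ => ((0, x.2) : ℂ × Phase n) + (s - x.2.2 k) • pDir k)
          (pDir k) s := by
        simpa using (((hasDerivAt_id s).sub_const (x.2.2 k)).smul_const (pDir k)).const_add
          ((0, x.2) : ℂ × Phase n)
      have hd := ((differentiableOn_qMoment hw m).differentiableAt
        ((isOpen_annularDomain _).mem_nhds (hmem s hs))).hasFDerivAt.comp_hasDerivAt s hline
      refine ⟨hd.differentiableAt, ?_⟩
      have h3 := key _ (hmem s hs) (by simp [pDir])
      have hd' : deriv (fun s : ℂ => qMoment k m w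
        (((0, x.2) : ℂ × Phase n) + (s - x.2.2 k) • pDir k)) s = _ := hd.deriv
      rw [hd', ← h3]
      simp [pDir])
  have := hode (x.2.2 k) (by simpa using hx.2.2.1 k)
  simpa using this

end Extension

section Extension

variable {n : ℕ}

theorem eqOn_annularDomain_of_eqOn_empty {J : Finset (Fin n)} {f g : ℂ × Phase n → ℂ}
    (hf : DifferentiableOn ℂ f (annularDomain J)) (hg : DifferentiableOn ℂ g (annularDomain J))
    (h : Set.EqOn f g (annularDomain (∅ : Finset (Fin n)))) : Set.EqOn f g (annularDomain J) := by
  intro x hx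
  rw [← sub_eq_zero]
  exact eq_zero_of_eq_zero_annularDomain (hf.sub hg)
    (fun w hw => by simp only [Pi.sub_apply, h hw, sub_self]) x hx

theorem exists_extension_of_paramBracket {K : Fin n → ℂ × Phase n → ℂ}
    (hK : ∀ k, DifferentiableOn ℂ (K k) (annularDomain Finset.univ))
    (hK0 : ∀ k, ∀ x ∈ annularDomain Finset.univ, x.1 = 0 → K k x = x.2.1 k * x.2.2 k)
    {f : ℂ × Phase n → ℂ} (hf : DifferentiableOn ℂ f (annularDomain ∅)) (δ : Fin n → ℕ)
    (S : Finset (Fin n))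
    (hPB : ∀ k ∈ S, ∀ x ∈ annularDomain ∅, paramBracket (K k) f x = δ k * f x) :
    ∃ F, DifferentiableOn ℂ F (annularDomain S) ∧ Set.EqOn F f (annularDomain ∅) := by
  classical
  induction S using Finset.induction_on with
  | empty => exact ⟨f, hf, fun _ _ => rfl⟩
  | insert k S hk ih =>
    obtain ⟨F, hF, hFf⟩ := ih fun l hl => hPB l (Finset.mem_insert_of_mem hl)
    have hu : ∀ J : Finset (Fin n), annularDomain J ⊆ annularDomain Finset.univ := fun J =>
      annularDomain_mono (Finset.subset_univ J)
    have hPBF : Set.EqOn (paramBracket (K k) F) (fun x => δ k * F x) (annularDomain S) := by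
      refine eqOn_annularDomain_of_eqOn_empty
        (differentiableOn_paramBracket ((hK k).mono (hu S)) hF) (hF.const_mul _) fun x hx => ?_
      rw [paramBracket_congr_right hFf hx, hPB k (Finset.mem_insert_self k S) x hx, hFf hx]
    obtain ⟨F', hF', hF'F⟩ := exists_extension_of_leading_qMoment_eq_zero (k := k) hF (by
      intro M G w hG hw hGw m x hx
      exact qMoment_eq_zero_of_paramBracket (N := m + 1 + δ k) (by omega) (by push_cast; rfl)
        ((hK k).mono (hu _)) (fun x hx => hK0 k x (hu _ hx)) hG hw hGw hPBF hx)
    exact ⟨F', hF', fun x hx =>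
      (hF'F (annularDomain_mono (Finset.empty_subset S) hx)).trans (hFf hx)⟩

theorem paramBracket_of_slice_eq_q {j : Fin n} {X g : ℂ × Phase n → ℂ}
    {U : Set (ℂ × Phase n)} (hU : IsOpen U) (hX : DifferentiableOn ℂ X U)
    (hX0 : ∀ x ∈ U, x.1 = 0 → X x = x.2.1 j) {x : ℂ × Phase n} (hx : x ∈ U)
    (hx0 : x.1 = 0) : paramBracket X g x = - fderiv ℂ g x (pDir j) := by
  unfold paramBracket
  have hXat := hX.differentiableAt (hU.mem_nhds hx)
  have hX' : HasFDerivAt (fun w : ℂ × Phase n => w.2.1 j)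
      ((ContinuousLinearMap.proj (R := ℂ) (φ := fun _ : Fin n => ℂ) j).comp
          ((ContinuousLinearMap.fst ℂ (Fin n → ℂ) (Fin n → ℂ)).comp
            (ContinuousLinearMap.snd ℂ ℂ (Phase n)))) x :=
    ((ContinuousLinearMap.proj (R := ℂ) (φ := fun _ : Fin n => ℂ) j).comp
          ((ContinuousLinearMap.fst ℂ (Fin n → ℂ) (Fin n → ℂ)).comp
            (ContinuousLinearMap.snd ℂ ℂ (Phase n)))).hasFDerivAt
  have e1 : ∀ l, fderiv ℂ X x (pDir l) = 0 := fun l => by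
    rw [fderiv_apply_eq_of_eq_slice hU hx hXat hX'.differentiableAt hx0 rfl hX0, hX'.fderiv]
    simp [pDir]
  have e2 : ∀ l, fderiv ℂ X x (qDir l) = (Pi.single l 1 : Fin n → ℂ) j := fun l => by
    rw [fderiv_apply_eq_of_eq_slice hU hx hXat hX'.differentiableAt hx0 rfl hX0, hX'.fderiv]
    simp [qDir]
  simp only [e1, e2]
  rw [Finset.sum_eq_single j]
  · simp
  · intro l _ hl
    simp [Pi.single_eq_of_ne hl.symm]
  · simp

theorem mem_annularDomain_univ {x : ℂ × Phase n} : x ∈ annularDomain Finset.univ ↔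
    ‖x.1‖ < 1 ∧ (∀ j, ‖x.2.1 j‖ < 2) ∧ ∀ j, ‖x.2.2 j‖ < 1 / 16 := by
  simp [annularDomain]

/-- A holomorphic function whose phase derivatives vanish on the zero slice is constant there. -/
theorem eq_apply_zero_of_fderiv_eq_zero {C : ℂ × Phase n → ℂ}
    (hC : DifferentiableOn ℂ C (annularDomain Finset.univ))
    (hq : ∀ y ∈ annularDomain Finset.univ, y.1 = 0 → ∀ l, fderiv ℂ C y (qDir l) = 0)
    (hp : ∀ y ∈ annularDomain Finset.univ, y.1 = 0 → ∀ l, fderiv ℂ C y (pDir l) = 0)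
    {y : ℂ × Phase n} (hy : y ∈ annularDomain Finset.univ) (hy0 : y.1 = 0) : C y = C 0 := by
  have hz : ∀ x ∈ annularDomain Finset.univ, x.1 = 0 → fderiv ℂ C x y = 0 := by
    intro x hx hx0
    have hdec : y = ∑ l, y.2.1 l • qDir l + ∑ l, y.2.2 l • pDir l := by
      refine Prod.ext ?_ (Prod.ext ?_ ?_)
      · simp [Prod.fst_sum, qDir, pDir, hy0]
      · ext j
        simp [Prod.fst_sum, Prod.snd_sum, qDir, pDir, Finset.sum_apply, Pi.single_apply]
      · ext j
        simp [Prod.snd_sum, qDir, pDir, Finset.sum_apply, Pi.single_apply]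
    rw [hdec]
    simp [map_sum, hq x hx hx0, hp x hx hx0]
  have hmem : ∀ s ∈ Set.Icc (0 : ℝ) 1, (s : ℂ) • y ∈ annularDomain Finset.univ := by
    intro s hs
    rw [mem_annularDomain_univ] at hy ⊢
    have hs1 : ‖(s : ℂ)‖ ≤ 1 := by
      rw [Complex.norm_real, Real.norm_eq_abs, abs_of_nonneg hs.1]; exact hs.2
    have hle : ∀ c : ℂ, ‖(s : ℂ) * c‖ ≤ ‖c‖ := fun c => by
      rw [norm_mul]
      exact mul_le_of_le_one_left (norm_nonneg c) hs1
    exact ⟨(hle _).trans_lt hy.1, fun j => (hle _).trans_lt (hy.2.1 j),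
      fun j => (hle _).trans_lt (hy.2.2 j)⟩
  have hder : ∀ s ∈ Set.Icc (0 : ℝ) 1, HasDerivAt (fun s : ℝ => C ((s : ℂ) • y)) 0 s := by
    intro s hs
    have hline : HasDerivAt (fun s : ℝ => (s : ℂ) • y) y s := by
      simpa using (Complex.ofRealCLM.hasDerivAt (x := s)).smul_const y
    have := ((hC.differentiableAt ((isOpen_annularDomain _).mem_nhds
      (hmem s hs))).hasFDerivAt.restrictScalars ℝ).comp_hasDerivAt s hline
    refine this.congr_deriv ?_
    simpa using hz _ (hmem s hs) (by simp [hy0])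
  have := constant_of_has_deriv_right_zero
    (fun s hs => (hder s hs).continuousAt.continuousWithinAt)
    (fun s hs => (hder s ⟨hs.1, hs.2.le⟩).hasDerivWithinAt) 1 ⟨zero_le_one, le_rfl⟩
  simpa using this

theorem exists_extension_of_conjugate {i : Fin n} {K X : Fin n → ℂ × Phase n → ℂ}
    (hK : ∀ k, DifferentiableOn ℂ (K k) (annularDomain Finset.univ))
    (hK0 : ∀ k, ∀ x ∈ annularDomain Finset.univ, x.1 = 0 → K k x = x.2.1 k * x.2.2 k)
    (hX : ∀ k, DifferentiableOn ℂ (X k) (annularDomain Finset.univ))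
    (hX0 : ∀ k, ∀ x ∈ annularDomain Finset.univ, x.1 = 0 → X k x = x.2.1 k)
    (hKo : ∀ ε, ‖ε‖ < 1 → K i (ε, 0) = 0) (hXo : ∀ ε, ‖ε‖ < 1 → X i (ε, 0) = 0)
    {f : ℂ × Phase n → ℂ} (hf : DifferentiableOn ℂ f (annularDomain ∅))
    (hKf : ∀ k ≠ i, ∀ x ∈ annularDomain ∅, paramBracket (K k) f x = 0)
    (hKfi : ∀ x ∈ annularDomain ∅, paramBracket (K i) f x = -f x)
    (hXf : ∀ j, ∃ c, ∀ x ∈ annularDomain ∅, paramBracket (X j) f x = c)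
    (hXK : ∀ x ∈ annularDomain ∅, X i x * f x = K i x) :
    ∃ F, DifferentiableOn ℂ F (annularDomain Finset.univ) ∧ Set.EqOn F f (annularDomain ∅) := by
  classical
  set S : Finset (Fin n) := Finset.univ.erase i with hS
  have hiS : insert i S = Finset.univ := Finset.insert_erase (Finset.mem_univ i)
  have hu : ∀ J : Finset (Fin n), annularDomain J ⊆ annularDomain Finset.univ := fun J =>
    annularDomain_mono (Finset.subset_univ J)
  obtain ⟨G, hG, hGf⟩ := exists_extension_of_paramBracket hK hK0 hf (fun _ => 0) S
    (fun k hk x hx => by simpa using hKf k (Finset.ne_of_mem_erase hk) x hx)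
  have hKG : ∀ k ≠ i, ∀ x ∈ annularDomain S, paramBracket (K k) G x = 0 * G x + 0 := by
    intro k hk
    refine eqOn_annularDomain_of_eqOn_empty
      (differentiableOn_paramBracket ((hK k).mono (hu S)) hG) ((hG.const_mul _).add_const _)
      fun x hx => ?_
    rw [paramBracket_congr_right hGf hx, hKf k hk x hx]
    ring
  have hKGi : ∀ x ∈ annularDomain S, paramBracket (K i) G x = (-1) * G x := by
    refine eqOn_annularDomain_of_eqOn_empty
      (differentiableOn_paramBracket ((hK i).mono (hu S)) hG) (hG.const_mul _) fun x hx => ?_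
    rw [paramBracket_congr_right hGf hx, hKfi x hx, hGf hx]
    ring
  have hXG : ∀ j, ∃ c, ∀ x ∈ annularDomain S, paramBracket (X j) G x = 0 * G x + c := by
    intro j
    obtain ⟨c, hc⟩ := hXf j
    refine ⟨c, eqOn_annularDomain_of_eqOn_empty
      (differentiableOn_paramBracket ((hX j).mono (hu S)) hG) ((hG.const_mul _).add_const _)
      fun x hx => ?_⟩
    rw [paramBracket_congr_right hGf hx, hc x hx]
    ring
  have hXKG : ∀ x ∈ annularDomain S, X i x * G x = K i x := by
    refine eqOn_annularDomain_of_eqOn_empty (((hX i).mono (hu S)).mul hG)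
      ((hK i).mono (hu S)) fun x hx => ?_
    rw [hGf hx, hXK x hx]
  obtain ⟨F, hF, hFG⟩ := exists_extension_of_leading_qMoment_eq_zero (k := i) hG (by
    intro M F w hF hw hFw m x hx
    rcases Nat.eq_zero_or_pos m with rfl | hm
    · have hC : DifferentiableOn ℂ (qMoment i 0 w) (annularDomain Finset.univ) := by
        rw [← hiS]; exact differentiableOn_qMoment hw 0
      have hp : ∀ y ∈ annularDomain Finset.univ, y.1 = 0 → ∀ l,
          fderiv ℂ (qMoment i 0 w) y (pDir l) = 0 := by
        intro y hy hy0 l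
        have hy' : (0, y.2) = y := by rw [← hy0]
        rw [← hiS] at hy
        obtain ⟨c, hc⟩ := hXG l
        have h1 := qMoment_paramBracket_eq_zero ((hX l).mono (hu _)) hF hw hFw hc 0 hy
        rw [hy'] at h1
        rw [fderiv_qMoment hw 0 hy (by simp [pDir]), ← neg_eq_zero, ← h1,
          ← neg_one_mul, ← qMoment_mul_left (c := fun _ => -1) (by simp)]
        apply circleIntegral.integral_congr zero_le_one
        intro ζ hζ
        simp only
        rw [paramBracket_of_slice_eq_q (isOpen_annularDomain _) (hX l) (hX0 l)
          (hu S (setQ_mem_of_sphere hy hζ)) (by simpa using hy0)]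
        ring
      have hq' : ∀ y ∈ annularDomain Finset.univ, y.1 = 0 → ∀ l ≠ i,
          y.2.1 l * fderiv ℂ (qMoment i 0 w) y (qDir l) = 0 := by
        intro y hy hy0 l hl
        have hy' : (0, y.2) = y := by rw [← hy0]
        have hpl := hp y hy hy0 l
        rw [← hiS] at hy
        have h1 := qMoment_paramBracket_eq_zero ((hK l).mono (hu _)) hF hw hFw (hKG l hl) 0 hy
        rw [hy'] at h1
        have h2 : qMoment i 0 (fun x => paramBracket (K l) w x - 0 * w x) y =
            qMoment i 0 (fun x => x.2.1 l * fderiv ℂ w x (qDir l) +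
              ((-x.2.2 l) * fderiv ℂ w x (pDir l))) y := by
          apply circleIntegral.integral_congr zero_le_one
          intro ζ hζ
          simp only
          rw [paramBracket_of_slice_eq_q_mul_p (isOpen_annularDomain _) (hK l) (hK0 l)
            (hu S (setQ_mem_of_sphere hy hζ)) (by simpa using hy0)]
          ring
        have c0 : ContinuousOn (fun x : ℂ × Phase n => x.2.1 l * fderiv ℂ w x (qDir l))
            (annularDomain S) :=
          ContinuousOn.mul (by fun_prop) (differentiableOn_fderiv_apply hw _).continuousOn
        have c1 : ContinuousOn (fun x : ℂ × Phase n => (-x.2.2 l) * fderiv ℂ w x (pDir l))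
            (annularDomain S) :=
          ContinuousOn.mul (by fun_prop) (differentiableOn_fderiv_apply hw _).continuousOn
        rw [h2, qMoment_add c0 c1 0 hy, qMoment_mul_left (c := fun x => -x.2.2 l) (by simp),
          qMoment_mul_left (c := fun x => x.2.1 l) (fun x ζ => setQ_q_ne _ _ _ hl),
          ← fderiv_qMoment hw 0 hy (v := pDir l) (by simp [pDir]),
          ← fderiv_qMoment hw 0 hy (v := qDir l) (by simp [qDir, Pi.single_eq_of_ne hl.symm]), hpl] at h1
        simpa using h1
      have hsq : ∀ y ∈ annularDomain (Finset.univ : Finset (Fin n)), ∀ l : Fin n, ∀ ζ : ℂ, ‖ζ‖ < 2 →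
          setQ l y ζ ∈ annularDomain Finset.univ := by
        intro y hy l ζ hζ
        have := setQ_mem_annularDomain_insert (J := Finset.univ) (k := l) (w := y)
          (by simpa using hy) hζ
        simpa using this
      have hq : ∀ y ∈ annularDomain Finset.univ, y.1 = 0 → ∀ l,
          fderiv ℂ (qMoment i 0 w) y (qDir l) = 0 := by
        intro y hy hy0 l
        by_cases hl : l = i
        · subst hl
          have h1 := ((hC.differentiableAt ((isOpen_annularDomain _).mem_nhds
            (show setQ l y (y.2.1 l) ∈ annularDomain Finset.univ by
              simpa using hy))).hasFDerivAt).comp_hasDerivAt _ (hasDerivAt_setQ l y (y.2.1 l))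
          rw [setQ_self] at h1
          refine h1.unique ?_
          refine (hasDerivAt_const (y.2.1 l) (qMoment l 0 w y)).congr_of_eventuallyEq ?_
          exact Eventually.of_forall fun ζ => qMoment_setQ 0 y ζ
        · by_cases h0 : y.2.1 l = 0
          · have hy' : setQ l y 0 = y := by rw [← h0, setQ_self]
            have hcont : ContinuousAt (fun ζ => fderiv ℂ (qMoment i 0 w) (setQ l y ζ) (qDir l))
                0 := by
              have h1 : ContinuousAt (fun x => fderiv ℂ (qMoment i 0 w) x (qDir l))
                  (setQ l y 0) := by
                rw [hy']
                exact ((differentiableOn_fderiv_apply hC _).differentiableAt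
                  ((isOpen_annularDomain _).mem_nhds hy)).continuousAt
              exact ContinuousAt.comp (f := fun ζ => setQ l y ζ) (x := 0) h1
                (hasDerivAt_setQ l y 0).continuousAt
            have := eq_zero_of_continuousAt_of_punctured hcont (by
              filter_upwards [self_mem_nhdsWithin, mem_nhdsWithin_of_mem_nhds
                (Metric.ball_mem_nhds (0 : ℂ) two_pos)] with ζ h1 h2
              have h3 := hq' (setQ l y ζ) (hsq y hy l ζ (by simpa using h2))
                (by simpa using hy0) l hl
              rw [setQ_q_same] at h3
              exact (mul_eq_zero.1 h3).resolve_left h1)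
            rwa [hy'] at this
          · exact (mul_eq_zero.1 (hq' y hy hy0 l hl)).resolve_left h0
      rw [hiS] at hx
      rw [eq_apply_zero_of_fderiv_eq_zero hC hq hp (zero_snd_mem hx) rfl]
      have hiS' : i ∉ S := Finset.notMem_erase i _
      have hne : ∀ x ∈ annularDomain S, x.2.1 i ≠ 0 := by
        intro x hx h0
        have := hx.2.2.2 i hiS'
        rw [h0, norm_zero] at this
        norm_num at this
      have hinv : DifferentiableOn ℂ (fun x : ℂ × Phase n => (x.2.1 i)⁻¹) (annularDomain S) :=
        DifferentiableOn.inv (by fun_prop) hne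
      set g : ℂ × Phase n → ℂ := fun x => (x.2.1 i)⁻¹ * (X i x * w x) with hg
      have hgd : DifferentiableOn ℂ g (annularDomain S) :=
        hinv.mul (((hX i).mono (hu S)).mul hw)
      have hmem : ∀ ε : ℂ, ‖ε‖ < 1 → ((ε, 0) : ℂ × Phase n) ∈ annularDomain (insert i S) := by
        intro ε hε
        rw [hiS, mem_annularDomain_univ]
        simp [hε]
      have hzero : ∀ ε : ℂ, ‖ε‖ < 1 → ε ≠ 0 → qMoment i 0 g (ε, 0) = 0 := by
        intro ε hε hε0
        have h1 : qMoment i 0 (fun x => x.1 ^ M * g x) (ε, 0) = ∮ ζ in C(0, 1), (ζ - 0)⁻¹ •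
            (K i (setQ i (ε, 0) ζ) - X i (setQ i (ε, 0) ζ) * F (setQ i (ε, 0) ζ)) := by
          apply circleIntegral.integral_congr zero_le_one
          intro ζ hζ
          have hm := setQ_mem_of_sphere (J := S) (hmem ε hε) hζ
          simp only [hg, setQ_q_same, sub_zero, smul_eq_mul, pow_zero, one_mul]
          rw [← hXKG _ hm, hFw _ hm]
          ring
        have hat : ∀ ζ ∈ Metric.closedBall (0 : ℂ) 1, DifferentiableAt ℂ (fun ζ =>
            K i (setQ i (ε, 0) ζ) - X i (setQ i (ε, 0) ζ) * F (setQ i (ε, 0) ζ)) ζ := by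
          intro ζ hζ
          have hζ' : ‖ζ‖ ≤ 1 := by simpa using hζ
          have hm := setQ_mem_annularDomain_insert (hmem ε hε) (ζ := ζ) (by linarith)
          have hs := (hasDerivAt_setQ i (ε, 0) ζ).differentiableAt
          have hd : ∀ {f : ℂ × Phase n → ℂ}, DifferentiableOn ℂ f (annularDomain (insert i S)) →
              DifferentiableAt ℂ (fun ζ => f (setQ i (ε, 0) ζ)) ζ := fun hf =>
            (hf.differentiableAt ((isOpen_annularDomain _).mem_nhds hm)).comp ζ hs
          exact (hd ((hK i).mono (hu _))).sub ((hd ((hX i).mono (hu _))).mul (hd hF))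
        rw [Complex.circleIntegral_sub_inv_smul_of_differentiable_on_off_countable
          Set.countable_empty (by simp) (fun ζ hζ => (hat ζ hζ).continuousAt.continuousWithinAt)
          (fun ζ hζ => hat ζ (Metric.ball_subset_closedBall hζ.1)),
          qMoment_mul_left (c := fun x => x.1 ^ M) (by simp)] at h1
        have h0 : setQ i ((ε, 0) : ℂ × Phase n) 0 = (ε, 0) := by simp [setQ]
        rw [h0, hKo ε hε, hXo ε hε] at h1
        simpa [hε0] using h1
      have hcont : ContinuousAt (fun ε : ℂ => qMoment i 0 g (ε, 0)) 0 := by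
        have h1 := ((differentiableOn_qMoment hgd 0).differentiableAt
          ((isOpen_annularDomain _).mem_nhds (hmem 0 (by simp)))).continuousAt
        exact ContinuousAt.comp (f := fun ε : ℂ => ((ε, 0) : ℂ × Phase n)) (x := 0) h1
          (by fun_prop)
      have h0 := eq_zero_of_continuousAt_of_punctured hcont (by
        filter_upwards [self_mem_nhdsWithin, mem_nhdsWithin_of_mem_nhds
          (Metric.ball_mem_nhds (0 : ℂ) one_pos)] with ε h1 h2
        exact hzero ε (by simpa using h2) h1)
      rw [← h0]
      apply circleIntegral.integral_congr zero_le_one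
      intro ζ hζ
      have hm := setQ_mem_of_sphere (J := S) (hmem 0 (by simp)) hζ
      have hζ0 : ζ ≠ 0 := by
        rintro rfl
        simp at hζ
      simp only [hg, setQ_q_same]
      rw [show ((0, 0) : ℂ × Phase n) = 0 from rfl] at *
      rw [hX0 i _ (hu _ hm) (by simp), setQ_q_same]
      field_simp
    · exact qMoment_eq_zero_of_paramBracket (N := m) hm.ne' (by ring)
        ((hK i).mono (hu _)) (fun x hx => hK0 i x (hu _ hx)) hF hw hFw hKGi hx)
  refine ⟨F, by rwa [hiS] at hF, fun x hx => ?_⟩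
  exact (hFG (annularDomain_mono (Finset.empty_subset S) hx)).trans (hGf hx)

end Extension

/-- The strip `|Re t_j| < log 2` in logarithmic coordinates, with a parameter in the unit disc. -/
def logStrip (n : ℕ) : Set (ℂ × (Fin n → ℂ)) :=
  {e | ‖e.1‖ < 1 ∧ ∀ j, |(e.2 j).re| < Real.log 2}

/-- The canonical chart `(t, P) ↦ (e^t, P e^{-t})`, with a parameter. -/
noncomputable def logChart {n : ℕ} (x : (ℂ × (Fin n → ℂ)) × (Fin n → ℂ)) : ℂ × Phase n :=
  (x.1.1, (fun j => Complex.exp (x.1.2 j), fun j => x.2 j * Complex.exp (-x.1.2 j)))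

theorem isOpen_logStrip (n : ℕ) : IsOpen (logStrip n) := by
  have : logStrip n = {e | ‖e.1‖ < 1} ∩ ⋂ j, {e | |(e.2 j).re| < Real.log 2} := by
    ext e; simp [logStrip]
  rw [this]
  refine (isOpen_lt (by fun_prop) (by fun_prop)).inter (isOpen_iInter_of_finite fun j => ?_)
  exact isOpen_lt (continuous_abs.comp (Complex.continuous_re.comp (by fun_prop))) (by fun_prop)

theorem differentiable_logChart {n : ℕ} :
    Differentiable ℂ (logChart : (ℂ × (Fin n → ℂ)) × (Fin n → ℂ) → ℂ × Phase n) := by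
  unfold logChart
  fun_prop

theorem fderiv_logChart {n : ℕ} (x v : (ℂ × (Fin n → ℂ)) × (Fin n → ℂ)) :
    fderiv ℂ logChart x v = (v.1.1, (fun j => Complex.exp (x.1.2 j) * v.1.2 j,
      fun j => (v.2 j - x.2 j * v.1.2 j) * Complex.exp (-x.1.2 j))) := by
  rw [← (differentiable_logChart x).lineDeriv_eq_fderiv]
  refine HasLineDerivAt.lineDeriv ?_
  have hl : ∀ a b : ℂ, HasDerivAt (fun s : ℂ => a + s * b) b 0 := fun a b => by
    simpa using ((hasDerivAt_id (0 : ℂ)).mul_const b).const_add a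
  refine HasDerivAt.prodMk ?_ (HasDerivAt.prodMk (hasDerivAt_pi.2 fun j => ?_)
    (hasDerivAt_pi.2 fun j => ?_))
  · simpa using hl x.1.1 v.1.1
  · simpa using (hl (x.1.2 j) (v.1.2 j)).cexp
  · have := (hl (x.2 j) (v.2 j)).mul (hl (x.1.2 j) (v.1.2 j)).neg.cexp
    refine this.congr_deriv ?_
    simp
    ring

theorem logStrip_exp_bound {n : ℕ} {e : ℂ × (Fin n → ℂ)} (he : e ∈ logStrip n) (j : Fin n) :
    1 / 2 < ‖Complex.exp (e.2 j)‖ ∧ ‖Complex.exp (e.2 j)‖ < 2 := by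
  have h := abs_lt.1 (he.2 j)
  rw [Complex.norm_exp]
  constructor
  · rw [← Real.exp_log (show (0 : ℝ) < 1 / 2 by norm_num), Real.exp_lt_exp, one_div, Real.log_inv]
    exact h.1
  · calc _ < Real.exp (Real.log 2) := Real.exp_lt_exp.2 h.2
      _ = 2 := Real.exp_log two_pos

theorem logChart_mem {n : ℕ} {x : (ℂ × (Fin n → ℂ)) × (Fin n → ℂ)}
    (hx : x ∈ logStrip n ×ˢ Metric.ball 0 4) :
    logChart x ∈ Metric.ball (0 : ℂ) 1 ×ˢ Metric.ball (0 : Phase n) 8 := by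
  obtain ⟨he, hP⟩ := hx
  refine ⟨by simpa [logChart] using he.1, ?_⟩
  rw [mem_ball_zero_iff] at hP ⊢
  refine max_lt ?_ ?_
  · refine (pi_norm_lt_iff (by norm_num)).2 fun j => ?_
    exact (logStrip_exp_bound he j).2.trans (by norm_num)
  · refine (pi_norm_lt_iff (by norm_num)).2 fun j => ?_
    have h1 : ‖x.2 j‖ < 4 := (norm_le_pi_norm _ j).trans_lt hP
    have h2 : ‖Complex.exp (-x.1.2 j)‖ < 2 := by
      rw [Complex.exp_neg, norm_inv]
      have := (logStrip_exp_bound he j).1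
      rw [inv_lt_comm₀ (by linarith) two_pos]
      linarith
    simp only [logChart, norm_mul]
    nlinarith [norm_nonneg (x.2 j), norm_nonneg (Complex.exp (-x.1.2 j))]

theorem logChart_add_single {n : ℕ} (ε : ℂ) (t P : Fin n → ℂ) (j : Fin n) :
    logChart ((ε, t + Pi.single j (2 * Real.pi * Complex.I)), P) = logChart ((ε, t), P) := by
  have : ∀ k, Complex.exp (t k + (Pi.single j (2 * Real.pi * Complex.I) : Fin n → ℂ) k) =
      Complex.exp (t k) := by
    intro k
    by_cases h : k = j
    · subst h; simp [Complex.exp_add]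
    · simp [h]
  simp only [logChart, Pi.add_apply, Complex.exp_neg, this]

theorem add_single_mem_logStrip {n : ℕ} {ε : ℂ} {t : Fin n → ℂ} (h : (ε, t) ∈ logStrip n)
    (j : Fin n) (s : ℝ) : (ε, t + Pi.single j (s * (2 * Real.pi * Complex.I))) ∈ logStrip n := by
  refine ⟨h.1, fun k => ?_⟩
  by_cases hk : k = j
  · subst hk; simpa using h.2 k
  · simpa [hk] using h.2 k

open Matrix in
/-- A matrix identity behind the closedness of the Liouville form on invariant tori. -/
theorem transpose_eq_of_mul_transpose_comm {n : ℕ} {A B X Z : Matrix (Fin n) (Fin n) ℂ}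
    (hX : A + B * X = 0) (hZ : B * Z = 1) (hAB : A * Bᵀ = B * Aᵀ) : Xᵀ = X := by
  have hZB : Z * B = 1 := mul_eq_one_comm.1 hZ
  have h1 : Z * A = -X := by
    rw [eq_neg_of_add_eq_zero_left hX, mul_neg, ← mul_assoc, hZB, one_mul]
  have h2 : Z * (A * Bᵀ) * Zᵀ = Z * A := by
    rw [← mul_assoc, mul_assoc, ← transpose_mul, hZB, transpose_one, mul_one]
  have h3 : Z * (B * Aᵀ) * Zᵀ = (Z * A)ᵀ := by
    rw [← mul_assoc Z, hZB, one_mul, transpose_mul]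
  rw [hAB, h3, h1, transpose_neg] at h2
  exact neg_injective h2

section Momentum

variable {n : ℕ}

theorem fderiv_logChart_single_left (x : (ℂ × (Fin n → ℂ)) × (Fin n → ℂ)) (k : Fin n) :
    fderiv ℂ logChart x ((0, Pi.single k 1), 0) =
      Complex.exp (x.1.2 k) • qDir k - (x.2 k * Complex.exp (-x.1.2 k)) • pDir k := by
  rw [fderiv_logChart]
  refine Prod.ext (by simp [qDir, pDir]) (Prod.ext (funext fun j => ?_) (funext fun j => ?_)) <;>
  · by_cases h : j = k
    · subst h; simp [qDir, pDir]
    · simp [qDir, pDir, h]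

theorem fderiv_logChart_single_right (x : (ℂ × (Fin n → ℂ)) × (Fin n → ℂ)) (k : Fin n) :
    fderiv ℂ logChart x (0, Pi.single k 1) = Complex.exp (-x.1.2 k) • pDir k := by
  rw [fderiv_logChart]
  refine Prod.ext (by simp [pDir]) (Prod.ext (funext fun j => ?_) (funext fun j => ?_))
  · simp [pDir]
  · by_cases h : j = k
    · subst h; simp [pDir]
    · simp [pDir, h]

theorem map_zero_prodMk_eq_sum {E : Type} [NormedAddCommGroup E] [NormedSpace ℂ E] {m : ℕ}
    (L : E × (Fin m → ℂ) →L[ℂ] (Fin n → ℂ)) (v : Fin m → ℂ) (i : Fin n) :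
    L (0, v) i = ∑ j, L (0, Pi.single j 1) i * v j := by
  have h : ((0, v) : E × (Fin m → ℂ)) = ∑ j, v j • (0, Pi.single j 1) := by
    refine Prod.ext (by simp [Prod.fst_sum]) ?_
    funext k
    simp [Prod.snd_sum, Finset.sum_apply, Pi.single_apply]
  rw [h, map_sum, Finset.sum_apply]
  refine Finset.sum_congr rfl fun j _ => ?_
  rw [map_smul, Pi.smul_apply, smul_eq_mul, mul_comm]

theorem fderiv_pi_apply {E : Type} [NormedAddCommGroup E] [NormedSpace ℂ E]
    {f : E → Fin n → ℂ} {x : E} (hf : DifferentiableAt ℂ f x) (v : E) (i : Fin n) :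
    fderiv ℂ f x v i = fderiv ℂ (fun y => f y i) x v :=
  (((hasFDerivAt_pi'.1 hf.hasFDerivAt i).fderiv).symm ▸ rfl)

theorem exists_momentum {R : ℂ × Phase n → Fin n → ℂ} {c : ℝ}
    (hR : DifferentiableOn ℂ R (Metric.ball 0 1 ×ˢ Metric.ball 0 8))
    (hb : ∀ w ∈ Metric.ball (0 : ℂ) 1 ×ˢ Metric.ball (0 : Phase n) 8, ‖R w‖ ≤ c)
    (hc : 16 * c ≤ 4)
    (hcomm : ∀ w ∈ Metric.ball (0 : ℂ) 1 ×ˢ Metric.ball (0 : Phase n) 8, ∀ i j,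
      paramBracket (fun x => x.2.2 i * x.2.1 i + R x i) (fun x => x.2.2 j * x.2.1 j + R x j) w = 0) :
    ∃ P : (ℂ × (Fin n → ℂ)) × (Fin n → ℂ) → Fin n → ℂ,
      DifferentiableOn ℂ P (logStrip n ×ˢ Metric.ball 0 1) ∧
      (∀ x ∈ logStrip n ×ˢ Metric.ball 0 1, P x ∈ Metric.ball 0 2 ∧
        P x + R (logChart (x.1, P x)) = x.2 ∧ ‖P x - x.2‖ ≤ c) ∧
      (∀ e ∈ logStrip n, ∀ h, ∀ v ∈ Metric.ball 0 2, ∀ w ∈ Metric.ball 0 2,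
        v + R (logChart (e, v)) = h → w + R (logChart (e, w)) = h → v = w) ∧
      ∀ x ∈ logStrip n ×ˢ Metric.ball 0 1, ∀ j k,
        fderiv ℂ P x ((0, Pi.single k 1), 0) j = fderiv ℂ P x ((0, Pi.single j 1), 0) k := by
  have hg : DifferentiableOn ℂ (fun x => R (logChart x)) (logStrip n ×ˢ Metric.ball 0 4) :=
    hR.comp differentiable_logChart.differentiableOn fun x hx => logChart_mem hx
  obtain ⟨P, hP, hP1, hP2⟩ := exists_holomorphic_inverse (isOpen_logStrip n) (by norm_num) hc hg
    (fun x hx => hb _ (logChart_mem hx))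
  rw [show (4 : ℝ) / 4 = 1 by norm_num, show (4 : ℝ) / 2 = 2 by norm_num] at *
  refine ⟨P, hP, hP1, hP2, ?_⟩
  intro x hx
  have ho : IsOpen (logStrip n ×ˢ Metric.ball (0 : Fin n → ℂ) 1) :=
    (isOpen_logStrip n).prod Metric.isOpen_ball
  have ho4 : IsOpen (logStrip n ×ˢ Metric.ball (0 : Fin n → ℂ) 4) :=
    (isOpen_logStrip n).prod Metric.isOpen_ball
  set y := (x.1, P x) with hy
  have hy4 : y ∈ logStrip n ×ˢ Metric.ball (0 : Fin n → ℂ) 4 :=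
    ⟨hx.1, Metric.ball_subset_ball (by norm_num) (hP1 x hx).1⟩
  set F : (ℂ × (Fin n → ℂ)) × (Fin n → ℂ) → Fin n → ℂ := fun x => x.2 + R (logChart x) with hF
  have hPx : DifferentiableAt ℂ P x := hP.differentiableAt (ho.mem_nhds hx)
  have hFy : DifferentiableAt ℂ F y :=
    differentiableAt_snd.add (hg.differentiableAt (ho4.mem_nhds hy4))
  have hid : ∀ v, fderiv ℂ F y (v.1, fderiv ℂ P x v) = v.2 := by
    intro v
    have h1 : HasFDerivAt (fun x => F (x.1, P x))
        ((fderiv ℂ F y).comp ((ContinuousLinearMap.fst ℂ _ _).prod (fderiv ℂ P x))) x :=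
      HasFDerivAt.comp (g := F) (f := fun x' : (ℂ × (Fin n → ℂ)) × (Fin n → ℂ) => (x'.1, P x')) x hFy.hasFDerivAt
        (hasFDerivAt_fst.prodMk hPx.hasFDerivAt)
    have h2 : HasFDerivAt (fun x => F (x.1, P x)) (ContinuousLinearMap.snd ℂ _ _) x := by
      refine hasFDerivAt_snd.congr_of_eventuallyEq ?_
      filter_upwards [ho.mem_nhds hx] with x' hx'
      exact (hP1 x' hx').2.1
    exact congrArg (fun L => L v) (h1.unique h2)
  set w := logChart y with hw
  have hwm := logChart_mem hy4
  have hH : ∀ i v, fderiv ℂ F y v i =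
      fderiv ℂ (fun x : ℂ × Phase n => x.2.2 i * x.2.1 i + R x i) w (fderiv ℂ logChart y v) := by
    intro i v
    rw [fderiv_pi_apply hFy]
    have h1 : DifferentiableAt ℂ (fun x : ℂ × Phase n => x.2.2 i * x.2.1 i + R x i) w := by
      have : DifferentiableAt ℂ R w :=
        hR.differentiableAt ((Metric.isOpen_ball.prod Metric.isOpen_ball).mem_nhds hwm)
      have := differentiableAt_pi.1 this i
      fun_prop
    rw [show (fun x => F x i) = (fun x : ℂ × Phase n => x.2.2 i * x.2.1 i + R x i) ∘ logChart by
      funext x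
      simp only [hF, Function.comp, logChart, Pi.add_apply]
      rw [mul_assoc, ← Complex.exp_add]
      simp]
    rw [fderiv_comp y h1 (differentiable_logChart y)]
    rfl
  set A : Matrix (Fin n) (Fin n) ℂ :=
    Matrix.of fun i k => fderiv ℂ F y ((0, Pi.single k 1), 0) i with hA
  set B : Matrix (Fin n) (Fin n) ℂ :=
    Matrix.of fun i k => fderiv ℂ F y (0, Pi.single k 1) i with hB
  have hX : A + B * Matrix.of (fun j k => fderiv ℂ P x ((0, Pi.single k 1), 0) j) = 0 := by
    ext i k
    have h := congrFun (hid ((0, Pi.single k 1), 0)) i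
    have h1 : ((((0, Pi.single k 1), 0) : (ℂ × (Fin n → ℂ)) × (Fin n → ℂ)).1,
        fderiv ℂ P x ((0, Pi.single k 1), 0)) =
        ((0, Pi.single k 1), 0) + (0, fderiv ℂ P x ((0, Pi.single k 1), 0)) := by simp
    rw [h1, map_add, Pi.add_apply, map_zero_prodMk_eq_sum] at h
    simpa [Matrix.mul_apply, hA, hB] using h
  have hZ : B * Matrix.of (fun j k => fderiv ℂ P x (0, Pi.single k 1) j) = 1 := by
    ext i k
    have h := congrFun (hid (0, Pi.single k 1)) i
    rw [show ((0, Pi.single k 1) : (ℂ × (Fin n → ℂ)) × (Fin n → ℂ)).1 = 0 from rfl,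
      map_zero_prodMk_eq_sum] at h
    simpa [Matrix.mul_apply, hB, Matrix.one_apply, Pi.single_apply] using h
  have hAB : A * B.transpose = B * A.transpose := by
    ext i j
    rw [← sub_eq_zero]
    have h := hcomm w hwm i j
    rw [← neg_eq_zero, ← h, paramBracket]
    simp only [Matrix.mul_apply, Matrix.transpose_apply, hA, hB, Matrix.of_apply, hH, fderiv_logChart_single_left,
      fderiv_logChart_single_right, map_sub, map_smul, smul_eq_mul]
    rw [← Finset.sum_sub_distrib, ← Finset.sum_neg_distrib]
    refine Finset.sum_congr rfl fun k _ => ?_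
    have he : Complex.exp (-y.1.2 k) * Complex.exp (y.1.2 k) = 1 := by
      rw [← Complex.exp_add]; simp
    linear_combination (-1 : ℂ) * (fderiv ℂ (fun x : ℂ × Phase n => x.2.2 i * x.2.1 i + R x i) w (qDir k) *
      fderiv ℂ (fun x : ℂ × Phase n => x.2.2 j * x.2.1 j + R x j) w (pDir k) -
      fderiv ℂ (fun x : ℂ × Phase n => x.2.2 i * x.2.1 i + R x i) w (pDir k) *
      fderiv ℂ (fun x : ℂ × Phase n => x.2.2 j * x.2.1 j + R x j) w (qDir k)) * he
  intro j k
  exact (congrFun (congrFun (transpose_eq_of_mul_transpose_comm hX hZ hAB) k) j)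

end Momentum

section GeneratingFunction

variable {n : ℕ}

theorem smul_mem_logStrip {e : ℂ × (Fin n → ℂ)} (he : e ∈ logStrip n) {τ : ℝ}
    (hτ : τ ∈ Set.uIcc (0 : ℝ) 1) : (e.1, (τ : ℂ) • e.2) ∈ logStrip n := by
  rw [Set.uIcc_of_le zero_le_one] at hτ
  refine ⟨he.1, fun j => ?_⟩
  have := he.2 j
  simp only [Pi.smul_apply, smul_eq_mul, Complex.re_ofReal_mul, abs_mul, abs_of_nonneg hτ.1]
  nlinarith [abs_nonneg (e.2 j).re, hτ.2]

theorem fderiv_left_eq_sum {F : Type} [NormedAddCommGroup F] [NormedSpace ℂ F]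
    (L : (ℂ × (Fin n → ℂ)) × (Fin n → ℂ) →L[ℂ] F) (t : Fin n → ℂ) :
    L ((0, t), 0) = ∑ j, t j • L ((0, Pi.single j 1), 0) := by
  have h : (((0, t), 0) : (ℂ × (Fin n → ℂ)) × (Fin n → ℂ)) =
      ∑ j, t j • ((0, Pi.single j 1), 0) := by
    refine Prod.ext (Prod.ext (by simp [Prod.fst_sum]) ?_) (by simp [Prod.snd_sum])
    funext k
    simp [Prod.snd_sum, Prod.fst_sum, Finset.sum_apply, Pi.single_apply]
  rw [h, map_sum]
  simp only [map_smul]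

/-- A potential of a family of closed one-forms in logarithmic coordinates. -/
theorem exists_generating_function {ρ : ℝ} {P : (ℂ × (Fin n → ℂ)) × (Fin n → ℂ) → Fin n → ℂ}
    (hP : DifferentiableOn ℂ P (logStrip n ×ˢ Metric.ball 0 ρ))
    (hs : ∀ x ∈ logStrip n ×ˢ Metric.ball 0 ρ, ∀ j k,
      fderiv ℂ P x ((0, Pi.single k 1), 0) j = fderiv ℂ P x ((0, Pi.single j 1), 0) k) :
    ∃ S : (ℂ × (Fin n → ℂ)) × (Fin n → ℂ) → ℂ,
      DifferentiableOn ℂ S (logStrip n ×ˢ Metric.ball 0 ρ) ∧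
      (∀ x ∈ logStrip n ×ˢ Metric.ball 0 ρ, ∀ k,
        fderiv ℂ S x ((0, Pi.single k 1), 0) = P x k) ∧
      ∀ x, S x = ∫ τ in (0 : ℝ)..1, ∑ j, x.1.2 j * P ((x.1.1, (τ : ℂ) • x.1.2), x.2) j := by
  set D := logStrip n ×ˢ Metric.ball (0 : Fin n → ℂ) ρ with hD
  have ho : IsOpen D := (isOpen_logStrip n).prod Metric.isOpen_ball
  set m : ℂ → (ℂ × (Fin n → ℂ)) × (Fin n → ℂ) → (ℂ × (Fin n → ℂ)) × (Fin n → ℂ) :=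
    fun τ x => ((x.1.1, τ • x.1.2), x.2) with hm
  have hmD : ∀ x ∈ D, ∀ τ ∈ Set.uIcc (0 : ℝ) 1, m τ x ∈ D := fun x hx τ hτ =>
    ⟨smul_mem_logStrip hx.1 hτ, hx.2⟩
  have hc : ContinuousOn (fun p : ℝ × ((ℂ × (Fin n → ℂ)) × (Fin n → ℂ)) =>
      ∑ j, p.2.1.2 j * P (m p.1 p.2) j) (Set.uIcc 0 1 ×ˢ D) := by
    refine continuousOn_finsetSum _ fun j _ => ContinuousOn.mul (by fun_prop) ?_
    refine (continuous_apply j).comp_continuousOn (hP.continuousOn.comp ?_ fun p hp =>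
      hmD _ hp.2 _ hp.1)
    have : Continuous fun p : ℝ × ((ℂ × (Fin n → ℂ)) × (Fin n → ℂ)) => m p.1 p.2 := by
      simp only [hm]
      exact ((by fun_prop : Continuous fun p : ℝ × ((ℂ × (Fin n → ℂ)) × (Fin n → ℂ)) =>
        p.2.1.1).prodMk ((Complex.continuous_ofReal.comp continuous_fst).smul (by fun_prop))).prodMk
        (by fun_prop)
    exact this.continuousOn
  have hPm : ∀ τ ∈ Set.uIcc (0 : ℝ) 1, ∀ x ∈ D, DifferentiableAt ℂ P (m τ x) :=
    fun τ hτ x hx => hP.differentiableAt (ho.mem_nhds (hmD x hx τ hτ))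
  have hterm : ∀ τ ∈ Set.uIcc (0 : ℝ) 1, ∀ x ∈ D, ∀ j,
      HasFDerivAt (fun y => P (m τ y) j) ((ContinuousLinearMap.proj j).comp
        ((fderiv ℂ P (m τ x)).comp (fderiv ℂ (m τ) x))) x := fun τ hτ x hx j =>
    hasFDerivAt_pi'.1 ((hPm τ hτ x hx).hasFDerivAt.comp x
      (show DifferentiableAt ℂ (m τ) x by simp only [hm]; fun_prop).hasFDerivAt) j
  have hd : ∀ τ ∈ Set.uIcc (0 : ℝ) 1, DifferentiableOn ℂ
      (fun x => ∑ j, x.1.2 j * P (m τ x) j) D := fun τ hτ x hx =>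
    DifferentiableAt.differentiableWithinAt <| DifferentiableAt.fun_sum fun j _ =>
      DifferentiableAt.mul (by fun_prop) (hterm τ hτ x hx j).differentiableAt
  refine ⟨fun x => ∫ τ in (0 : ℝ)..1, ∑ j, x.1.2 j * P (m τ x) j,
    differentiableOn_intervalIntegral ho hc hd, fun x hx k => ?_, fun x => rfl⟩
  rw [fderiv_intervalIntegral ho hc hd hx]
  have hmk : ∀ τ : ℂ, fderiv ℂ (m τ) x ((0, Pi.single k 1), 0) = ((0, τ • Pi.single k 1), 0) := by
    intro τ
    have h : IsLinearMap ℂ (m τ) := ⟨fun a b => by simp [hm], fun c a =>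
      Prod.ext (Prod.ext rfl (smul_comm τ c a.1.2)) rfl⟩
    have h2 : m τ = (LinearMap.toContinuousLinearMap h.mk' : _ →L[ℂ] _) := rfl
    rw [h2, ContinuousLinearMap.fderiv]
    simp [hm]
  have hval : ∀ τ ∈ Set.uIcc (0 : ℝ) 1, fderiv ℂ (fun x => ∑ j, x.1.2 j * P (m τ x) j) x
      ((0, Pi.single k 1), 0) = P (m τ x) k + τ * fderiv ℂ P (m τ x) ((0, x.1.2), 0) k := by
    intro τ hτ
    have h1 : ∀ j, HasFDerivAt (fun x : (ℂ × (Fin n → ℂ)) × (Fin n → ℂ) => x.1.2 j)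
        ((ContinuousLinearMap.proj j).comp ((ContinuousLinearMap.snd ℂ ℂ (Fin n → ℂ)).comp
          (ContinuousLinearMap.fst ℂ _ (Fin n → ℂ)))) x := fun j =>
      ContinuousLinearMap.hasFDerivAt ((ContinuousLinearMap.proj j).comp
        ((ContinuousLinearMap.snd ℂ ℂ (Fin n → ℂ)).comp
          (ContinuousLinearMap.fst ℂ _ (Fin n → ℂ))))
    rw [(HasFDerivAt.fun_sum fun j _ => (h1 j).fun_mul (hterm τ hτ x hx j)).fderiv]
    simp only [_root_.sum_apply, _root_.add_apply,
      _root_.smul_apply, ContinuousLinearMap.comp_apply, hmk,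
      ContinuousLinearMap.proj_apply, ContinuousLinearMap.coe_fst', ContinuousLinearMap.coe_snd',
      Finset.sum_add_distrib]
    rw [add_comm]
    congr 1
    · simp [Pi.single_apply]
    · rw [fderiv_left_eq_sum _ x.1.2, Finset.sum_apply, Finset.mul_sum]
      refine Finset.sum_congr rfl fun j _ => ?_
      rw [Pi.smul_apply, ← hs _ (hmD x hx τ hτ),
        show (((0, (τ : ℂ) • Pi.single k 1), 0) : (ℂ × (Fin n → ℂ)) × (Fin n → ℂ)) =
          (τ : ℂ) • ((0, Pi.single k 1), 0) by simp, map_smul, Pi.smul_apply]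
      simp only [smul_eq_mul]
      ring
  have hder : ∀ τ ∈ Set.uIcc (0 : ℝ) 1, HasDerivAt (fun τ : ℝ => (τ : ℂ) * P (m τ x) k)
      (P (m τ x) k + τ * fderiv ℂ P (m τ x) ((0, x.1.2), 0) k) τ := by
    intro τ hτ
    have h1 : HasDerivAt (fun σ : ℂ => m σ x) ((0, x.1.2), 0) (τ : ℂ) := by
      refine ((hasDerivAt_const _ _).prodMk ?_).prodMk (hasDerivAt_const _ _)
      simpa using (hasDerivAt_id (τ : ℂ)).smul_const x.1.2
    have h2 := hasDerivAt_pi.1 ((hPm τ hτ x hx).hasFDerivAt.comp_hasDerivAt _ h1) k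
    have h3 := ((hasDerivAt_id (τ : ℂ)).fun_mul h2).comp_ofReal
    simpa using h3
  have hintegr : IntervalIntegrable
      (fun τ : ℝ => P (m τ x) k + τ * fderiv ℂ P (m τ x) ((0, x.1.2), 0) k)
      MeasureTheory.volume 0 1 := by
    refine ContinuousOn.intervalIntegrable ?_
    have hmc : ContinuousOn (fun τ : ℝ => m τ x) (Set.uIcc 0 1) := by
      simp only [hm]; fun_prop
    have h1 : ContinuousOn (fun τ : ℝ => P (m τ x)) (Set.uIcc 0 1) :=
      hP.continuousOn.comp hmc fun τ hτ => hmD x hx τ hτ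
    have h2 : ContinuousOn (fun τ : ℝ => fderiv ℂ P (m τ x)) (Set.uIcc 0 1) :=
      (hP.fderiv_of_isOpen ho).continuousOn.comp hmc fun τ hτ => hmD x hx τ hτ
    have h3 : ContinuousOn (fun τ : ℝ => fderiv ℂ P (m τ x) ((0, x.1.2), 0)) (Set.uIcc 0 1) :=
      h2.clm_apply continuousOn_const
    exact (continuousOn_pi.1 h1 k).add
      (Complex.continuous_ofReal.continuousOn.mul (continuousOn_pi.1 h3 k))
  rw [intervalIntegral.integral_congr hval, intervalIntegral.integral_eq_sub_of_hasDerivAt hder hintegr]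
  simp [hm]

end GeneratingFunction

section Action

variable {n : ℕ}

/-- The periods of the momenta over the imaginary directions of the logarithmic coordinates. -/
noncomputable def actionIntegral (P : (ℂ × (Fin n → ℂ)) × (Fin n → ℂ) → Fin n → ℂ)
    (y : ℂ × (Fin n → ℂ)) : Fin n → ℂ := fun j =>
  ∫ s in (0 : ℝ)..1, P ((y.1, (s : ℂ) • Pi.single j (2 * Real.pi * Complex.I)), y.2) j

theorem smul_single_mem_logStrip {ε : ℂ} (hε : ‖ε‖ < 1) (j : Fin n) (s : ℝ) :
    ((ε, (s : ℂ) • Pi.single j (2 * Real.pi * Complex.I)) : ℂ × (Fin n → ℂ)) ∈ logStrip n := by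
  refine ⟨hε, fun k => ?_⟩
  have : 0 < Real.log 2 := Real.log_pos one_lt_two
  by_cases hk : k = j
  · subst hk; simpa using this
  · simpa [hk] using this

theorem differentiableOn_actionIntegral {ρ : ℝ} {P : (ℂ × (Fin n → ℂ)) × (Fin n → ℂ) → Fin n → ℂ}
    (hP : DifferentiableOn ℂ P (logStrip n ×ˢ Metric.ball 0 ρ)) :
    DifferentiableOn ℂ (actionIntegral P) (Metric.ball 0 1 ×ˢ Metric.ball 0 ρ) := by
  refine differentiableOn_pi.2 fun j => differentiableOn_intervalIntegral
    (Metric.isOpen_ball.prod Metric.isOpen_ball) ?_ fun s _ => ?_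
  · refine (continuous_apply j).comp_continuousOn (hP.continuousOn.comp ?_ fun p hp =>
      ⟨smul_single_mem_logStrip (by simpa using hp.2.1) j p.1, hp.2.2⟩)
    fun_prop
  · have h1 : DifferentiableOn ℂ (fun y : ℂ × (Fin n → ℂ) =>
        ((y.1, (s : ℂ) • (Pi.single j (2 * Real.pi * Complex.I) : Fin n → ℂ)), y.2))
        (Metric.ball 0 1 ×ˢ Metric.ball 0 ρ) := by fun_prop
    exact (differentiableOn_pi.1 hP j).comp h1 fun x hx =>
      ⟨smul_single_mem_logStrip (by simpa using hx.1) j s, hx.2⟩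

theorem norm_actionIntegral_sub_le {ρ c : ℝ} (hc : 0 ≤ c)
    {P : (ℂ × (Fin n → ℂ)) × (Fin n → ℂ) → Fin n → ℂ}
    (hP : DifferentiableOn ℂ P (logStrip n ×ˢ Metric.ball 0 ρ))
    (hb : ∀ x ∈ logStrip n ×ˢ Metric.ball 0 ρ, ‖P x - x.2‖ ≤ c)
    {y : ℂ × (Fin n → ℂ)} (hy : y ∈ Metric.ball (0 : ℂ) 1 ×ˢ Metric.ball (0 : Fin n → ℂ) ρ) :
    ‖actionIntegral P y - y.2‖ ≤ c := by
  have hm : ∀ j : Fin n, ∀ s : ℝ, ((y.1, (s : ℂ) • Pi.single j (2 * Real.pi * Complex.I)), y.2) ∈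
      logStrip n ×ˢ Metric.ball (0 : Fin n → ℂ) ρ := fun j s =>
    ⟨smul_single_mem_logStrip (by simpa using hy.1) j s, hy.2⟩
  refine (pi_norm_le_iff_of_nonneg hc).2 fun j => ?_
  have hi : IntervalIntegrable (fun s : ℝ =>
      P ((y.1, (s : ℂ) • Pi.single j (2 * Real.pi * Complex.I)), y.2) j)
      MeasureTheory.volume 0 1 := by
    refine Continuous.intervalIntegrable ?_ _ _
    refine (continuous_apply j).comp (hP.continuousOn.comp_continuous (by fun_prop) (hm j))
  have h1 : (actionIntegral P y - y.2) j = ∫ s in (0 : ℝ)..1,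
      (P ((y.1, (s : ℂ) • Pi.single j (2 * Real.pi * Complex.I)), y.2) j - y.2 j) := by
    rw [intervalIntegral.integral_sub hi (by simp)]
    simp [actionIntegral]
  rw [h1]
  refine (intervalIntegral.norm_integral_le_of_norm_le_const (C := c) fun s _ => ?_).trans_eq
    (by simp)
  exact (norm_le_pi_norm (P ((y.1, (s : ℂ) • Pi.single j (2 * Real.pi * Complex.I)), y.2) - y.2)
    j).trans (hb _ (hm j s))

theorem fderiv_comp_of_fst_eq_zero {P : (ℂ × (Fin n → ℂ)) × (Fin n → ℂ) → Fin n → ℂ}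
    {B : ℂ × (Fin n → ℂ) → Fin n → ℂ} {x : (ℂ × (Fin n → ℂ)) × (Fin n → ℂ)}
    (hP : DifferentiableAt ℂ P (x.1, B (x.1.1, x.2))) (hB : DifferentiableAt ℂ B (x.1.1, x.2))
    (v : Fin n → ℂ) :
    fderiv ℂ (fun x => P (x.1, B (x.1.1, x.2))) x ((0, v), 0) =
      fderiv ℂ P (x.1, B (x.1.1, x.2)) ((0, v), 0) := by
  have hl : DifferentiableAt ℂ
      (fun x : (ℂ × (Fin n → ℂ)) × (Fin n → ℂ) => (x.1.1, x.2)) x := by fun_prop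
  have hBx : DifferentiableAt ℂ
      (fun x : (ℂ × (Fin n → ℂ)) × (Fin n → ℂ) => B (x.1.1, x.2)) x :=
    DifferentiableAt.comp x hB hl
  have h1 : DifferentiableAt ℂ (fun x => P (x.1, B (x.1.1, x.2))) x :=
    DifferentiableAt.comp (f := fun x : (ℂ × (Fin n → ℂ)) × (Fin n → ℂ) =>
      (x.1, B (x.1.1, x.2))) x hP (differentiableAt_fst.prodMk hBx)
  rw [← h1.lineDeriv_eq_fderiv, ← hP.lineDeriv_eq_fderiv]
  simp only [lineDeriv, Prod.fst_add, Prod.snd_add, smul_zero,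
    add_zero, Prod.mk_add_mk, Prod.smul_mk]

end Action

section Period

variable {n : ℕ}

theorem map_add_single_sub_eq {ρ : ℝ} {P : (ℂ × (Fin n → ℂ)) × (Fin n → ℂ) → Fin n → ℂ}
    {S : (ℂ × (Fin n → ℂ)) × (Fin n → ℂ) → ℂ}
    (hS : DifferentiableOn ℂ S (logStrip n ×ˢ Metric.ball 0 ρ))
    (hSP : ∀ x ∈ logStrip n ×ˢ Metric.ball 0 ρ, ∀ k,
      fderiv ℂ S x ((0, Pi.single k 1), 0) = P x k)
    (hper : ∀ x ∈ logStrip n ×ˢ Metric.ball 0 ρ, ∀ j,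
      P ((x.1.1, x.1.2 + Pi.single j (2 * Real.pi * Complex.I)), x.2) = P x)
    (hSi : ∀ x, S x = ∫ τ in (0 : ℝ)..1, ∑ j, x.1.2 j * P ((x.1.1, (τ : ℂ) • x.1.2), x.2) j)
    {x : (ℂ × (Fin n → ℂ)) × (Fin n → ℂ)} (hx : x ∈ logStrip n ×ˢ Metric.ball 0 ρ) (j : Fin n) :
    S ((x.1.1, x.1.2 + Pi.single j (2 * Real.pi * Complex.I)), x.2) - S x =
      2 * Real.pi * Complex.I * actionIntegral P (x.1.1, x.2) j := by
  have ho : IsOpen (logStrip n ×ˢ Metric.ball (0 : Fin n → ℂ) ρ) :=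
    (isOpen_logStrip n).prod Metric.isOpen_ball
  set v : Fin n → ℂ := Pi.single j (2 * Real.pi * Complex.I) with hv
  have hder : ∀ w : Fin n → ℂ, ∀ σ : ℝ,
      ((x.1.1, (σ : ℂ) • x.1.2 + w), x.2) ∈ logStrip n ×ˢ Metric.ball 0 ρ →
      HasDerivAt (fun σ : ℝ => S ((x.1.1, (σ : ℂ) • x.1.2 + w), x.2))
        (∑ k, x.1.2 k * P ((x.1.1, (σ : ℂ) • x.1.2 + w), x.2) k) σ := by
    intro w σ hσ
    have h1 : HasDerivAt (fun σ : ℂ => ((x.1.1, σ • x.1.2 + w), x.2))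
        (((0, x.1.2), 0) : (ℂ × (Fin n → ℂ)) × (Fin n → ℂ)) (σ : ℂ) := by
      refine ((hasDerivAt_const _ _).prodMk ?_).prodMk (hasDerivAt_const _ _)
      simpa using ((hasDerivAt_id (σ : ℂ)).smul_const x.1.2).add_const w
    have h2 := ((hS.differentiableAt (ho.mem_nhds hσ)).hasFDerivAt.comp_hasDerivAt _ h1).comp_ofReal
    rw [fderiv_left_eq_sum] at h2
    simp only [hSP _ hσ, smul_eq_mul] at h2
    exact h2
  have hm0 : ∀ σ ∈ Set.uIcc (0 : ℝ) 1,
      ((x.1.1, (σ : ℂ) • x.1.2 + 0), x.2) ∈ logStrip n ×ˢ Metric.ball 0 ρ := fun σ hσ => by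
    rw [add_zero]; exact ⟨smul_mem_logStrip hx.1 hσ, hx.2⟩
  have hmv : ∀ σ ∈ Set.uIcc (0 : ℝ) 1,
      ((x.1.1, (σ : ℂ) • x.1.2 + v), x.2) ∈ logStrip n ×ˢ Metric.ball 0 ρ := fun σ hσ =>
    ⟨by simpa using add_single_mem_logStrip (smul_mem_logStrip hx.1 hσ) j 1, hx.2⟩
  have hd : ∀ σ ∈ Set.uIcc (0 : ℝ) 1,
      HasDerivAt (fun σ : ℝ => S ((x.1.1, (σ : ℂ) • x.1.2 + v), x.2) -
        S ((x.1.1, (σ : ℂ) • x.1.2 + 0), x.2)) 0 σ := by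
    intro σ hσ
    refine ((hder v σ (hmv σ hσ)).sub (hder 0 σ (hm0 σ hσ))).congr_deriv ?_
    rw [sub_eq_zero]
    refine Finset.sum_congr rfl fun k _ => ?_
    rw [← hper _ (hm0 σ hσ) j, add_zero]
  have h := intervalIntegral.integral_eq_sub_of_hasDerivAt hd (by simp)
  have h0 : S ((x.1.1, 0), x.2) = 0 := by rw [hSi]; simp
  have hv1 : S ((x.1.1, v), x.2) = 2 * Real.pi * Complex.I * actionIntegral P (x.1.1, x.2) j := by
    rw [hSi, actionIntegral, ← intervalIntegral.integral_const_mul]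
    refine intervalIntegral.integral_congr fun τ _ => ?_
    simp only
    rw [Finset.sum_eq_single j (fun k _ hk => by simp [hv, hk]) (by simp)]
    simp [hv]
  simp only [intervalIntegral.integral_zero, Complex.ofReal_one, one_smul, Complex.ofReal_zero,
    zero_smul, zero_add, add_zero, h0, hv1, sub_zero] at h
  linear_combination -h

end Period

section ActionAngle

variable {n : ℕ}

theorem exists_action_angle_generating_function {R : ℂ × Phase n → Fin n → ℂ} {c : ℝ}
    (hR : DifferentiableOn ℂ R (Metric.ball 0 1 ×ˢ Metric.ball 0 8))
    (hb : ∀ w ∈ Metric.ball (0 : ℂ) 1 ×ˢ Metric.ball (0 : Phase n) 8, ‖R w‖ ≤ c)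
    (hc0 : 0 ≤ c) (hc : 32 * c ≤ 1) (hR0 : ∀ z ∈ Metric.ball (0 : Phase n) 8, R (0, z) = 0)
    (hcomm : ∀ w ∈ Metric.ball (0 : ℂ) 1 ×ˢ Metric.ball (0 : Phase n) 8, ∀ i j,
      paramBracket (fun x => x.2.2 i * x.2.1 i + R x i) (fun x => x.2.2 j * x.2.1 j + R x j) w = 0) :
    ∃ (A B : ℂ × (Fin n → ℂ) → Fin n → ℂ) (S : (ℂ × (Fin n → ℂ)) × (Fin n → ℂ) → ℂ)
      (κ : ℂ → Fin n → ℂ),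
      DifferentiableOn ℂ A (Metric.ball 0 1 ×ˢ Metric.ball 0 1) ∧
      (∀ y ∈ Metric.ball (0 : ℂ) 1 ×ˢ Metric.ball (0 : Fin n → ℂ) 1, ‖A y - y.2‖ ≤ 2 * c) ∧
      (∀ ε, A (ε, 0) = 0) ∧
      (∀ h ∈ Metric.ball (0 : Fin n → ℂ) 1, A (0, h) = h) ∧
      DifferentiableOn ℂ B (Metric.ball 0 1 ×ˢ Metric.ball 0 (1 / 4)) ∧
      (∀ ε ∈ Metric.ball (0 : ℂ) 1, ∀ h ∈ Metric.ball (0 : Fin n → ℂ) (1 / 2),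
        A (ε, h) ∈ Metric.ball (0 : Fin n → ℂ) (1 / 4) → B (ε, A (ε, h)) = h) ∧
      DifferentiableOn ℂ S (logStrip n ×ˢ Metric.ball 0 (1 / 4)) ∧
      (∀ e ∈ logStrip n, ∀ v ∈ Metric.ball (0 : Fin n → ℂ) 2,
        v + R (logChart (e, v)) ∈ Metric.ball (0 : Fin n → ℂ) (1 / 2) →
        A (e.1, v + R (logChart (e, v))) ∈ Metric.ball (0 : Fin n → ℂ) (1 / 4) → ∀ k,
          fderiv ℂ S (e, A (e.1, v + R (logChart (e, v)))) ((0, Pi.single k 1), 0) = v k) ∧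
      (∀ x ∈ logStrip n ×ˢ Metric.ball (0 : Fin n → ℂ) (1 / 4), ∀ j,
        S ((x.1.1, x.1.2 + Pi.single j (2 * Real.pi * Complex.I)), x.2) =
          S x + 2 * Real.pi * Complex.I * (x.2 j + κ x.1.1 j)) ∧
      ∀ x ∈ logStrip n ×ˢ Metric.ball (0 : Fin n → ℂ) (1 / 4), x.1.1 = 0 →
        S x = ∑ j, x.1.2 j * x.2 j := by
  obtain ⟨P, hP, hP1, hP2, hPs⟩ := exists_momentum hR hb (by linarith) hcomm
  have hA' := differentiableOn_actionIntegral hP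
  have hAb' : ∀ y ∈ Metric.ball (0 : ℂ) 1 ×ˢ Metric.ball (0 : Fin n → ℂ) 1,
      ‖actionIntegral P y - y.2‖ ≤ c := fun y hy =>
    norm_actionIntegral_sub_le hc0 hP (fun x hx => (hP1 x hx).2.2) hy
  set A : ℂ × (Fin n → ℂ) → Fin n → ℂ := fun y => actionIntegral P y - actionIntegral P (y.1, 0)
    with hA
  have hAd : DifferentiableOn ℂ A (Metric.ball 0 1 ×ˢ Metric.ball 0 1) :=
    hA'.sub (hA'.comp (f := fun y : ℂ × (Fin n → ℂ) => (y.1, (0 : Fin n → ℂ))) (by fun_prop)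
      fun y hy => ⟨hy.1, by simp⟩)
  have hAb : ∀ y ∈ Metric.ball (0 : ℂ) 1 ×ˢ Metric.ball (0 : Fin n → ℂ) 1,
      ‖A y - y.2‖ ≤ 2 * c := by
    intro y hy
    have h1 := hAb' y hy
    have h2 := hAb' (y.1, 0) ⟨hy.1, by simp⟩
    simp only [sub_zero] at h2
    calc ‖A y - y.2‖ = ‖(actionIntegral P y - y.2) - actionIntegral P (y.1, 0)‖ := by
          simp only [hA]; congr 1; abel
      _ ≤ _ := (norm_sub_le _ _).trans (by linarith)
  obtain ⟨B, hB, hB1, hB2⟩ := exists_holomorphic_inverse (g := fun y => A y - y.2)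
    (Metric.isOpen_ball : IsOpen (Metric.ball (0 : ℂ) 1)) one_pos (by linarith)
    (hAd.sub differentiable_snd.differentiableOn) hAb
  have hBA : ∀ p ∈ Metric.ball (0 : ℂ) 1 ×ˢ Metric.ball (0 : Fin n → ℂ) (1 / 4),
      A (p.1, B p) = p.2 := fun p hp => by simpa using (hB1 p hp).2.1
  have hBA2 : ∀ ε ∈ Metric.ball (0 : ℂ) 1, ∀ h ∈ Metric.ball (0 : Fin n → ℂ) (1 / 2),
        A (ε, h) ∈ Metric.ball (0 : Fin n → ℂ) (1 / 4) → B (ε, A (ε, h)) = h := by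
    intro ε hε h hh hAh
    refine hB2 ε hε (A (ε, h)) _ (hB1 (ε, A (ε, h)) ⟨hε, hAh⟩).1 _ hh ?_ (by simp)
    simpa using hBA (ε, A (ε, h)) ⟨hε, hAh⟩
  have hhalf : Metric.ball (0 : Fin n → ℂ) (1 / 2) ⊆ Metric.ball 0 1 :=
    Metric.ball_subset_ball (by norm_num)
  have hquarter : Metric.ball (0 : Fin n → ℂ) (1 / 4) ⊆ Metric.ball 0 1 :=
    Metric.ball_subset_ball (by norm_num)
  set Q : (ℂ × (Fin n → ℂ)) × (Fin n → ℂ) → Fin n → ℂ := fun x => P (x.1, B (x.1.1, x.2)) with hQ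
  have hm : ∀ x ∈ logStrip n ×ˢ Metric.ball (0 : Fin n → ℂ) (1 / 4),
      (x.1.1, x.2) ∈ Metric.ball (0 : ℂ) 1 ×ˢ Metric.ball (0 : Fin n → ℂ) (1 / 4) := fun x hx =>
    ⟨by simpa using hx.1.1, hx.2⟩
  have hmB : ∀ x ∈ logStrip n ×ˢ Metric.ball (0 : Fin n → ℂ) (1 / 4),
      (x.1, B (x.1.1, x.2)) ∈ logStrip n ×ˢ Metric.ball (0 : Fin n → ℂ) 1 := fun x hx =>
    ⟨hx.1, hhalf (hB1 _ (hm x hx)).1⟩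
  have hBc : DifferentiableOn ℂ (fun x : (ℂ × (Fin n → ℂ)) × (Fin n → ℂ) => B (x.1.1, x.2))
      (logStrip n ×ˢ Metric.ball (0 : Fin n → ℂ) (1 / 4)) :=
    hB.comp (f := fun x : (ℂ × (Fin n → ℂ)) × (Fin n → ℂ) => (x.1.1, x.2)) (by fun_prop) hm
  have hQd : DifferentiableOn ℂ Q (logStrip n ×ˢ Metric.ball 0 (1 / 4)) :=
    hP.comp (differentiable_fst.differentiableOn.prodMk hBc) hmB
  have ho1 : IsOpen (logStrip n ×ˢ Metric.ball (0 : Fin n → ℂ) 1) :=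
    (isOpen_logStrip n).prod Metric.isOpen_ball
  have hQs : ∀ x ∈ logStrip n ×ˢ Metric.ball 0 (1 / 4), ∀ j k,
      fderiv ℂ Q x ((0, Pi.single k 1), 0) j = fderiv ℂ Q x ((0, Pi.single j 1), 0) k := by
    intro x hx j k
    have h1 := hP.differentiableAt (ho1.mem_nhds (hmB x hx))
    have h2 := hB.differentiableAt ((Metric.isOpen_ball.prod Metric.isOpen_ball).mem_nhds (hm x hx))
    rw [hQ, fderiv_comp_of_fst_eq_zero h1 h2, fderiv_comp_of_fst_eq_zero h1 h2,
      hPs _ (hmB x hx)]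
  obtain ⟨S, hS, hSQ, hSi⟩ := exists_generating_function hQd hQs
  have hperP : ∀ x ∈ logStrip n ×ˢ Metric.ball (0 : Fin n → ℂ) 1, ∀ j,
      P ((x.1.1, x.1.2 + Pi.single j (2 * Real.pi * Complex.I)), x.2) = P x := by
    intro x hx j
    have hx' : ((x.1.1, x.1.2 + Pi.single j (2 * Real.pi * Complex.I)), x.2) ∈
        logStrip n ×ˢ Metric.ball (0 : Fin n → ℂ) 1 :=
      ⟨by simpa using add_single_mem_logStrip hx.1 j 1, hx.2⟩
    have h1 := hP1 _ hx'
    refine hP2 x.1 hx.1 x.2 _ h1.1 _ (hP1 x hx).1 ?_ (hP1 x hx).2.1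
    have := h1.2.1
    rwa [logChart_add_single] at this
  have hP0 : ∀ x ∈ logStrip n ×ˢ Metric.ball (0 : Fin n → ℂ) 1, x.1.1 = 0 → P x = x.2 := by
    intro x hx hx0
    have h := (hP1 x hx).2.1
    have h2 : (x.1, P x) ∈ logStrip n ×ˢ Metric.ball (0 : Fin n → ℂ) 4 :=
      ⟨hx.1, Metric.ball_subset_ball (by norm_num) (hP1 x hx).1⟩
    have h3 : logChart (x.1, P x) = (0, (logChart (x.1, P x)).2) :=
      Prod.ext hx0 rfl
    rwa [h3, hR0 _ (logChart_mem h2).2, add_zero] at h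
  have hA0 : ∀ h ∈ Metric.ball (0 : Fin n → ℂ) 1, actionIntegral P (0, h) = h := by
    intro h hh
    funext j
    rw [actionIntegral]
    have : ∀ s : ℝ, P ((0, (s : ℂ) • Pi.single j (2 * Real.pi * Complex.I)), h) = h := fun s =>
      hP0 _ ⟨smul_single_mem_logStrip (by simp) j s, hh⟩ rfl
    simp only [this]
    simp
  have hA00 : ∀ h ∈ Metric.ball (0 : Fin n → ℂ) 1, A (0, h) = h := by
    intro h hh
    simp only [hA]
    rw [hA0 h hh, hA0 0 (by simp), sub_zero]
  refine ⟨A, B, S, fun ε => actionIntegral P (ε, 0), hAd, hAb, fun ε => by simp [hA], hA00, hB,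
    hBA2, hS, ?_, ?_, ?_⟩
  · intro e he v hv h1 h2 k
    have he1 : e.1 ∈ Metric.ball (0 : ℂ) 1 := by simpa using he.1
    obtain ⟨h, hh⟩ : ∃ h, v + R (logChart (e, v)) = h := ⟨_, rfl⟩
    rw [hh] at h1 h2 ⊢
    have h3 := hP1 (e, h) ⟨he, hhalf h1⟩
    have h4 : P (e, h) = v := hP2 e he h _ h3.1 v hv h3.2.1 hh
    have h5 : B (e.1, A (e.1, h)) = h := hBA2 e.1 he1 h h1 h2
    have h6 := hSQ (e, A (e.1, h)) ⟨he, h2⟩ k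
    rw [h6]
    change P (e, B (e.1, A (e.1, h))) k = v k
    rw [h5, h4]
  · intro x hx j
    have h := map_add_single_sub_eq hS hSQ (fun x hx j => hperP _ (hmB x hx) j) hSi hx j
    have h2 : actionIntegral Q (x.1.1, x.2) = actionIntegral P (x.1.1, B (x.1.1, x.2)) := rfl
    have h3 := congrFun (hBA _ (hm x hx)) j
    simp only [hA, Pi.sub_apply] at h3
    rw [h2] at h
    linear_combination h + 2 * Real.pi * Complex.I * h3
  · intro x hx hx0
    have hx1 := hm x hx
    have h1 : B (x.1.1, x.2) = x.2 := by
      have h2 := hBA _ hx1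
      have h3 := hA00 _ (hhalf (hB1 _ hx1).1)
      rw [hx0] at h2 h3 ⊢
      exact h3.symm.trans h2
    have hQ0 : ∀ τ ∈ Set.uIcc (0 : ℝ) 1, Q ((x.1.1, (τ : ℂ) • x.1.2), x.2) = x.2 := by
      intro τ hτ
      have h2 := hP0 ((x.1.1, (τ : ℂ) • x.1.2), x.2) ⟨smul_mem_logStrip hx.1 hτ, hquarter hx.2⟩ hx0
      simp only [hQ, h1, h2]
    rw [hSi, intervalIntegral.integral_congr (g := fun _ => ∑ j, x.1.2 j * x.2 j) fun τ hτ => by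
      simp only [hQ0 τ hτ]]
    simp

end ActionAngle

section Angle

variable {n : ℕ}

/-- The angle variables, as derivatives of the generating function along the actions. -/
noncomputable def angleVar (S : (ℂ × (Fin n → ℂ)) × (Fin n → ℂ) → ℂ) (i : Fin n)
    (x : (ℂ × (Fin n → ℂ)) × (Fin n → ℂ)) : ℂ := fderiv ℂ S x (0, Pi.single i 1)

variable {ρ : ℝ} {S : (ℂ × (Fin n → ℂ)) × (Fin n → ℂ) → ℂ}

theorem isOpen_logStrip_prod_ball (n : ℕ) (ρ : ℝ) :
    IsOpen (logStrip n ×ˢ Metric.ball (0 : Fin n → ℂ) ρ) :=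
  (isOpen_logStrip n).prod Metric.isOpen_ball

theorem eventually_add_smul_mem {x : (ℂ × (Fin n → ℂ)) × (Fin n → ℂ)}
    (hx : x ∈ logStrip n ×ˢ Metric.ball (0 : Fin n → ℂ) ρ)
    (v : (ℂ × (Fin n → ℂ)) × (Fin n → ℂ)) :
    ∀ᶠ σ : ℂ in 𝓝 0, x + σ • v ∈ logStrip n ×ˢ Metric.ball (0 : Fin n → ℂ) ρ := by
  have hc : ContinuousAt (fun σ : ℂ => x + σ • v) 0 := by fun_prop
  exact hc.eventually_mem ((isOpen_logStrip_prod_ball n ρ).mem_nhds (by simpa using hx))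

theorem angleVar_add_single (hS : DifferentiableOn ℂ S (logStrip n ×ˢ Metric.ball 0 ρ))
    {κ : ℂ → Fin n → ℂ}
    (hper : ∀ x ∈ logStrip n ×ˢ Metric.ball (0 : Fin n → ℂ) ρ, ∀ j,
      S ((x.1.1, x.1.2 + Pi.single j (2 * Real.pi * Complex.I)), x.2) =
        S x + 2 * Real.pi * Complex.I * (x.2 j + κ x.1.1 j))
    {x : (ℂ × (Fin n → ℂ)) × (Fin n → ℂ)} (hx : x ∈ logStrip n ×ˢ Metric.ball 0 ρ) (i j : Fin n) :
    angleVar S i ((x.1.1, x.1.2 + Pi.single j (2 * Real.pi * Complex.I)), x.2) =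
      angleVar S i x + 2 * Real.pi * Complex.I * (Pi.single i 1 : Fin n → ℂ) j := by
  have ho := isOpen_logStrip_prod_ball n ρ
  have hx' : ((x.1.1, x.1.2 + Pi.single j (2 * Real.pi * Complex.I)), x.2) ∈
      logStrip n ×ˢ Metric.ball (0 : Fin n → ℂ) ρ :=
    ⟨by simpa using add_single_mem_logStrip hx.1 j 1, hx.2⟩
  have h1 := hS.differentiableAt (ho.mem_nhds hx)
  have h2 := hS.differentiableAt (ho.mem_nhds hx')
  rw [angleVar, ← h2.lineDeriv_eq_fderiv]
  refine HasLineDerivAt.lineDeriv ?_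
  have h3 : HasDerivAt (fun σ : ℂ => S (x + σ • (0, Pi.single i 1)))
      (fderiv ℂ S x (0, Pi.single i 1)) 0 := h1.hasFDerivAt.hasLineDerivAt _
  have h4 : HasDerivAt (fun σ : ℂ => 2 * Real.pi * Complex.I *
      (x.2 j + σ * (Pi.single i 1 : Fin n → ℂ) j + κ x.1.1 j))
      (2 * Real.pi * Complex.I * (Pi.single i 1 : Fin n → ℂ) j) 0 := by
    have := (((hasDerivAt_id (0 : ℂ)).mul_const ((Pi.single i 1 : Fin n → ℂ) j)).const_add
      (x.2 j)).add_const (κ x.1.1 j)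
    simpa using this.const_mul (2 * Real.pi * Complex.I)
  refine (h3.add h4).congr_of_eventuallyEq ?_
  filter_upwards [eventually_add_smul_mem hx (0, Pi.single i 1)] with σ hσ
  have := hper _ hσ j
  simpa using this

theorem exp_angleVar_add_single (hS : DifferentiableOn ℂ S (logStrip n ×ˢ Metric.ball 0 ρ))
    {κ : ℂ → Fin n → ℂ}
    (hper : ∀ x ∈ logStrip n ×ˢ Metric.ball (0 : Fin n → ℂ) ρ, ∀ j,
      S ((x.1.1, x.1.2 + Pi.single j (2 * Real.pi * Complex.I)), x.2) =
        S x + 2 * Real.pi * Complex.I * (x.2 j + κ x.1.1 j))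
    {x : (ℂ × (Fin n → ℂ)) × (Fin n → ℂ)} (hx : x ∈ logStrip n ×ˢ Metric.ball 0 ρ) (i j : Fin n) :
    Complex.exp (angleVar S i ((x.1.1, x.1.2 + Pi.single j (2 * Real.pi * Complex.I)), x.2)) =
      Complex.exp (angleVar S i x) := by
  rw [angleVar_add_single hS hper hx]
  by_cases h : j = i
  · subst h; simp [Complex.exp_add]
  · simp [h]

theorem add_lattice_mem_logStrip {ε : ℂ} {t : Fin n → ℂ} (h : (ε, t) ∈ logStrip n)
    (m : Fin n → ℤ) : (ε, t + fun j => (m j : ℂ) * (2 * Real.pi * Complex.I)) ∈ logStrip n :=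
  ⟨h.1, fun k => by simpa using h.2 k⟩

theorem eq_of_add_single_eq {f : (ℂ × (Fin n → ℂ)) × (Fin n → ℂ) → ℂ}
    (hf : ∀ x ∈ logStrip n ×ˢ Metric.ball (0 : Fin n → ℂ) ρ, ∀ j,
      f ((x.1.1, x.1.2 + Pi.single j (2 * Real.pi * Complex.I)), x.2) = f x) (m : Fin n → ℤ) :
    ∀ x ∈ logStrip n ×ˢ Metric.ball (0 : Fin n → ℂ) ρ,
      f ((x.1.1, x.1.2 + fun j => (m j : ℂ) * (2 * Real.pi * Complex.I)), x.2) = f x := by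
  let L : AddSubgroup (Fin n → ℤ) :=
    { carrier := {m | ∀ x ∈ logStrip n ×ˢ Metric.ball (0 : Fin n → ℂ) ρ,
        f ((x.1.1, x.1.2 + fun j => (m j : ℂ) * (2 * Real.pi * Complex.I)), x.2) = f x}
      zero_mem' := by
        intro x _
        congr
        funext j
        simp
      add_mem' := by
        intro a b ha hb x hx
        rw [← ha x hx, ← hb ((x.1.1, x.1.2 + fun j => (a j : ℂ) * (2 * Real.pi * Complex.I)), x.2) ⟨add_lattice_mem_logStrip hx.1 a, hx.2⟩]
        congr 3
        funext j
        simp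
        ring
      neg_mem' := by
        intro a ha x hx
        rw [← ha ((x.1.1, x.1.2 + fun j => (((-a) j : ℤ) : ℂ) * (2 * Real.pi * Complex.I)), x.2)
          ⟨add_lattice_mem_logStrip hx.1 (-a), hx.2⟩]
        congr
        funext j
        simp }
  have hL : m ∈ L := by
    have : m = ∑ j, m j • (Pi.single j 1 : Fin n → ℤ) := by
      funext k
      simp [Finset.sum_apply, Pi.single_apply]
    rw [this]
    refine AddSubgroup.sum_mem _ fun j _ => AddSubgroup.zsmul_mem _ ?_ _
    intro x hx
    rw [← hf x hx j]
    congr 3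
    funext k
    by_cases h : k = j
    · subst h; simp
    · simp [h]
  exact hL

theorem eq_of_exp_eq {f : (ℂ × (Fin n → ℂ)) × (Fin n → ℂ) → ℂ}
    (hf : ∀ x ∈ logStrip n ×ˢ Metric.ball (0 : Fin n → ℂ) ρ, ∀ j,
      f ((x.1.1, x.1.2 + Pi.single j (2 * Real.pi * Complex.I)), x.2) = f x) {ε : ℂ}
    {t t' a : Fin n → ℂ} (ht : (ε, t) ∈ logStrip n) (ha : a ∈ Metric.ball 0 ρ)
    (h : ∀ j, Complex.exp (t' j) = Complex.exp (t j)) : f ((ε, t'), a) = f ((ε, t), a) := by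
  choose m hm using fun j => Complex.exp_eq_exp_iff_exists_int.1 (h j)
  rw [← eq_of_add_single_eq hf m ((ε, t), a) ⟨ht, ha⟩]
  congr 3
  funext j
  exact hm j

theorem mem_logStrip_of_exp_eq {w : ℂ × Phase n} (hw : w ∈ annularDomain ∅) {t : Fin n → ℂ}
    (ht : ∀ j, Complex.exp (t j) = w.2.1 j) : (w.1, t) ∈ logStrip n := by
  refine ⟨hw.1, fun j => ?_⟩
  have h1 := hw.2.1 j
  have h2 := hw.2.2.2 j (Finset.notMem_empty j)
  have h3 : (t j).re = Real.log ‖w.2.1 j‖ := by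
    rw [← ht j, Complex.norm_exp, Real.log_exp]
  rw [h3, abs_lt]
  constructor
  · rw [← Real.log_inv]
    exact Real.log_lt_log (by norm_num) (by rwa [← one_div])
  · exact Real.log_lt_log (by linarith) h1

theorem ne_zero_of_mem_annularDomain {w : ℂ × Phase n} (hw : w ∈ annularDomain ∅) (j : Fin n) :
    w.2.1 j ≠ 0 := by
  have h := hw.2.2.2 j (Finset.notMem_empty j)
  intro h0
  rw [h0, norm_zero] at h
  norm_num at h

theorem exists_log_branch {w : ℂ × Phase n} (hw : w ∈ annularDomain ∅) :
    ∃ ℓ : ℂ × Phase n → Fin n → ℂ, DifferentiableAt ℂ ℓ w ∧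
      ∀ᶠ x in 𝓝 w, ∀ j, Complex.exp (ℓ x j) = x.2.1 j := by
  have h0 := ne_zero_of_mem_annularDomain hw
  refine ⟨fun x j => Complex.log (x.2.1 j / w.2.1 j) + Complex.log (w.2.1 j),
    differentiableAt_pi.2 fun j => ?_, eventually_all.2 fun j => ?_⟩
  · have h1 : DifferentiableAt ℂ (fun x : ℂ × Phase n => x.2.1 j) w := by fun_prop
    have h2 : DifferentiableAt ℂ (fun x : ℂ × Phase n => x.2.1 j / w.2.1 j) w := by
      simpa only [div_eq_mul_inv] using h1.mul_const _
    exact (h2.clog (by simp [h0 j])).add_const _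
  · have hc : ContinuousAt (fun x : ℂ × Phase n => x.2.1 j) w := by fun_prop
    filter_upwards [hc.eventually_ne (h0 j)] with x hx
    rw [Complex.exp_add, Complex.exp_log (div_ne_zero hx (h0 j)), Complex.exp_log (h0 j),
      div_mul_cancel₀ _ (h0 j)]

end Angle

section SymplecticCoordinates

variable {n : ℕ}

theorem fderiv_right_eq_sum {F : Type} [NormedAddCommGroup F] [NormedSpace ℂ F]
    (L : (ℂ × (Fin n → ℂ)) × (Fin n → ℂ) →L[ℂ] F) (a : Fin n → ℂ) :
    L (0, a) = ∑ j, a j • L (0, Pi.single j 1) := by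
  have h : ((0, a) : (ℂ × (Fin n → ℂ)) × (Fin n → ℂ)) = ∑ j, a j • (0, Pi.single j 1) := by
    refine Prod.ext (by simp [Prod.fst_sum]) ?_
    funext k
    simp [Prod.snd_sum, Finset.sum_apply, Pi.single_apply]
  rw [h, map_sum]
  simp only [map_smul]

/-- The symplectic form in the coordinates attached to a generating function. -/
theorem sum_fderiv_angle_action_eq {D : Set ((ℂ × (Fin n → ℂ)) × (Fin n → ℂ))} (ho : IsOpen D)
    {S : (ℂ × (Fin n → ℂ)) × (Fin n → ℂ) → ℂ} (hS : DifferentiableOn ℂ S D)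
    {ℓ K : ℂ × Phase n → Fin n → ℂ} {w : ℂ × Phase n} (hℓ : DifferentiableAt ℂ ℓ w)
    (hK : DifferentiableAt ℂ K w) (hw : ((w.1, ℓ w), K w) ∈ D) (u v : Phase n) :
    ∑ i, (fderiv ℂ (fun x => angleVar S i ((x.1, ℓ x), K x)) w (0, u) *
        fderiv ℂ (fun x => K x i) w (0, v) -
      fderiv ℂ (fun x => angleVar S i ((x.1, ℓ x), K x)) w (0, v) *
        fderiv ℂ (fun x => K x i) w (0, u)) =
    ∑ i, (fderiv ℂ (fun x => ℓ x i) w (0, u) *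
        fderiv ℂ (fun x => fderiv ℂ S ((x.1, ℓ x), K x) ((0, Pi.single i 1), 0)) w (0, v) -
      fderiv ℂ (fun x => ℓ x i) w (0, v) *
        fderiv ℂ (fun x => fderiv ℂ S ((x.1, ℓ x), K x) ((0, Pi.single i 1), 0)) w (0, u)) := by
  set G : ℂ × Phase n → (ℂ × (Fin n → ℂ)) × (Fin n → ℂ) := fun x => ((x.1, ℓ x), K x) with hG
  have hGd : HasFDerivAt G (((ContinuousLinearMap.fst ℂ _ _).prod (fderiv ℂ ℓ w)).prod
      (fderiv ℂ K w)) w :=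
    (hasFDerivAt_fst.prodMk hℓ.hasFDerivAt).prodMk hK.hasFDerivAt
  have hGv : ∀ v : Phase n, fderiv ℂ G w (0, v) =
      ((0, fderiv ℂ ℓ w (0, v)), fderiv ℂ K w (0, v)) := fun v => by rw [hGd.fderiv]; rfl
  have hS2 : DifferentiableAt ℂ (fderiv ℂ S) (G w) :=
    (hS.fderiv_of_isOpen ho).differentiableAt (ho.mem_nhds hw)
  have hcomp : ∀ (e : (ℂ × (Fin n → ℂ)) × (Fin n → ℂ)) (v : Phase n),
      fderiv ℂ (fun x => fderiv ℂ S (G x) e) w (0, v) =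
        fderiv ℂ (fderiv ℂ S) (G w) (fderiv ℂ G w (0, v)) e := by
    intro e v
    have h1 := hS2.hasFDerivAt.comp w hGd
    have h2 : HasFDerivAt (fun x => fderiv ℂ S (G x) e) _ w :=
      h1.clm_apply (hasFDerivAt_const e w)
    rw [h2.fderiv, hGd.fderiv]
    simp
  have hsymm : IsSymmSndFDerivAt ℂ S (G w) :=
    (hS.contDiffAt_of_isOpen (n := 2) ho hw).isSymmSndFDerivAt (by simp)
  have hsum1 : ∀ u v : Phase n, ∑ i, fderiv ℂ (fun x => fderiv ℂ S (G x) (0, Pi.single i 1)) w (0, u) *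
      fderiv ℂ (fun x => K x i) w (0, v) =
      fderiv ℂ (fderiv ℂ S) (G w) (fderiv ℂ G w (0, u)) (0, fderiv ℂ K w (0, v)) := by
    intro u v
    rw [fderiv_right_eq_sum]
    refine Finset.sum_congr rfl fun i _ => ?_
    rw [hcomp, ← fderiv_pi_apply hK, smul_eq_mul, mul_comm]
  have hsum2 : ∀ u v : Phase n, ∑ i, fderiv ℂ (fun x => ℓ x i) w (0, u) *
      fderiv ℂ (fun x => fderiv ℂ S (G x) ((0, Pi.single i 1), 0)) w (0, v) =
      fderiv ℂ (fderiv ℂ S) (G w) (fderiv ℂ G w (0, v)) ((0, fderiv ℂ ℓ w (0, u)), 0) := by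
    intro u v
    rw [fderiv_left_eq_sum]
    refine Finset.sum_congr rfl fun i _ => ?_
    rw [hcomp, ← fderiv_pi_apply hℓ, smul_eq_mul]
  simp only [angleVar]
  rw [Finset.sum_sub_distrib, Finset.sum_sub_distrib, hsum1, hsum1, hsum2, hsum2]
  have h := hsymm (fderiv ℂ G w (0, u)) (fderiv ℂ G w (0, v))
  have hsplit : ∀ v : Phase n, fderiv ℂ G w (0, v) =
      ((0, fderiv ℂ ℓ w (0, v)), 0) + (0, fderiv ℂ K w (0, v)) := fun v => by rw [hGv]; simp
  have hu : ∀ (M : (ℂ × (Fin n → ℂ)) × (Fin n → ℂ) →L[ℂ] ℂ) (v : Phase n),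
      M (fderiv ℂ G w (0, v)) = M ((0, fderiv ℂ ℓ w (0, v)), 0) + M (0, fderiv ℂ K w (0, v)) :=
    fun M v => by rw [← map_add, ← hsplit]
  rw [hu _ v, hu _ u] at h
  linear_combination h

/-- The exponentials of the angle variables on the annular domain. -/
noncomputable def expAngle (S : (ℂ × (Fin n → ℂ)) × (Fin n → ℂ) → ℂ)
    (K : ℂ × Phase n → Fin n → ℂ) (i : Fin n) (w : ℂ × Phase n) : ℂ :=
  Complex.exp (angleVar S i ((w.1, fun j => Complex.log (w.2.1 j)), K w))

end SymplecticCoordinates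

section ExpAngle

variable {n : ℕ} {ρ : ℝ} {S : (ℂ × (Fin n → ℂ)) × (Fin n → ℂ) → ℂ}
  {K : ℂ × Phase n → Fin n → ℂ}

theorem expAngle_ne_zero (i : Fin n) (w : ℂ × Phase n) : expAngle S K i w ≠ 0 :=
  Complex.exp_ne_zero _

theorem expAngle_eventuallyEq (hS : DifferentiableOn ℂ S (logStrip n ×ˢ Metric.ball 0 ρ))
    {κ : ℂ → Fin n → ℂ}
    (hper : ∀ x ∈ logStrip n ×ˢ Metric.ball (0 : Fin n → ℂ) ρ, ∀ j,
      S ((x.1.1, x.1.2 + Pi.single j (2 * Real.pi * Complex.I)), x.2) =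
        S x + 2 * Real.pi * Complex.I * (x.2 j + κ x.1.1 j))
    (hKρ : ∀ x ∈ annularDomain ∅, K x ∈ Metric.ball 0 ρ) {w : ℂ × Phase n}
    (hw : w ∈ annularDomain ∅) {ℓ : ℂ × Phase n → Fin n → ℂ}
    (hℓ : ∀ᶠ x in 𝓝 w, ∀ j, Complex.exp (ℓ x j) = x.2.1 j) (i : Fin n) :
    ∀ᶠ x in 𝓝 w, expAngle S K i x = Complex.exp (angleVar S i ((x.1, ℓ x), K x)) := by
  filter_upwards [hℓ, (isOpen_annularDomain ∅).mem_nhds hw] with x hx hxD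
  exact eq_of_exp_eq (f := fun x => Complex.exp (angleVar S i x))
    (fun x hx j => exp_angleVar_add_single hS hper hx i j) (mem_logStrip_of_exp_eq hxD hx)
    (hKρ x hxD)
    (fun j => by rw [hx j, Complex.exp_log (ne_zero_of_mem_annularDomain hxD j)])

theorem differentiableAt_angleVar_comp
    (hS : DifferentiableOn ℂ S (logStrip n ×ˢ Metric.ball 0 ρ))
    {w : ℂ × Phase n} {ℓ : ℂ × Phase n → Fin n → ℂ} (hℓ : DifferentiableAt ℂ ℓ w)
    (hK : DifferentiableAt ℂ K w)
    (hw : ((w.1, ℓ w), K w) ∈ logStrip n ×ˢ Metric.ball (0 : Fin n → ℂ) ρ) (i : Fin n) :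
    DifferentiableAt ℂ (fun x => angleVar S i ((x.1, ℓ x), K x)) w := by
  have ho := isOpen_logStrip_prod_ball n ρ
  have h1 : DifferentiableAt ℂ (fderiv ℂ S) ((w.1, ℓ w), K w) :=
    (hS.fderiv_of_isOpen ho).differentiableAt (ho.mem_nhds hw)
  have h2 : DifferentiableAt ℂ (fun x : ℂ × Phase n => ((x.1, ℓ x), K x)) w :=
    (differentiableAt_fst.prodMk hℓ).prodMk hK
  have h3 : DifferentiableAt ℂ (fun x => fderiv ℂ S ((x.1, ℓ x), K x)) w :=
    DifferentiableAt.comp (f := fun x : ℂ × Phase n => ((x.1, ℓ x), K x)) w h1 h2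
  exact h3.clm_apply (differentiableAt_const _)

theorem differentiableOn_expAngle (hS : DifferentiableOn ℂ S (logStrip n ×ˢ Metric.ball 0 ρ))
    {κ : ℂ → Fin n → ℂ}
    (hper : ∀ x ∈ logStrip n ×ˢ Metric.ball (0 : Fin n → ℂ) ρ, ∀ j,
      S ((x.1.1, x.1.2 + Pi.single j (2 * Real.pi * Complex.I)), x.2) =
        S x + 2 * Real.pi * Complex.I * (x.2 j + κ x.1.1 j))
    (hK : DifferentiableOn ℂ K (annularDomain ∅))
    (hKρ : ∀ x ∈ annularDomain ∅, K x ∈ Metric.ball 0 ρ) (i : Fin n) :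
    DifferentiableOn ℂ (expAngle S K i) (annularDomain ∅) := by
  intro w hw
  obtain ⟨ℓ, hℓd, hℓ⟩ := exists_log_branch hw
  refine DifferentiableAt.differentiableWithinAt ?_
  refine DifferentiableAt.congr_of_eventuallyEq ?_ (expAngle_eventuallyEq hS hper hKρ hw hℓ i)
  exact (differentiableAt_angleVar_comp hS hℓd
    (hK.differentiableAt ((isOpen_annularDomain ∅).mem_nhds hw))
    ⟨mem_logStrip_of_exp_eq hw hℓ.self_of_nhds, hKρ w hw⟩ i).cexp

/-- Polar coordinates are symplectic. -/
theorem mul_sub_mul_of_mul_eq {E : Type} [NormedAddCommGroup E] [NormedSpace ℂ E]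
    {X Y θ k : E → ℂ} {w : E} (hX : X =ᶠ[𝓝 w] fun x => Complex.exp (θ x))
    (hXY : ∀ᶠ x in 𝓝 w, X x * Y x = k x) (hθ : DifferentiableAt ℂ θ w)
    (hY : DifferentiableAt ℂ Y w) (u v : E) :
    fderiv ℂ X w u * fderiv ℂ Y w v - fderiv ℂ X w v * fderiv ℂ Y w u =
      fderiv ℂ θ w u * fderiv ℂ k w v - fderiv ℂ θ w v * fderiv ℂ k w u := by
  have h1 : HasFDerivAt X (Complex.exp (θ w) • fderiv ℂ θ w) w :=
    hθ.hasFDerivAt.cexp.congr_of_eventuallyEq hX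
  have h2 : HasFDerivAt k (X w • fderiv ℂ Y w + Y w • (Complex.exp (θ w) • fderiv ℂ θ w)) w :=
    (h1.mul hY.hasFDerivAt).congr_of_eventuallyEq (hXY.mono fun x hx => hx.symm)
  rw [h1.fderiv, h2.fderiv, hX.self_of_nhds]
  simp only [_root_.smul_apply, _root_.add_apply, smul_eq_mul]
  ring

/-- The exponentials of the angles together with `K / expAngle` are symplectic coordinates. -/
theorem sum_fderiv_expAngle_eq_omegaC
    (hS : DifferentiableOn ℂ S (logStrip n ×ˢ Metric.ball 0 ρ))
    {κ : ℂ → Fin n → ℂ}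
    (hper : ∀ x ∈ logStrip n ×ˢ Metric.ball (0 : Fin n → ℂ) ρ, ∀ j,
      S ((x.1.1, x.1.2 + Pi.single j (2 * Real.pi * Complex.I)), x.2) =
        S x + 2 * Real.pi * Complex.I * (x.2 j + κ x.1.1 j))
    (hK : DifferentiableOn ℂ K (annularDomain ∅))
    (hKρ : ∀ x ∈ annularDomain ∅, K x ∈ Metric.ball 0 ρ)
    (hSP : ∀ w ∈ annularDomain ∅, ∀ t : Fin n → ℂ, (∀ j, Complex.exp (t j) = w.2.1 j) →
      ∀ k, fderiv ℂ S ((w.1, t), K w) ((0, Pi.single k 1), 0) = w.2.1 k * w.2.2 k)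
    {w : ℂ × Phase n} (hw : w ∈ annularDomain ∅) (u v : Phase n) :
    ∑ i, (fderiv ℂ (expAngle S K i) w (0, u) *
          fderiv ℂ (fun x => K x i * (expAngle S K i x)⁻¹) w (0, v) -
        fderiv ℂ (expAngle S K i) w (0, v) *
          fderiv ℂ (fun x => K x i * (expAngle S K i x)⁻¹) w (0, u)) = omegaC u v := by
  obtain ⟨ℓ, hℓd, hℓ⟩ := exists_log_branch hw
  have hD := (isOpen_annularDomain ∅).mem_nhds hw
  have hKw := hK.differentiableAt hD
  have hKi : ∀ i, DifferentiableAt ℂ (fun x => K x i) w := fun i => differentiableAt_pi.1 hKw i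
  have hmem : ((w.1, ℓ w), K w) ∈ logStrip n ×ˢ Metric.ball (0 : Fin n → ℂ) ρ :=
    ⟨mem_logStrip_of_exp_eq hw hℓ.self_of_nhds, hKρ w hw⟩
  have hX := fun i => (differentiableOn_expAngle hS hper hK hKρ i).differentiableAt hD
  rw [Finset.sum_congr rfl fun i _ => mul_sub_mul_of_mul_eq (k := fun x => K x i)
    (expAngle_eventuallyEq hS hper hKρ hw hℓ i)
    (Eventually.of_forall fun x => by
      rw [mul_comm, mul_assoc, inv_mul_cancel₀ (expAngle_ne_zero i x), mul_one])
    (differentiableAt_angleVar_comp hS hℓd hKw hmem i)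
    ((hKi i).fun_mul ((hX i).fun_inv (expAngle_ne_zero i w))) (0, u) (0, v)]
  rw [sum_fderiv_angle_action_eq (isOpen_logStrip_prod_ball n ρ) hS hℓd hKw hmem, omegaC]
  refine Finset.sum_congr rfl fun i _ => ?_
  have hq : HasFDerivAt (fun x : ℂ × Phase n => x.2.1 i)
      ((ContinuousLinearMap.proj i).comp ((ContinuousLinearMap.fst ℂ _ _).comp
        (ContinuousLinearMap.snd ℂ ℂ (Phase n)))) w :=
    ContinuousLinearMap.hasFDerivAt ((ContinuousLinearMap.proj i).comp
      ((ContinuousLinearMap.fst ℂ (Fin n → ℂ) (Fin n → ℂ)).comp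
        (ContinuousLinearMap.snd ℂ ℂ (Phase n))))
  have hp : HasFDerivAt (fun x : ℂ × Phase n => x.2.2 i)
      ((ContinuousLinearMap.proj i).comp ((ContinuousLinearMap.snd ℂ _ _).comp
        (ContinuousLinearMap.snd ℂ ℂ (Phase n)))) w :=
    ContinuousLinearMap.hasFDerivAt ((ContinuousLinearMap.proj i).comp
      ((ContinuousLinearMap.snd ℂ (Fin n → ℂ) (Fin n → ℂ)).comp
        (ContinuousLinearMap.snd ℂ ℂ (Phase n))))
  have hS1 : (fun x => fderiv ℂ S ((x.1, ℓ x), K x) ((0, Pi.single i 1), 0)) =ᶠ[𝓝 w]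
      fun x => x.2.1 i * x.2.2 i := by
    filter_upwards [hℓ, (isOpen_annularDomain ∅).mem_nhds hw] with x hx hxD
    exact hSP x hxD _ hx i
  have hℓi : DifferentiableAt ℂ (fun x => ℓ x i) w := differentiableAt_pi.1 hℓd i
  have he : ∀ v : Phase n, w.2.1 i * fderiv ℂ (fun x => ℓ x i) w (0, v) = v.1 i := by
    intro v
    have h1 := hℓi.hasFDerivAt.cexp
    have h2 := (hq.congr_of_eventuallyEq (hℓ.mono fun x hx => hx i)).unique h1
    have h3 := congrArg (fun L : ℂ × Phase n →L[ℂ] ℂ => L (0, v)) h2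
    rw [hℓ.self_of_nhds i] at h3
    simpa using h3.symm
  rw [((hq.mul hp).congr_of_eventuallyEq hS1).fderiv]
  simp only [_root_.add_apply, _root_.smul_apply, smul_eq_mul, ContinuousLinearMap.comp_apply,
    ContinuousLinearMap.coe_snd', ContinuousLinearMap.coe_fst', ContinuousLinearMap.proj_apply]
  have hu := he u
  have hv := he v
  linear_combination (v.2 i) * hu - (u.2 i) * hv +
    (fderiv ℂ (fun x => ℓ x i) w (0, v) * w.2.2 i) * hu -
    (fderiv ℂ (fun x => ℓ x i) w (0, u) * w.2.2 i) * hv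

theorem expAngle_of_fst_eq_zero
    (hS : DifferentiableOn ℂ S (logStrip n ×ˢ Metric.ball 0 ρ))
    (hS0 : ∀ x ∈ logStrip n ×ˢ Metric.ball (0 : Fin n → ℂ) ρ, x.1.1 = 0 →
      S x = ∑ j, x.1.2 j * x.2 j)
    (hKρ : ∀ x ∈ annularDomain ∅, K x ∈ Metric.ball 0 ρ) {w : ℂ × Phase n}
    (hw : w ∈ annularDomain ∅) (hw0 : w.1 = 0) (i : Fin n) : expAngle S K i w = w.2.1 i := by
  have hlog : ∀ j, Complex.exp (Complex.log (w.2.1 j)) = w.2.1 j := fun j =>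
    Complex.exp_log (ne_zero_of_mem_annularDomain hw j)
  have hmem : ((w.1, fun j => Complex.log (w.2.1 j)), K w) ∈
      logStrip n ×ˢ Metric.ball (0 : Fin n → ℂ) ρ := ⟨mem_logStrip_of_exp_eq hw hlog, hKρ w hw⟩
  rw [expAngle, angleVar]
  obtain ⟨x, hx⟩ : ∃ x, ((w.1, fun j => Complex.log (w.2.1 j)), K w) = x := ⟨_, rfl⟩
  have hx1 : x.1.1 = 0 := by rw [← hx]; exact hw0
  have hx2 : x.1.2 i = Complex.log (w.2.1 i) := by rw [← hx]
  rw [hx] at hmem ⊢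
  have hd := hS.differentiableAt ((isOpen_logStrip_prod_ball n ρ).mem_nhds hmem)
  have h1 : HasDerivAt (fun σ : ℂ => ∑ j, x.1.2 j * (x.2 j + σ * (Pi.single i 1 : Fin n → ℂ) j))
      (∑ j, x.1.2 j * (Pi.single i 1 : Fin n → ℂ) j) 0 := by
    refine HasDerivAt.fun_sum fun j _ => ?_
    simpa using ((((hasDerivAt_id (0 : ℂ)).mul_const _).const_add _).const_mul (x.1.2 j))
  have h2 : HasLineDerivAt ℂ S (∑ j, x.1.2 j * (Pi.single i 1 : Fin n → ℂ) j) x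
      (0, Pi.single i 1) := by
    refine HasDerivAt.congr_of_eventuallyEq h1 ?_
    filter_upwards [eventually_add_smul_mem hmem (0, Pi.single i 1)] with σ hσ
    rw [hS0 _ hσ (by simpa using hx1)]
    simp
  rw [← hd.lineDeriv_eq_fderiv, h2.lineDeriv]
  simp only [Pi.single_apply, mul_ite, mul_one, mul_zero, Finset.sum_ite_eq', Finset.mem_univ,
    if_true]
  rw [hx2, hlog]

end ExpAngle

section SymplecticLinearAlgebra

variable {n : ℕ}

theorem omegaC_single_right (u : Phase n) (l : Fin n) : omegaC u (0, Pi.single l 1) = u.1 l := by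
  simp [omegaC, Pi.single_apply]

theorem omegaC_single_left (u : Phase n) (l : Fin n) : omegaC u (Pi.single l 1, 0) = -u.2 l := by
  simp [omegaC, Pi.single_apply]

theorem eq_of_omegaC_eq {u u' : Phase n} (h : ∀ v, omegaC u v = omegaC u' v) : u = u' := by
  refine Prod.ext (funext fun l => ?_) (funext fun l => ?_)
  · simpa only [omegaC_single_right] using h (0, Pi.single l 1)
  · simpa only [omegaC_single_left, neg_inj] using h (Pi.single l 1, 0)

theorem injective_of_omegaC_map_eq {M : Phase n →ₗ[ℂ] Phase n}
    (hM : ∀ u v, omegaC (M u) (M v) = omegaC u v) : Function.Injective M := by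
  intro u u' h
  refine eq_of_omegaC_eq fun v => ?_
  rw [← hM u v, h, hM]

theorem phase_eq_sum (z : Phase n) : z =
    ∑ l, z.1 l • ((Pi.single l 1, 0) : Phase n) + ∑ l, z.2 l • ((0, Pi.single l 1) : Phase n) := by
  refine Prod.ext (funext fun j => ?_) (funext fun j => ?_)
  · simp [Prod.fst_sum, Finset.sum_apply, Pi.single_apply]
  · simp [Prod.snd_sum, Finset.sum_apply, Pi.single_apply]

/-- The Hamiltonian vector of a linear form. -/
noncomputable def hamVec (L : Phase n →ₗ[ℂ] ℂ) : Phase n :=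
  (fun l => L (0, Pi.single l 1), fun l => -L (Pi.single l 1, 0))

theorem omegaC_hamVec (L : Phase n →ₗ[ℂ] ℂ) (v : Phase n) : omegaC (hamVec L) v = L v := by
  conv_rhs => rw [phase_eq_sum v]
  rw [map_add, map_sum, map_sum, omegaC, ← Finset.sum_add_distrib]
  refine Finset.sum_congr rfl fun l _ => ?_
  simp only [hamVec, map_smul, smul_eq_mul]
  ring

theorem map_hamVec {M : Phase n →ₗ[ℂ] Phase n}
    (hM : ∀ u v, omegaC (M u) (M v) = omegaC u v) {L : Phase n →ₗ[ℂ] ℂ} {η : Phase n}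
    (h : ∀ v, L v = omegaC η (M v)) : M (hamVec L) = η := by
  obtain ⟨ζ, rfl⟩ := LinearMap.injective_iff_surjective.1 (injective_of_omegaC_map_eq hM) η
  congr 1
  exact eq_of_omegaC_eq fun v => by rw [omegaC_hamVec, h, hM]

theorem paramBracket_eq_fderiv_hamVec (f g : ℂ × Phase n → ℂ) (w : ℂ × Phase n) :
    paramBracket f g w =
      fderiv ℂ g w (0, hamVec ((fderiv ℂ f w).toLinearMap.comp (LinearMap.inr ℂ ℂ (Phase n)))) := by
  have h := congrArg ((fderiv ℂ g w).toLinearMap.comp (LinearMap.inr ℂ ℂ (Phase n)))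
    (phase_eq_sum (hamVec ((fderiv ℂ f w).toLinearMap.comp (LinearMap.inr ℂ ℂ (Phase n)))))
  have h2 := h
  rw [map_add, map_sum, map_sum, ← Finset.sum_add_distrib] at h2
  simp only [map_smul, smul_eq_mul] at h2
  refine Eq.trans ?_ h2.symm
  unfold paramBracket
  refine Finset.sum_congr rfl fun l _ => ?_
  simp only [hamVec, LinearMap.comp_apply, LinearMap.inr_apply, ContinuousLinearMap.coe_coe, qDir,
    pDir]
  ring

/-- Brackets in symplectic coordinates. -/
theorem paramBracket_of_symplectic {X Y : Fin n → ℂ × Phase n → ℂ} {w : ℂ × Phase n}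
    (hω : ∀ u v : Phase n, ∑ i, (fderiv ℂ (X i) w (0, u) * fderiv ℂ (Y i) w (0, v) -
      fderiv ℂ (X i) w (0, v) * fderiv ℂ (Y i) w (0, u)) = omegaC u v)
    {f : ℂ × Phase n → ℂ} {α β : Fin n → ℂ}
    (hf : ∀ v : Phase n, fderiv ℂ f w (0, v) =
      ∑ i, (α i * fderiv ℂ (Y i) w (0, v) - β i * fderiv ℂ (X i) w (0, v))) (i : Fin n) :
    paramBracket f (X i) w = α i ∧ paramBracket f (Y i) w = β i := by
  let M : Phase n →ₗ[ℂ] Phase n :=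
    (LinearMap.pi fun i => (fderiv ℂ (X i) w).toLinearMap.comp (LinearMap.inr ℂ ℂ (Phase n))).prod
      (LinearMap.pi fun i => (fderiv ℂ (Y i) w).toLinearMap.comp (LinearMap.inr ℂ ℂ (Phase n)))
  have hM : ∀ u v, omegaC (M u) (M v) = omegaC u v := by
    intro u v
    rw [← hω u v, omegaC]
    refine Finset.sum_congr rfl fun i _ => ?_
    change fderiv ℂ (X i) w (0, u) * fderiv ℂ (Y i) w (0, v) -
      fderiv ℂ (Y i) w (0, u) * fderiv ℂ (X i) w (0, v) = _
    ring
  have h := map_hamVec hM (η := (α, β))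
    (L := (fderiv ℂ f w).toLinearMap.comp (LinearMap.inr ℂ ℂ (Phase n))) (fun v => hf v)
  rw [paramBracket_eq_fderiv_hamVec, paramBracket_eq_fderiv_hamVec]
  exact ⟨congrFun (congrArg Prod.fst h) i, congrFun (congrArg Prod.snd h) i⟩

end SymplecticLinearAlgebra

section Coordinates

variable {n : ℕ} {X Y K : Fin n → ℂ × Phase n → ℂ} {w : ℂ × Phase n}

theorem paramBracket_action_of_symplectic
    (hω : ∀ u v : Phase n, ∑ i, (fderiv ℂ (X i) w (0, u) * fderiv ℂ (Y i) w (0, v) -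
      fderiv ℂ (X i) w (0, v) * fderiv ℂ (Y i) w (0, u)) = omegaC u v) {k : Fin n}
    (hX : DifferentiableAt ℂ (X k) w) (hY : DifferentiableAt ℂ (Y k) w)
    (hK : ∀ᶠ x in 𝓝 w, X k x * Y k x = K k x) (i : Fin n) :
    paramBracket (K k) (X i) w = (Pi.single i 1 : Fin n → ℂ) k * X i w ∧
      paramBracket (K k) (Y i) w = -((Pi.single i 1 : Fin n → ℂ) k * Y i w) := by
  have hd : HasFDerivAt (K k) _ w :=
    (hX.hasFDerivAt.mul hY.hasFDerivAt).congr_of_eventuallyEq (hK.mono fun x hx => hx.symm)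
  have h := paramBracket_of_symplectic hω (f := K k) (α := Pi.single k (X k w))
    (β := -Pi.single k (Y k w)) (fun v => by
      rw [hd.fderiv]
      simp [Pi.single_apply, Finset.sum_add_distrib]) i
  rw [h.1, h.2]
  by_cases hik : i = k
  · subst hik; simp
  · have hik' : k ≠ i := fun h => hik h.symm
    simp [hik, hik']

theorem paramBracket_position_of_symplectic
    (hω : ∀ u v : Phase n, ∑ i, (fderiv ℂ (X i) w (0, u) * fderiv ℂ (Y i) w (0, v) -
      fderiv ℂ (X i) w (0, v) * fderiv ℂ (Y i) w (0, u)) = omegaC u v) (j i : Fin n) :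
    paramBracket (X j) (Y i) w = -(Pi.single j 1 : Fin n → ℂ) i :=
  (paramBracket_of_symplectic hω (f := X j) (α := 0) (β := -Pi.single j 1) (fun v => by
      simp [Pi.single_apply]) i).2

/-- Symplectic coordinates on the annular domain adapted to `K` extend to the polydisc. -/
theorem exists_extension_of_symplectic_coordinates
    (hK : ∀ k, DifferentiableOn ℂ (K k) (annularDomain Finset.univ))
    (hK0 : ∀ k, ∀ x ∈ annularDomain Finset.univ, x.1 = 0 → K k x = x.2.1 k * x.2.2 k)
    (hKo : ∀ k ε, ‖ε‖ < 1 → K k (ε, 0) = 0)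
    (hKd : ∀ k ε, ‖ε‖ < 1 → ∀ v : Phase n, fderiv ℂ (K k) (ε, 0) (0, v) = 0)
    (hX : ∀ k, DifferentiableOn ℂ (X k) (annularDomain ∅))
    (hXne : ∀ k, ∀ x ∈ annularDomain ∅, X k x ≠ 0)
    (hX0 : ∀ k, ∀ x ∈ annularDomain ∅, x.1 = 0 → X k x = x.2.1 k)
    (hω : ∀ w ∈ annularDomain ∅, ∀ u v : Phase n,
      ∑ i, (fderiv ℂ (X i) w (0, u) * fderiv ℂ (fun x => K i x * (X i x)⁻¹) w (0, v) -
        fderiv ℂ (X i) w (0, v) * fderiv ℂ (fun x => K i x * (X i x)⁻¹) w (0, u)) = omegaC u v) :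
    ∃ x y : Fin n → ℂ × Phase n → ℂ,
      (∀ k, DifferentiableOn ℂ (x k) (annularDomain Finset.univ)) ∧
      (∀ k, DifferentiableOn ℂ (y k) (annularDomain Finset.univ)) ∧
      (∀ k, ∀ w ∈ annularDomain Finset.univ, x k w * y k w = K k w) ∧
      (∀ k ε, ‖ε‖ < 1 → x k (ε, 0) = 0) ∧ (∀ k ε, ‖ε‖ < 1 → y k (ε, 0) = 0) ∧
      ∀ w ∈ annularDomain Finset.univ, ∀ u v : Phase n,
        ∑ i, (fderiv ℂ (x i) w (0, u) * fderiv ℂ (y i) w (0, v) -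
          fderiv ℂ (x i) w (0, v) * fderiv ℂ (y i) w (0, u)) = omegaC u v := by
  classical
  have hsub : annularDomain (∅ : Finset (Fin n)) ⊆ annularDomain Finset.univ :=
    annularDomain_mono (Finset.empty_subset _)
  have ho := isOpen_annularDomain (∅ : Finset (Fin n))
  have hY : ∀ k, DifferentiableOn ℂ (fun x => K k x * (X k x)⁻¹) (annularDomain ∅) := fun k =>
    ((hK k).mono hsub).mul ((hX k).inv (hXne k))
  have hXY : ∀ k, ∀ x ∈ annularDomain ∅, X k x * (K k x * (X k x)⁻¹) = K k x := fun k x hx => by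
    rw [mul_comm, mul_assoc, inv_mul_cancel₀ (hXne k x hx), mul_one]
  have hPB : ∀ k i, ∀ w ∈ annularDomain ∅, _ := fun k i w hw =>
    paramBracket_action_of_symplectic (hω w hw) (K := K) ((hX k).differentiableAt (ho.mem_nhds hw))
      ((hY k).differentiableAt (ho.mem_nhds hw))
      (eventually_of_mem (ho.mem_nhds hw) (hXY k)) i
  have hex : ∀ i, ∃ F, DifferentiableOn ℂ F (annularDomain Finset.univ) ∧
      Set.EqOn F (X i) (annularDomain ∅) := fun i =>
    exists_extension_of_paramBracket hK hK0 (hX i) (Pi.single i 1) Finset.univ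
      (fun k _ w hw => by
        rw [(hPB k i w hw).1]
        congr 1
        simp [Pi.single_apply])
  choose x hx hxX using hex
  have hcong : ∀ {f g : ℂ × Phase n → ℂ}, Set.EqOn f g (annularDomain ∅) →
      ∀ w ∈ annularDomain ∅, fderiv ℂ f w = fderiv ℂ g w := fun h w hw =>
    (eventuallyEq_of_mem (ho.mem_nhds hw) h).fderiv_eq
  have horigin : ∀ ε : ℂ, ‖ε‖ < 1 → (ε, (0 : Phase n)) ∈ annularDomain Finset.univ := fun ε hε =>
    mem_annularDomain_univ.2 ⟨hε, by simp, by simp⟩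
  have hKzero : ∀ k ε, ‖ε‖ < 1 → ∀ f : ℂ × Phase n → ℂ, paramBracket (K k) f (ε, 0) = 0 := by
    intro k ε hε f
    unfold paramBracket
    simp only [qDir, pDir, hKd k ε hε, zero_mul, sub_zero, Finset.sum_const_zero]
  have hxo : ∀ k ε, ‖ε‖ < 1 → x k (ε, 0) = 0 := by
    intro k ε hε
    have h : Set.EqOn (paramBracket (K k) (x k)) (x k) (annularDomain Finset.univ) := by
      refine eqOn_annularDomain_of_eqOn_empty (differentiableOn_paramBracket (hK k) (hx k)) (hx k)
        fun w hw => ?_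
      rw [paramBracket_congr_right (hxX k) hw, (hPB k k w hw).1, hxX k hw]
      simp
    rw [← h (horigin ε hε), hKzero k ε hε]
  have hx0 : ∀ k, ∀ w ∈ annularDomain Finset.univ, w.1 = 0 → x k w = w.2.1 k := by
    intro k w hw hw0
    have h : Set.EqOn (fun w : ℂ × Phase n => x k (0, w.2)) (fun w => w.2.1 k)
        (annularDomain Finset.univ) := by
      refine eqOn_annularDomain_of_eqOn_empty ?_ ?_ fun w hw => ?_
      · exact (hx k).comp (by fun_prop) fun w hw => zero_snd_mem hw
      · exact Differentiable.differentiableOn (by fun_prop)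
      · have := zero_snd_mem hw
        simp only [hxX k this, hX0 k _ this rfl]
    have h' := h hw
    simp only [← hw0] at h'
    exact h'
  have hxy : ∀ k, Set.EqOn (fun w => x k w * (K k w * (X k w)⁻¹)) (K k) (annularDomain ∅) :=
    fun k w hw => by
      simp only [hxX k hw]
      exact hXY k w hw
  have hωx : ∀ w ∈ annularDomain ∅, ∀ u v : Phase n,
      ∑ i, (fderiv ℂ (x i) w (0, u) * fderiv ℂ (fun x => K i x * (X i x)⁻¹) w (0, v) -
        fderiv ℂ (x i) w (0, v) * fderiv ℂ (fun x => K i x * (X i x)⁻¹) w (0, u)) =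
        omegaC u v := by
    intro w hw u v
    simp only [hcong (hxX _) w hw]
    exact hω w hw u v
  have hey : ∀ i, ∃ F, DifferentiableOn ℂ F (annularDomain Finset.univ) ∧
      Set.EqOn F (fun x => K i x * (X i x)⁻¹) (annularDomain ∅) := by
    intro i
    refine exists_extension_of_conjugate hK hK0 hx hx0 (hKo i) (hxo i) (hY i) ?_ ?_ ?_
      (fun w hw => hxy i hw)
    · intro k hk w hw
      rw [(hPB k i w hw).2]
      simp [hk]
    · intro w hw
      rw [(hPB i i w hw).2]
      simp
    · exact fun j => ⟨_, fun w hw => paramBracket_position_of_symplectic (hωx w hw) j i⟩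
  choose y hy hyY using hey
  refine ⟨x, y, hx, hy, fun k => ?_, hxo, ?_, ?_⟩
  · refine eqOn_annularDomain_of_eqOn_empty ((hx k).mul (hy k)) (hK k) fun w hw => ?_
    rw [hyY k hw]
    exact hxy k hw
  · intro k ε hε
    have h : Set.EqOn (paramBracket (K k) (y k)) (fun w => -y k w) (annularDomain Finset.univ) := by
      refine eqOn_annularDomain_of_eqOn_empty (differentiableOn_paramBracket (hK k) (hy k))
        (hy k).neg fun w hw => ?_
      rw [paramBracket_congr_right (hyY k) hw, (hPB k k w hw).2, hyY k hw]
      simp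
    have h' := h (horigin ε hε)
    rw [hKzero k ε hε] at h'
    exact (neg_eq_zero.1 h'.symm)
  · intro w hw u v
    refine eqOn_annularDomain_of_eqOn_empty
      (f := fun w => ∑ i, (fderiv ℂ (x i) w (0, u) * fderiv ℂ (y i) w (0, v) -
          fderiv ℂ (x i) w (0, v) * fderiv ℂ (y i) w (0, u)))
      (g := fun _ => omegaC u v) ?_ (differentiableOn_const _) (fun w hw => ?_) hw
    · refine DifferentiableOn.fun_sum fun i _ => ?_
      exact ((differentiableOn_fderiv_apply (hx i) _).mul
        (differentiableOn_fderiv_apply (hy i) _)).sub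
        ((differentiableOn_fderiv_apply (hx i) _).mul (differentiableOn_fderiv_apply (hy i) _))
    · simp only [hcong (hyY _) w hw]
      exact hωx w hw u v

end Coordinates

section NormalFormWithParameter

variable {n : ℕ}

/-- The normal form for a perturbation depending on a parameter. -/
theorem exists_normal_form_with_parameter {R : ℂ × Phase n → Fin n → ℂ} {c : ℝ}
    (hR : DifferentiableOn ℂ R (Metric.ball 0 1 ×ˢ Metric.ball 0 8))
    (hb : ∀ w ∈ Metric.ball (0 : ℂ) 1 ×ˢ Metric.ball (0 : Phase n) 8, ‖R w‖ ≤ c)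
    (hc0 : 0 ≤ c) (hc : 32 * c ≤ 1) (hR0 : ∀ z ∈ Metric.ball (0 : Phase n) 8, R (0, z) = 0)
    (hRo : ∀ ε ∈ Metric.ball (0 : ℂ) 1, R (ε, 0) = 0)
    (hRd : ∀ ε ∈ Metric.ball (0 : ℂ) 1, ∀ v : Phase n, fderiv ℂ R (ε, 0) (0, v) = 0)
    (hcomm : ∀ w ∈ Metric.ball (0 : ℂ) 1 ×ˢ Metric.ball (0 : Phase n) 8, ∀ i j,
      paramBracket (fun x => x.2.2 i * x.2.1 i + R x i) (fun x => x.2.2 j * x.2.1 j + R x j) w = 0) :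
    ∃ (A B : ℂ × (Fin n → ℂ) → Fin n → ℂ) (x y : Fin n → ℂ × Phase n → ℂ),
      DifferentiableOn ℂ A (Metric.ball 0 1 ×ˢ Metric.ball 0 1) ∧
      DifferentiableOn ℂ B (Metric.ball 0 1 ×ˢ Metric.ball 0 (1 / 4)) ∧
      (∀ ε, A (ε, 0) = 0) ∧
      (∀ ε ∈ Metric.ball (0 : ℂ) 1, ∀ h ∈ Metric.ball (0 : Fin n → ℂ) (1 / 2),
        A (ε, h) ∈ Metric.ball (0 : Fin n → ℂ) (1 / 4) → B (ε, A (ε, h)) = h) ∧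
      (∀ k, DifferentiableOn ℂ (x k) (annularDomain Finset.univ)) ∧
      (∀ k, DifferentiableOn ℂ (y k) (annularDomain Finset.univ)) ∧
      (∀ w ∈ annularDomain Finset.univ,
        B (w.1, fun i => x i w * y i w) = fun i => w.2.2 i * w.2.1 i + R w i) ∧
      (∀ k ε, ‖ε‖ < 1 → x k (ε, 0) = 0) ∧ (∀ k ε, ‖ε‖ < 1 → y k (ε, 0) = 0) ∧
      ∀ w ∈ annularDomain Finset.univ, ∀ u v : Phase n,
        ∑ i, (fderiv ℂ (x i) w (0, u) * fderiv ℂ (y i) w (0, v) -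
          fderiv ℂ (x i) w (0, v) * fderiv ℂ (y i) w (0, u)) = omegaC u v := by
  obtain ⟨A, B, S, κ, hA, hAb, hAo, hA0, hB, hBA, hS, hSP, hper, hS0⟩ :=
    exists_action_angle_generating_function hR hb hc0 hc hR0 hcomm
  set U := Metric.ball (0 : ℂ) 1 ×ˢ Metric.ball (0 : Phase n) 8 with hU
  have hsubU : annularDomain (Finset.univ : Finset (Fin n)) ⊆ U := by
    intro w hw
    obtain ⟨h1, h2, h3⟩ := mem_annularDomain_univ.1 hw
    refine ⟨by simpa using h1, mem_ball_zero_iff.2 (max_lt ?_ ?_)⟩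
    · exact (pi_norm_lt_iff (by norm_num)).2 fun j => (h2 j).trans (by norm_num)
    · exact (pi_norm_lt_iff (by norm_num)).2 fun j => (h3 j).trans (by norm_num)
  have hsub : annularDomain (∅ : Finset (Fin n)) ⊆ annularDomain Finset.univ :=
    annularDomain_mono (Finset.empty_subset _)
  have ho := isOpen_annularDomain (Finset.univ : Finset (Fin n))
  set P : ℂ × Phase n → Fin n → ℂ := fun w i => w.2.1 i * w.2.2 i with hP
  set H : ℂ × Phase n → Fin n → ℂ := fun w => P w + R w with hH
  set K : ℂ × Phase n → Fin n → ℂ := fun w => A (w.1, H w) with hK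
  have hPd : Differentiable ℂ P := by
    refine differentiable_pi.2 fun i => ?_
    simp only [hP]
    fun_prop
  have hHd : DifferentiableOn ℂ H (annularDomain Finset.univ) :=
    hPd.differentiableOn.add (hR.mono hsubU)
  have hPb : ∀ w ∈ annularDomain Finset.univ, ‖P w‖ ≤ 1 / 8 := by
    intro w hw
    obtain ⟨-, h2, h3⟩ := mem_annularDomain_univ.1 hw
    refine (pi_norm_le_iff_of_nonneg (by norm_num)).2 fun j => ?_
    rw [hP, norm_mul]
    calc _ ≤ 2 * (1 / 16 : ℝ) :=
          mul_le_mul (h2 j).le (h3 j).le (norm_nonneg _) (by norm_num)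
      _ = _ := by norm_num
  have hHb : ∀ w ∈ annularDomain Finset.univ, ‖H w‖ ≤ 1 / 8 + c := fun w hw =>
    (norm_add_le _ _).trans (add_le_add (hPb w hw) (hb w (hsubU hw)))
  have hmA : ∀ w ∈ annularDomain Finset.univ,
      (w.1, H w) ∈ Metric.ball (0 : ℂ) 1 ×ˢ Metric.ball (0 : Fin n → ℂ) 1 := fun w hw =>
    ⟨by simpa using hw.1, mem_ball_zero_iff.2 ((hHb w hw).trans_lt (by linarith))⟩
  have hKd : DifferentiableOn ℂ K (annularDomain Finset.univ) :=
    hA.comp (f := fun w : ℂ × Phase n => (w.1, H w))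
      (differentiable_fst.differentiableOn.prodMk hHd) hmA
  have hKρ : ∀ w ∈ annularDomain Finset.univ, K w ∈ Metric.ball (0 : Fin n → ℂ) (1 / 4) := by
    intro w hw
    refine mem_ball_zero_iff.2 ?_
    have h1 := hAb _ (hmA w hw)
    have h2 := norm_sub_norm_le (K w) (H w)
    have h3 := hHb w hw
    have h4 : ‖K w - H w‖ ≤ 2 * c := h1
    linarith
  have horigin : ∀ ε : ℂ, ‖ε‖ < 1 → (ε, (0 : Phase n)) ∈ annularDomain Finset.univ := fun ε hε =>
    mem_annularDomain_univ.2 ⟨hε, by simp, by simp⟩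
  have hHo : ∀ ε : ℂ, ‖ε‖ < 1 → H (ε, 0) = 0 := by
    intro ε hε
    funext i
    simp [hH, hP, hRo ε (by simpa using hε)]
  have hSP' : ∀ w ∈ annularDomain ∅, ∀ t : Fin n → ℂ, (∀ j, Complex.exp (t j) = w.2.1 j) →
      ∀ k, fderiv ℂ S ((w.1, t), K w) ((0, Pi.single k 1), 0) = w.2.1 k * w.2.2 k := by
    intro w hw t ht k
    have hwu := hsub hw
    have hchart : logChart ((w.1, t), P w) = w := by
      refine Prod.ext rfl (Prod.ext (funext ht) (funext fun j => ?_))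
      change w.2.1 j * w.2.2 j * Complex.exp (-t j) = w.2.2 j
      rw [Complex.exp_neg, ht j]
      field_simp [ne_zero_of_mem_annularDomain hw j]
    have h := hSP (w.1, t) (mem_logStrip_of_exp_eq hw ht) (P w)
      (mem_ball_zero_iff.2 ((hPb w hwu).trans_lt (by norm_num)))
    rw [hchart] at h
    exact h (mem_ball_zero_iff.2 ((hHb w hwu).trans_lt (by linarith))) (hKρ w hwu) k
  obtain ⟨x, y, hx, hy, hxy, hxo, hyo, hω⟩ := exists_extension_of_symplectic_coordinates
    (K := fun k w => K w k) (X := expAngle S K)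
    (fun k w hw => differentiableWithinAt_pi.1 (hKd w hw) k)
    (fun k w hw hw0 => by
      have hRw : R w = 0 := by
        rw [← hR0 w.2 (hsubU hw).2, ← hw0]
      change A (w.1, P w + R w) k = _
      rw [hRw, add_zero, hw0,
        hA0 _ (mem_ball_zero_iff.2 ((hPb w hw).trans_lt (by norm_num)))])
    (fun k ε hε => by
      change A (ε, H (ε, 0)) k = 0
      rw [hHo ε hε, hAo]
      rfl)
    (fun k ε hε v => by
      have hw := ho.mem_nhds (horigin ε hε)
      have hHv : fderiv ℂ H (ε, 0) (0, v) = 0 := by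
        have h1 := (hPd (ε, 0)).hasFDerivAt.add
          ((hR.mono hsubU).differentiableAt hw).hasFDerivAt
        have h2 : fderiv ℂ H (ε, 0) = fderiv ℂ P (ε, 0) + fderiv ℂ R (ε, 0) := h1.fderiv
        rw [h2, _root_.add_apply, hRd ε (by simpa using hε), add_zero]
        funext i
        rw [fderiv_pi_apply (hPd _)]
        have h3 : HasFDerivAt (fun x : ℂ × Phase n => x.2.1 i * x.2.2 i) _ (ε, 0) :=
          HasFDerivAt.fun_mul
            (DifferentiableAt.hasFDerivAt (𝕜 := ℂ) (f := fun x : ℂ × Phase n => x.2.1 i) (by fun_prop))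
            (DifferentiableAt.hasFDerivAt (𝕜 := ℂ) (f := fun x : ℂ × Phase n => x.2.2 i) (by fun_prop))
        simp only [hP]
        rw [h3.fderiv]
        simp
      rw [← fderiv_pi_apply (hKd.differentiableAt hw)]
      have hAd : DifferentiableAt ℂ A (ε, H (ε, 0)) :=
        hA.differentiableAt ((Metric.isOpen_ball.prod Metric.isOpen_ball).mem_nhds
          (hmA _ (horigin ε hε)))
      have hG : HasFDerivAt (fun w : ℂ × Phase n => (w.1, H w))
          ((ContinuousLinearMap.fst ℂ ℂ (Phase n)).prod (fderiv ℂ H (ε, 0))) (ε, 0) :=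
        hasFDerivAt_fst.prodMk (hHd.differentiableAt hw).hasFDerivAt
      have h1 : HasFDerivAt K ((fderiv ℂ A (ε, H (ε, 0))).comp
          ((ContinuousLinearMap.fst ℂ ℂ (Phase n)).prod (fderiv ℂ H (ε, 0)))) (ε, 0) :=
        HasFDerivAt.comp (f := fun w : ℂ × Phase n => (w.1, H w)) (ε, 0) hAd.hasFDerivAt hG
      rw [h1.fderiv, ContinuousLinearMap.comp_apply, ContinuousLinearMap.prod_apply, hHv]
      change fderiv ℂ A (ε, H (ε, 0)) (0, 0) k = 0
      rw [Prod.mk_zero_zero, map_zero]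
      rfl)
    (fun k => differentiableOn_expAngle hS hper (hKd.mono hsub) (fun w hw => hKρ w (hsub hw)) k)
    (fun k w _ => expAngle_ne_zero k w)
    (fun k w hw hw0 => expAngle_of_fst_eq_zero hS hS0 (fun w hw => hKρ w (hsub hw)) hw hw0 k)
    (fun w hw u v => sum_fderiv_expAngle_eq_omegaC hS hper (hKd.mono hsub)
      (fun w hw => hKρ w (hsub hw)) hSP' hw u v)
  refine ⟨A, B, x, y, hA, hB, hAo, hBA, hx, hy, fun w hw => ?_, hxo, hyo, hω⟩
  have h1 : (fun i => x i w * y i w) = A (w.1, H w) := funext fun i => hxy i w hw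
  rw [h1, hBA w.1 (by simpa using hw.1) _
    (mem_ball_zero_iff.2 ((hHb w hw).trans_lt (by linarith))) (hKρ w hw)]
  funext i
  simp only [hH, hP, Pi.add_apply, mul_comm]

end NormalFormWithParameter

section Scaling

theorem isLittleO_norm_sq_of_fderiv_eq_zero {E F : Type} [NormedAddCommGroup E] [NormedSpace ℂ E]
    [NormedAddCommGroup F] [NormedSpace ℂ F] [CompleteSpace F] {r : E → F} (hr : AnalyticAt ℂ r 0)
    (h0 : r 0 = 0) (h1 : fderiv ℂ r 0 = 0) (h2 : fderiv ℂ (fderiv ℂ r) 0 = 0) :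
    r =o[𝓝 0] fun z => ‖z‖ ^ 2 := by
  refine Asymptotics.isLittleO_iff.2 fun c hc => ?_
  have hd := hr.fderiv.differentiableAt.hasFDerivAt
  rw [h2] at hd
  have hl := hd.isLittleO
  simp only [h1, sub_zero, _root_.zero_apply] at hl
  obtain ⟨δ, hδ, hball⟩ := Metric.eventually_nhds_iff_ball.1
    ((Asymptotics.isLittleO_iff.1 hl hc).and hr.eventually_analyticAt)
  filter_upwards [Metric.ball_mem_nhds (0 : E) hδ] with z hz
  have hsub : Metric.closedBall (0 : E) ‖z‖ ⊆ Metric.ball 0 δ :=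
    Metric.closedBall_subset_ball (by simpa using hz)
  have h := (convex_closedBall (0 : E) ‖z‖).norm_image_sub_le_of_norm_fderiv_le (𝕜 := ℂ)
    (f := r) (C := c * ‖z‖) (fun x hx => (hball x (hsub hx)).2.differentiableAt)
    (fun x hx => (hball x (hsub hx)).1.trans
      (mul_le_mul_of_nonneg_left (by simpa using hx) hc.le))
    (x := 0) (y := z) (by simp) (by simp)
  rw [h0, sub_zero, sub_zero] at h
  rw [norm_pow, norm_norm]
  linarith [h, sq ‖z‖, mul_assoc c ‖z‖ ‖z‖]

theorem exists_scaling {E F : Type} [NormedAddCommGroup E] [NormedSpace ℂ E]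
    [FiniteDimensional ℂ E] [NormedAddCommGroup F] [NormedSpace ℂ F] [CompleteSpace F] {r : E → F}
    (hr : AnalyticAt ℂ r 0) (hro : r =o[𝓝 0] fun z => ‖z‖ ^ 2) {V : Set E} (hV : V ∈ 𝓝 0) {c : ℝ}
    (hc : 0 < c) (a : ℝ) :
    ∃ (s : ℝ) (R : ℂ × E → F), 0 < s ∧
      DifferentiableOn ℂ R (Metric.ball 0 1 ×ˢ Metric.ball 0 a) ∧
      (∀ w ∈ Metric.ball (0 : ℂ) 1 ×ˢ Metric.ball (0 : E) a, ‖R w‖ ≤ c) ∧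
      (∀ z ∈ Metric.ball (0 : E) a, R (0, z) = 0) ∧
      ∀ w ∈ Metric.ball (0 : ℂ) 1 ×ˢ Metric.ball (0 : E) a,
        (s * w.1) • w.2 ∈ V ∧ r ((s * w.1) • w.2) = (s * w.1) ^ 2 • R w := by
  obtain ⟨δ, hδ, hball⟩ := Metric.eventually_nhds_iff_ball.1
    (hr.eventually_analyticAt.and (eventually_mem_set.2 hV))
  set W : Set (ℂ × E) := {w | w.1 • w.2 ∈ Metric.ball (0 : E) δ} with hW
  have hWo : IsOpen W := Metric.isOpen_ball.preimage (by fun_prop)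
  have hstar : ∀ p ∈ W, ∀ τ ∈ Set.Icc (0 : ℝ) 1, ((τ : ℂ) * p.1, p.2) ∈ W := by
    intro p hp τ hτ
    simp only [hW, Set.mem_ofPred_eq, mem_ball_zero_iff, norm_smul, norm_mul, Complex.norm_real,
      Real.norm_eq_abs, abs_of_nonneg hτ.1] at hp ⊢
    refine lt_of_le_of_lt ?_ hp
    rw [mul_assoc]
    exact mul_le_of_le_one_left (by positivity) hτ.2
  have hdiv : ∀ k ≤ 3, ∃ g : ℂ × E → F, DifferentiableOn ℂ g W ∧
      ∀ p ∈ W, r (p.1 • p.2) = p.1 ^ k • g p := by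
    intro k hk
    induction k with
    | zero =>
      refine ⟨fun p => r (p.1 • p.2), fun p hp => ?_, fun p _ => by simp⟩
      have h1 : DifferentiableAt ℂ r (p.1 • p.2) := (hball _ hp).1.differentiableAt
      have h2 : DifferentiableAt ℂ (fun p : ℂ × E => p.1 • p.2) p := by fun_prop
      exact (DifferentiableAt.comp (f := fun p : ℂ × E => p.1 • p.2) p h1
        h2).differentiableWithinAt
    | succ k ih =>
      obtain ⟨g, hg, hgr⟩ := ih (by omega)
      obtain ⟨g', hg', hgg'⟩ := exists_eq_add_smul_of_starShaped hWo hstar hg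
      refine ⟨g', hg', fun p hp => ?_⟩
      have hz : g (0, p.2) = 0 := by
        have hmem : ((0 : ℂ), p.2) ∈ W := by simp [hW, hδ]
        have hcg : ContinuousAt (fun ε : ℂ => g (ε, p.2)) 0 :=
          ContinuousAt.comp (f := fun ε : ℂ => (ε, p.2)) (x := 0)
            (hg.continuousOn.continuousAt (hWo.mem_nhds hmem)) (by fun_prop)
        have hlim : Tendsto (fun ε : ℂ => ε • p.2) (𝓝 0) (𝓝 0) := by
          have : ContinuousAt (fun ε : ℂ => ε • p.2) 0 := by fun_prop
          simpa [ContinuousAt] using this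
        have hev : ∀ᶠ ε : ℂ in 𝓝 0, (ε, p.2) ∈ W :=
          (by fun_prop : ContinuousAt (fun ε : ℂ => (ε, p.2)) 0).eventually_mem
            (hWo.mem_nhds hmem)
        refine norm_eq_zero.1 (le_antisymm (le_of_forall_pos_le_add fun η hη => ?_)
          (norm_nonneg _))
        have hη' : 0 < η / (‖p.2‖ ^ 2 + 1) := by positivity
        have hsmall := hlim.eventually (Asymptotics.isLittleO_iff.1 hro hη')
        have hone : ∀ᶠ ε : ℂ in 𝓝 0, ‖ε‖ < 1 := by
          filter_upwards [Metric.ball_mem_nhds (0 : ℂ) one_pos] with ε hε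
          simpa using hε
        refine le_of_tendsto (f := fun ε : ℂ => ‖g (ε, p.2)‖) (x := 𝓝[≠] 0)
          (hcg.norm.tendsto.mono_left nhdsWithin_le_nhds) ?_
        filter_upwards [nhdsWithin_le_nhds hev, nhdsWithin_le_nhds hsmall,
          nhdsWithin_le_nhds hone, self_mem_nhdsWithin] with ε hε1 hε2 hε3 hε0
        have hpos : 0 < ‖ε‖ := norm_pos_iff.2 hε0
        rw [hgr (ε, p.2) hε1, norm_smul, norm_pow, norm_pow, norm_norm, norm_smul, mul_pow] at hε2
        have h1 : ‖ε‖ ^ 2 ≤ ‖ε‖ ^ k := pow_le_pow_of_le_one hpos.le hε3.le (by omega)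
        have h2 : ‖ε‖ ^ k * ‖g (ε, p.2)‖ ≤ ‖ε‖ ^ k * η := by
          refine hε2.trans ?_
          have h3 : η / (‖p.2‖ ^ 2 + 1) * ‖p.2‖ ^ 2 ≤ η := by
            rw [div_mul_eq_mul_div, div_le_iff₀ (by positivity)]
            nlinarith
          calc η / (‖p.2‖ ^ 2 + 1) * (‖ε‖ ^ 2 * ‖p.2‖ ^ 2)
              = ‖ε‖ ^ 2 * (η / (‖p.2‖ ^ 2 + 1) * ‖p.2‖ ^ 2) := by ring
            _ ≤ ‖ε‖ ^ k * η := mul_le_mul h1 h3 (by positivity) (by positivity)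
        rw [zero_add]
        exact le_of_mul_le_mul_left h2 (by positivity)
      rw [hgr p hp, hgg' p hp, hz, zero_add, smul_smul, pow_succ]
  obtain ⟨g, hg, hgr⟩ := hdiv 3 le_rfl
  have : ProperSpace E := FiniteDimensional.proper ℂ E
  set b := max a 1 with hb
  have hb0 : 0 < b := lt_of_lt_of_le one_pos (le_max_right _ _)
  have hδb : 0 < δ / (2 * b) := by positivity
  have hcW : Metric.closedBall (0 : ℂ) (δ / (2 * b)) ×ˢ Metric.closedBall (0 : E) b ⊆ W := by
    rintro ⟨ε, z⟩ ⟨h1, h2⟩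
    simp only [mem_closedBall_zero_iff] at h1 h2
    simp only [hW, Set.mem_ofPred_eq, mem_ball_zero_iff, norm_smul]
    calc ‖ε‖ * ‖z‖ ≤ δ / (2 * b) * b := mul_le_mul h1 h2 (norm_nonneg _) hδb.le
      _ = δ / 2 := by field_simp
      _ < δ := by linarith
  obtain ⟨M, hM⟩ := ((isCompact_closedBall (0 : ℂ) (δ / (2 * b))).prod
    (isCompact_closedBall (0 : E) b)).exists_bound_of_continuousOn (hg.continuousOn.mono hcW)
  have hM0 : 0 ≤ M := (norm_nonneg _).trans (hM 0 ⟨by simp [hδb.le], by simp [hb0.le]⟩)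
  set s := min (δ / (2 * b)) (c / (M + 1)) with hs
  have hs0 : 0 < s := lt_min hδb (by positivity)
  have hmem : ∀ w ∈ Metric.ball (0 : ℂ) 1 ×ˢ Metric.ball (0 : E) a,
      ((s : ℂ) * w.1, w.2) ∈
        Metric.closedBall (0 : ℂ) (δ / (2 * b)) ×ˢ Metric.closedBall (0 : E) b := by
    rintro ⟨ε, z⟩ ⟨h1, h2⟩
    simp only [mem_ball_zero_iff] at h1 h2
    refine ⟨?_, mem_closedBall_zero_iff.2 (h2.le.trans (le_max_left _ _))⟩
    simp only [mem_closedBall_zero_iff, norm_mul, Complex.norm_real, Real.norm_eq_abs,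
      abs_of_pos hs0]
    exact (mul_le_of_le_one_right hs0.le h1.le).trans (min_le_left _ _)
  refine ⟨s, fun w => ((s : ℂ) * w.1) • g ((s : ℂ) * w.1, w.2), hs0, ?_, fun w hw => ?_,
    fun z _ => by simp, fun w hw => ⟨(hball _ (hcW (hmem w hw))).2, ?_⟩⟩
  · refine DifferentiableOn.fun_smul (Differentiable.differentiableOn (by fun_prop)) ?_
    exact hg.comp (f := fun w : ℂ × E => ((s : ℂ) * w.1, w.2))
      (Differentiable.differentiableOn (by fun_prop)) fun w hw => hcW (hmem w hw)
  · have h1 : ‖w.1‖ < 1 := by simpa using hw.1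
    rw [norm_smul, norm_mul, Complex.norm_real, Real.norm_eq_abs, abs_of_pos hs0]
    calc s * ‖w.1‖ * _ ≤ c / (M + 1) * M :=
          mul_le_mul ((mul_le_of_le_one_right hs0.le h1.le).trans (min_le_right _ _))
            (hM _ (hmem w hw)) (norm_nonneg _) (by positivity)
      _ ≤ c := by
          rw [div_mul_eq_mul_div, div_le_iff₀ (by positivity)]
          nlinarith
  · rw [smul_smul, ← pow_succ]
    exact hgr _ (hcW (hmem w hw))

end Scaling

section ScalingOfHamiltonians

theorem fderiv_of_scaling {E F : Type} [NormedAddCommGroup E] [NormedSpace ℂ E]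
    [NormedAddCommGroup F] [NormedSpace ℂ F] {f : E → F} {G : ℂ × E → F} {w : ℂ × E} {s : ℂ}
    (hs : s * w.1 ≠ 0) (hf : DifferentiableAt ℂ f ((s * w.1) • w.2)) (hG : DifferentiableAt ℂ G w)
    (h : ∀ᶠ x in 𝓝 w, f ((s * x.1) • x.2) = (s * x.1) ^ 2 • G x) (v : E) :
    fderiv ℂ G w (0, v) = (s * w.1)⁻¹ • fderiv ℂ f ((s * w.1) • w.2) v := by
  have hi : HasFDerivAt (fun z : E => (w.1, z)) (ContinuousLinearMap.inr ℂ ℂ E) w.2 :=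
    hasFDerivAt_prodMk_right w.1 w.2
  have h1 : HasFDerivAt (fun z : E => (s * w.1) ^ 2 • G (w.1, z))
      ((s * w.1) ^ 2 • (fderiv ℂ G w).comp (ContinuousLinearMap.inr ℂ ℂ E)) w.2 :=
    (HasFDerivAt.comp (f := fun z : E => (w.1, z)) w.2 hG.hasFDerivAt hi).const_smul _
  have h2 : HasFDerivAt (fun z : E => f ((s * w.1) • z))
      ((fderiv ℂ f ((s * w.1) • w.2)).comp ((s * w.1) • ContinuousLinearMap.id ℂ E)) w.2 :=
    HasFDerivAt.comp (f := fun z : E => (s * w.1) • z) w.2 hf.hasFDerivAt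
      ((hasFDerivAt_id w.2).const_smul (s * w.1))
  have h3 : (fun z : E => (s * w.1) ^ 2 • G (w.1, z)) =ᶠ[𝓝 w.2]
      fun z => f ((s * w.1) • z) := by
    have := hi.continuousAt.tendsto.eventually h
    filter_upwards [this] with z hz using hz.symm
  have h4 := congrArg (fun L : E →L[ℂ] F => L v) (h1.unique (h2.congr_of_eventuallyEq h3))
  simp only [_root_.smul_apply, ContinuousLinearMap.comp_apply, ContinuousLinearMap.inr_apply,
    ContinuousLinearMap.id_apply, map_smul] at h4
  rw [eq_inv_smul_iff₀ hs]
  refine smul_right_injective F hs ?_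
  simp only [smul_smul, ← sq]
  rw [h4]

variable {n : ℕ}

theorem paramBracket_eq_zero_of_scaling {f g : Phase n → ℂ} {F G : ℂ × Phase n → ℂ}
    {w : ℂ × Phase n} {s : ℂ} (hs : s * w.1 ≠ 0)
    (hf : DifferentiableAt ℂ f ((s * w.1) • w.2)) (hg : DifferentiableAt ℂ g ((s * w.1) • w.2))
    (hF : DifferentiableAt ℂ F w) (hG : DifferentiableAt ℂ G w)
    (hfF : ∀ᶠ x in 𝓝 w, f ((s * x.1) • x.2) = (s * x.1) ^ 2 • F x)
    (hgG : ∀ᶠ x in 𝓝 w, g ((s * x.1) • x.2) = (s * x.1) ^ 2 • G x)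
    (hfg : poisson f g ((s * w.1) • w.2) = 0) : paramBracket F G w = 0 := by
  have h : paramBracket F G w = -((s * w.1)⁻¹ ^ 2 * poisson f g ((s * w.1) • w.2)) := by
    unfold paramBracket poisson
    rw [Finset.mul_sum, ← Finset.sum_neg_distrib]
    refine Finset.sum_congr rfl fun l _ => ?_
    simp only [qDir, pDir, fderiv_of_scaling hs hf hF hfF, fderiv_of_scaling hs hg hG hgG,
      smul_eq_mul]
    ring
  rw [h, hfg, mul_zero, neg_zero]

theorem exists_scaled_normal_form (H : Phase n → Fin n → ℂ) (hH : AnalyticAt ℂ H 0)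
    (hcomm : ∀ i j, ∀ᶠ z in 𝓝 (0 : Phase n),
      poisson (fun w => H w i) (fun w => H w j) z = 0)
    (hr : ∀ i, VanishesToOrder3 (fun z => H z i - z.2 i * z.1 i)) :
    ∃ (s : ℂ) (A B : (Fin n → ℂ) → Fin n → ℂ) (χ : Phase n → Phase n), s ≠ 0 ∧
      AnalyticAt ℂ A 0 ∧ A 0 = 0 ∧ AnalyticAt ℂ B 0 ∧ (∀ᶠ h in 𝓝 0, B (A h) = h) ∧
      AnalyticAt ℂ χ 0 ∧ χ 0 = 0 ∧
      (∀ᶠ z in 𝓝 (0 : Phase n), ∀ u v : Phase n,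
        omegaC (fderiv ℂ χ z u) (fderiv ℂ χ z v) = omegaC u v) ∧
      ∀ᶠ z in 𝓝 (0 : Phase n), H (s • z) = s ^ 2 • B (fun i => (χ z).2 i * (χ z).1 i) := by
  set r : Phase n → Fin n → ℂ := fun z i => H z i - z.2 i * z.1 i with hrdef
  have hHi : ∀ i, AnalyticAt ℂ (fun z => H z i) 0 := analyticAt_pi_iff.1 hH
  have hri : ∀ i, AnalyticAt ℂ (fun z => r z i) 0 := fun i => by
    have h1 : AnalyticAt ℂ (fun z : Phase n => z.2 i * z.1 i) 0 := by
      refine DifferentiableOn.analyticAt_of_isOpen (U := Set.univ) ?_ isOpen_univ (Set.mem_univ _)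
      exact Differentiable.differentiableOn (by fun_prop)
    exact (hHi i).fun_sub h1
  have hra : AnalyticAt ℂ r 0 := analyticAt_pi_iff.2 hri
  have hro : r =o[𝓝 0] fun z => ‖z‖ ^ 2 := Asymptotics.isLittleO_pi.2 fun i =>
    isLittleO_norm_sq_of_fderiv_eq_zero (hri i) (hr i).1 (hr i).2.1 (hr i).2.2
  have hr0 : r 0 = 0 := funext fun i => (hr i).1
  have hrd0 : fderiv ℂ r 0 = 0 := by
    refine ContinuousLinearMap.ext fun v => ?_
    funext i
    rw [fderiv_pi_apply hra.differentiableAt]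
    exact congrArg (fun L : Phase n →L[ℂ] ℂ => L v) (hr i).2.1
  obtain ⟨s, R, hs, hR, hRb, hR0, hRs⟩ := exists_scaling hra hro
    (V := {z | AnalyticAt ℂ H z ∧ ∀ i j, poisson (fun w => H w i) (fun w => H w j) z = 0})
    (hH.eventually_analyticAt.and (eventually_all.2 fun i => eventually_all.2 fun j => hcomm i j))
    (c := 1 / 32) (by norm_num) 8
  set U := Metric.ball (0 : ℂ) 1 ×ˢ Metric.ball (0 : Phase n) 8 with hU
  have hUo : IsOpen U := Metric.isOpen_ball.prod Metric.isOpen_ball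
  have hs0 : (s : ℂ) ≠ 0 := by exact_mod_cast hs.ne'
  have hHs : ∀ i, ∀ w ∈ U,
      H ((s * w.1) • w.2) i = (s * w.1) ^ 2 • (w.2.2 i * w.2.1 i + R w i) := by
    intro i w hw
    have h := congrFun (hRs w hw).2 i
    simp only [hrdef, Prod.smul_fst, Prod.smul_snd, Pi.smul_apply, smul_eq_mul] at h ⊢
    linear_combination h
  have hRi : ∀ i, DifferentiableOn ℂ (fun w => R w i) U := fun i w hw =>
    differentiableWithinAt_pi.1 (hR w hw) i
  have hFd : ∀ i, DifferentiableOn ℂ (fun x : ℂ × Phase n => x.2.2 i * x.2.1 i + R x i) U :=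
    fun i => (Differentiable.differentiableOn (by fun_prop)).fun_add (hRi i)
  have hF0 : ∀ i, ∀ x ∈ U, x.1 = 0 → x.2.2 i * x.2.1 i + R x i = x.2.1 i * x.2.2 i := by
    intro i x hx hx0
    have : R x = 0 := by rw [← hR0 x.2 hx.2, ← hx0]
    rw [this, Pi.zero_apply, add_zero, mul_comm]
  have horigin : ∀ ε ∈ Metric.ball (0 : ℂ) 1, (ε, (0 : Phase n)) ∈ U := fun ε hε =>
    ⟨hε, by simp⟩
  obtain ⟨A, B, x, y, hA, hB, hAo, hBA, hx, hy, hBxy, hxo, hyo, hω⟩ :=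
    exists_normal_form_with_parameter hR hRb (by norm_num) (by norm_num) hR0
    (fun ε hε => by
      by_cases h0 : ε = 0
      · rw [h0]; exact hR0 0 (by simp)
      · have h := (hRs _ (horigin ε hε)).2
        simp only [smul_zero, hr0] at h
        exact (smul_eq_zero.1 h.symm).resolve_left (pow_ne_zero 2 (mul_ne_zero hs0 h0)))
    (fun ε hε v => by
      have hm := horigin ε hε
      by_cases h0 : ε = 0
      · subst h0
        funext i
        rw [fderiv_pi_apply (hR.differentiableAt (hUo.mem_nhds hm)),
          fderiv_apply_eq_of_eq_slice hUo hm ((hRi i).differentiableAt (hUo.mem_nhds hm))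
            (differentiableAt_const 0) rfl rfl (fun y hy hy0 => by
              rw [← Pi.zero_apply (M := fun _ => ℂ) i, ← hR0 y.2 hy.2, ← hy0])]
        simp
      · rw [fderiv_of_scaling (f := r) (s := (s : ℂ)) (mul_ne_zero hs0 h0)
          (by rw [smul_zero]; exact hra.differentiableAt)
          (hR.differentiableAt (hUo.mem_nhds hm))
          (eventually_of_mem (hUo.mem_nhds hm) fun x hx => (hRs x hx).2) v, smul_zero, hrd0]
        simp)
    (fun w hw i j => by
      by_cases h0 : w.1 = 0
      · rw [paramBracket_of_slice_eq_q_mul_p (k := i) hUo (hFd i) (hF0 i) hw h0]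
        have hd : ∀ v : ℂ × Phase n, v.1 = 0 → _ := fun v hv =>
          fderiv_apply_eq_of_eq_slice (v := v) hUo hw ((hFd j).differentiableAt (hUo.mem_nhds hw))
            (K' := fun x : ℂ × Phase n => x.2.1 j * x.2.2 j) (by fun_prop) h0 hv (hF0 j)
        rw [hd (qDir i) rfl, hd (pDir i) rfl, (fderiv_q_mul_p w).1, (fderiv_q_mul_p w).2]
        by_cases hij : j = i
        · subst hij; ring
        · simp [hij]
      · have hV := (hRs w hw).1
        exact paramBracket_eq_zero_of_scaling (f := fun z => H z i) (g := fun z => H z j)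
          (s := (s : ℂ)) (mul_ne_zero hs0 h0)
          (analyticAt_pi_iff.1 hV.1 i).differentiableAt (analyticAt_pi_iff.1 hV.1 j).differentiableAt
          ((hFd i).differentiableAt (hUo.mem_nhds hw)) ((hFd j).differentiableAt (hUo.mem_nhds hw))
          (eventually_of_mem (hUo.mem_nhds hw) (hHs i))
          (eventually_of_mem (hUo.mem_nhds hw) (hHs j)) (hV.2 i j))
  have hslice : ∀ {E F : Type} [NormedAddCommGroup E] [NormedSpace ℂ E] [FiniteDimensional ℂ E]
      [NormedAddCommGroup F] [NormedSpace ℂ F] [CompleteSpace F] {f : ℂ × E → F}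
      {S : Set (ℂ × E)} (z : E), DifferentiableOn ℂ f S → IsOpen S → ((1 / 2 : ℂ), z) ∈ S →
      AnalyticAt ℂ (fun z => f (1 / 2, z)) z := by
    intro E F _ _ _ _ _ _ f S z hf hS hz
    refine DifferentiableOn.analyticAt_of_isOpen (U := {z | ((1 / 2 : ℂ), z) ∈ S}) ?_
      (hS.preimage (by fun_prop)) hz
    exact hf.comp (f := fun z : E => ((1 / 2 : ℂ), z))
      (Differentiable.differentiableOn (by fun_prop)) fun z hz => hz
  have hhalf : (1 / 2 : ℂ) ∈ Metric.ball (0 : ℂ) 1 := by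
    rw [mem_ball_zero_iff]; norm_num
  have hhalf' : ‖(1 / 2 : ℂ)‖ < 1 := by simpa using hhalf
  have hann : IsOpen (annularDomain (n := n) Finset.univ) := isOpen_annularDomain _
  have hann0 : ((1 / 2 : ℂ), (0 : Phase n)) ∈ annularDomain (n := n) Finset.univ :=
    mem_annularDomain_univ.2 ⟨hhalf', by simp, by simp⟩
  have hmem : ∀ᶠ z in 𝓝 (0 : Phase n), ((1 / 2 : ℂ), z) ∈ annularDomain (n := n) Finset.univ :=
    (hann.preimage (f := fun z : Phase n => ((1 / 2 : ℂ), z)) (by fun_prop)).mem_nhds hann0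
  have hAan : AnalyticAt ℂ (fun h => A (1 / 2, h)) 0 :=
    hslice 0 hA (Metric.isOpen_ball.prod Metric.isOpen_ball) ⟨hhalf, by simp⟩
  refine ⟨s * (1 / 2), fun h => A (1 / 2, h), fun h => B (1 / 2, h),
    fun z => (fun i => x i (1 / 2, z), fun i => y i (1 / 2, z)), mul_ne_zero hs0 (by norm_num),
    hAan, hAo _, hslice 0 hB (Metric.isOpen_ball.prod Metric.isOpen_ball) ⟨hhalf, by simp⟩,
    ?_, ?_, ?_, ?_, ?_⟩
  · have h := hAan.continuousAt.eventually_mem (s := Metric.ball 0 (1 / 4)) (by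
      rw [hAo]; exact Metric.ball_mem_nhds _ (by norm_num))
    filter_upwards [h, Metric.ball_mem_nhds (0 : Fin n → ℂ) (by norm_num : (0 : ℝ) < 1 / 2)]
      with a ha ha'
    exact hBA _ hhalf a ha' ha
  · exact (analyticAt_pi_iff.2 fun i => hslice 0 (hx i) hann hann0).prod
      (analyticAt_pi_iff.2 fun i => hslice 0 (hy i) hann hann0)
  · exact Prod.ext (funext fun i => hxo i _ hhalf') (funext fun i => hyo i _ hhalf')
  · filter_upwards [hmem] with z hz u v
    have hd : ∀ f : ℂ × Phase n → ℂ, DifferentiableOn ℂ f (annularDomain Finset.univ) →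
        HasFDerivAt (fun z => f (1 / 2, z))
          ((fderiv ℂ f (1 / 2, z)).comp (ContinuousLinearMap.inr ℂ ℂ (Phase n))) z := fun f hf =>
      HasFDerivAt.comp (f := fun z : Phase n => ((1 / 2 : ℂ), z)) z
        (hf.differentiableAt (hann.mem_nhds hz)).hasFDerivAt (hasFDerivAt_prodMk_right _ z)
    have hχ := ((hasFDerivAt_pi.2 fun i => hd _ (hx i)).prodMk
      (hasFDerivAt_pi.2 fun i => hd _ (hy i))).fderiv
    rw [hχ, ← hω _ hz u v]
    unfold omegaC
    refine Finset.sum_congr rfl fun i _ => ?_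
    change fderiv ℂ (x i) (1 / 2, z) (0, u) * fderiv ℂ (y i) (1 / 2, z) (0, v) -
      fderiv ℂ (y i) (1 / 2, z) (0, u) * fderiv ℂ (x i) (1 / 2, z) (0, v) = _
    ring
  · filter_upwards [hmem, Metric.ball_mem_nhds (0 : Phase n) (by norm_num : (0 : ℝ) < 8)]
      with z hz hz8
    have h := hBxy _ hz
    simp only [mul_comm (y _ _)]
    rw [h]
    funext i
    rw [Pi.smul_apply]
    exact hHs i ((1 / 2 : ℂ), z) ⟨hhalf, hz8⟩

end ScalingOfHamiltonians

section LocalInverse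

variable {n : ℕ}

theorem exists_symplectic_right_inverse {χ : Phase n → Phase n} (hχ : AnalyticAt ℂ χ 0)
    (h0 : χ 0 = 0) (hω : ∀ᶠ z in 𝓝 (0 : Phase n), ∀ u v : Phase n,
      omegaC (fderiv ℂ χ z u) (fderiv ℂ χ z v) = omegaC u v) :
    ∃ g : Phase n → Phase n, IsSymplectoGerm g ∧ ∀ᶠ z in 𝓝 0, χ (g z) = z := by
  have hinj : Function.Injective (fderiv ℂ χ 0).toLinearMap :=
    injective_of_omegaC_map_eq hω.self_of_nhds
  let e : Phase n ≃L[ℂ] Phase n :=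
    (LinearEquiv.ofInjectiveEndo (fderiv ℂ χ 0).toLinearMap hinj).toContinuousLinearEquiv
  have he : (e : Phase n →L[ℂ] Phase n) = fderiv ℂ χ 0 := ContinuousLinearMap.ext fun v => rfl
  have hs : HasStrictFDerivAt χ (e : Phase n →L[ℂ] Phase n) 0 := by
    rw [he]; exact hχ.hasStrictFDerivAt
  let P := hs.toOpenPartialHomeomorph χ
  have hP0 : (0 : Phase n) ∈ P.source := hs.mem_toOpenPartialHomeomorph_source
  have hPχ : (P : Phase n → Phase n) = χ := hs.toOpenPartialHomeomorph_coe
  have hg0 : P.symm 0 = 0 := by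
    have := P.left_inv hP0
    rwa [hPχ, h0] at this
  have ht : (0 : Phase n) ∈ P.target := by
    have := P.map_source hP0
    rwa [hPχ, h0] at this
  have hga : AnalyticAt ℂ P.symm 0 := by
    refine P.analyticAt_symm (i := e) ?_ ?_ ?_
    · exact ht
    · rw [hg0, hPχ]; exact hχ
    · rw [hg0, hPχ, he]
  have hinv : ∀ᶠ z in 𝓝 (0 : Phase n), χ (P.symm z) = z := by
    filter_upwards [P.open_target.mem_nhds ht] with z hz
    rw [← hPχ]; exact P.right_inv hz
  have hgc : Tendsto P.symm (𝓝 0) (𝓝 0) := by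
    have := hga.continuousAt.tendsto
    rwa [hg0] at this
  refine ⟨P.symm, ⟨hga, hg0, ?_⟩, hinv⟩
  filter_upwards [hgc.eventually hω, hgc.eventually hχ.eventually_analyticAt,
    hga.eventually_analyticAt, hinv.eventually_nhds] with z hz hχz hgz hzi u v
  have hc := (hχz.differentiableAt.hasFDerivAt.comp z hgz.differentiableAt.hasFDerivAt)
  have hid := hc.unique ((hasFDerivAt_id z).congr_of_eventuallyEq hzi)
  have hv : ∀ v, fderiv ℂ χ (P.symm z) (fderiv ℂ P.symm z v) = v := fun v =>
    congrArg (fun L : Phase n →L[ℂ] Phase n => L v) hid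
  rw [← hz, hv, hv]

theorem isUnit_fderiv_of_eventually_leftInverse {E : Type} [NormedAddCommGroup E]
    [NormedSpace ℂ E] [FiniteDimensional ℂ E] {A B : E → E} (hA : AnalyticAt ℂ A 0)
    (hA0 : A 0 = 0) (hB : AnalyticAt ℂ B 0) (h : ∀ᶠ x in 𝓝 0, B (A x) = x) :
    IsUnit (fderiv ℂ B 0) := by
  have hBA : HasFDerivAt B (fderiv ℂ B 0) (A 0) := by
    rw [hA0]; exact hB.differentiableAt.hasFDerivAt
  have h1 : fderiv ℂ B 0 * fderiv ℂ A 0 = 1 :=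
    (hBA.comp 0 hA.differentiableAt.hasFDerivAt).unique
      ((hasFDerivAt_id (0 : E)).congr_of_eventuallyEq h)
  have h2 : (fderiv ℂ A 0).toLinearMap * (fderiv ℂ B 0).toLinearMap = 1 := by
    refine mul_eq_one_comm.1 (LinearMap.ext fun v => ?_)
    exact congrArg (fun L : E →L[ℂ] E => L v) h1
  refine ⟨⟨fderiv ℂ B 0, fderiv ℂ A 0, h1, ContinuousLinearMap.ext fun v => ?_⟩, rfl⟩
  exact congrArg (fun L : E →ₗ[ℂ] E => L v) h2

theorem IsSymplectoGerm.conj_smul {g : Phase n → Phase n} (hg : IsSymplectoGerm g) {s : ℂ}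
    (hs : s ≠ 0) : IsSymplectoGerm fun z => s • g (s⁻¹ • z) := by
  have ht : Tendsto (fun z : Phase n => s⁻¹ • z) (𝓝 0) (𝓝 0) := by
    have : Continuous fun z : Phase n => s⁻¹ • z := by fun_prop
    simpa using this.tendsto 0
  refine ⟨?_, by simp [hg.2.1], ?_⟩
  · have hl : AnalyticAt ℂ (fun z : Phase n => s⁻¹ • z) 0 :=
      analyticAt_id.fun_const_smul
    have hgl : AnalyticAt ℂ (fun z : Phase n => g (s⁻¹ • z)) 0 :=
      AnalyticAt.fun_comp (by rw [smul_zero]; exact hg.1) hl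
    exact AnalyticAt.fun_const_smul hgl
  · filter_upwards [ht.eventually hg.2.2, ht.eventually hg.1.eventually_analyticAt]
      with z hz hza u v
    have hd : HasFDerivAt (fun z => s • g (s⁻¹ • z)) (fderiv ℂ g (s⁻¹ • z)) z := by
      have h1 := (HasFDerivAt.comp (f := fun z : Phase n => s⁻¹ • z) z
        hza.differentiableAt.hasFDerivAt ((hasFDerivAt_id z).const_smul s⁻¹)).const_smul s
      refine h1.congr_fderiv (ContinuousLinearMap.ext fun v => ?_)
      change s • fderiv ℂ g (s⁻¹ • z) (s⁻¹ • v) = _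
      rw [map_smul, smul_smul, mul_inv_cancel₀ hs, one_smul]
    rw [hd.fderiv, hz]

end LocalInverse

/-- **The Rüssmann–Vey theorem.**  Let `H = (H₁, …, H_n) : (ℂ^{2n},0) → (ℂⁿ,0)` be a
holomorphic germ with pairwise Poisson-commuting components such that
`H_i = p_i q_i + r_i` with `r_i ∈ 𝔪³`.  Then there exist a symplectomorphism germ `φ`
of `(ℂ^{2n},0)` and a biholomorphism germ `ψ` of `(ℂⁿ,0)` with
`H ∘ φ = ψ(p₁q₁, …, p_n q_n)` near `0`. -/
theorem russmann_vey
    {n : ℕ} (H : Phase n → (Fin n → ℂ)) (hH : AnalyticAt ℂ H 0)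
    (hcomm : ∀ i j, ∀ᶠ z in 𝓝 (0 : Phase n),
      poisson (fun w => H w i) (fun w => H w j) z = 0)
    (hr : ∀ i, VanishesToOrder3 (fun z => H z i - z.2 i * z.1 i)) :
    ∃ φ : Phase n → Phase n, ∃ ψ : (Fin n → ℂ) → (Fin n → ℂ),
      IsSymplectoGerm φ ∧
      AnalyticAt ℂ ψ 0 ∧ ψ 0 = 0 ∧ IsUnit (fderiv ℂ ψ 0) ∧
      ∀ᶠ z in 𝓝 (0 : Phase n), H (φ z) = ψ (fun i => z.2 i * z.1 i) := by
  obtain ⟨s, A, B, χ, hs, hA, hA0, hB, hBA, hχ, hχ0, hω, hHs⟩ :=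
    exists_scaled_normal_form H hH hcomm hr
  obtain ⟨g, hg, hχg⟩ := exists_symplectic_right_inverse hχ hχ0 hω
  have hs2 : s ^ 2 ≠ 0 := pow_ne_zero 2 hs
  have hB0 : B 0 = 0 := by simpa [hA0] using hBA.self_of_nhds
  have hψ : HasFDerivAt (fun a => s ^ 2 • B ((s ^ 2)⁻¹ • a)) (fderiv ℂ B 0) 0 := by
    have hd : HasFDerivAt B (fderiv ℂ B 0) ((s ^ 2)⁻¹ • (0 : Fin n → ℂ)) := by
      rw [smul_zero]; exact hB.differentiableAt.hasFDerivAt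
    have h1 := (HasFDerivAt.comp (f := fun a : Fin n → ℂ => (s ^ 2)⁻¹ • a) 0 hd
      ((hasFDerivAt_id (0 : Fin n → ℂ)).const_smul (s ^ 2)⁻¹)).const_smul (s ^ 2)
    refine h1.congr_fderiv (ContinuousLinearMap.ext fun v => ?_)
    change s ^ 2 • fderiv ℂ B 0 ((s ^ 2)⁻¹ • v) = _
    rw [map_smul, smul_smul, mul_inv_cancel₀ hs2, one_smul]
  refine ⟨fun z => s • g (s⁻¹ • z), fun a => s ^ 2 • B ((s ^ 2)⁻¹ • a), hg.conj_smul hs, ?_,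
    by simp [hB0], ?_, ?_⟩
  · have hl : AnalyticAt ℂ (fun a : Fin n → ℂ => (s ^ 2)⁻¹ • a) 0 :=
      analyticAt_id.fun_const_smul
    have hBl : AnalyticAt ℂ (fun a : Fin n → ℂ => B ((s ^ 2)⁻¹ • a)) 0 :=
      AnalyticAt.fun_comp (by rw [smul_zero]; exact hB) hl
    exact AnalyticAt.fun_const_smul hBl
  · rw [hψ.fderiv]
    exact isUnit_fderiv_of_eventually_leftInverse hA hA0 hB hBA
  · have ht : Tendsto (fun z : Phase n => s⁻¹ • z) (𝓝 0) (𝓝 0) := by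
      have : Continuous fun z : Phase n => s⁻¹ • z := by fun_prop
      simpa using this.tendsto 0
    have hgt : Tendsto g (𝓝 0) (𝓝 0) := by
      simpa [hg.2.1] using hg.1.continuousAt.tendsto
    filter_upwards [ht.eventually hχg, (hgt.comp ht).eventually hHs] with z h1 h2
    simp only [Function.comp_apply, h1] at h2
    rw [h2]
    congr 2
    funext i
    simp only [Prod.smul_fst, Prod.smul_snd, Pi.smul_apply, smul_eq_mul]
    ring
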